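/- Fix a real number p > 2. There exist constants K > 0 and c₀ > 0, depending only on p, such that for every integer n ≥ 2, every 0 < ε < 1, and every δ with 2^{−n^{c₀}} ≤ δ ≤ 7/8, there exist an integer r with r ≤ K · min( n , n^{1−2/p} ( ε^{−2} log(1/δ) + ε^{−4/p} (log(1/δ))^{2/p} log n ) ) and an (ε,δ)-sketching scheme (ρ, f) for F_p on ℝⁿ with sketching dimension r. -/

import Mathlib

open MeasureTheory

/-- `F_p(x) = ∑ i |x_i|^p`. -/
noncomputable def Fp (p : ℝ) {n : ℕ} (x : Fin n → ℝ) : ℝ := ∑ i, |x i| ^ p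

/-- `(ρ, f)` is an `(ε,δ)`-sketching scheme for `F_p` on `ℝⁿ` with sketching dimension `r`:
`ρ` is a Borel probability measure on real `r × n` matrices (modeled as `Fin r → Fin n → ℝ`),
`f` is measurable, and for every `x`, with `ρ`-probability at least `1 - δ` over `S` one has
`|f(S, S·x) − ‖x‖_p^p| ≤ ε·‖x‖_p^p`. -/
def IsSketchingScheme (p : ℝ) (n r : ℕ) (ε δ : ℝ)
    (ρ : Measure (Fin r → Fin n → ℝ))
    (f : (Fin r → Fin n → ℝ) → (Fin r → ℝ) → ℝ) : Prop :=
  IsProbabilityMeasure ρ ∧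
  Measurable (fun q : (Fin r → Fin n → ℝ) × (Fin r → ℝ) => f q.1 q.2) ∧
  ∀ x : Fin n → ℝ,
    ENNReal.ofReal (1 - δ) ≤
      ρ {S | |f S (fun k => ∑ i, S k i * x i) - Fp p x| ≤ ε * Fp p x}

namespace FpSketch

open ProbabilityTheory Real

/-- The standard Gaussian measure on `ℝ`. -/
noncomputable abbrev stdG : Measure ℝ := gaussianReal 0 1

/-- The standard Gaussian measure on `ι → ℝ`. -/
noncomputable abbrev gaussPi (ι : Type*) [Fintype ι] : Measure (ι → ℝ) :=
  Measure.pi fun _ => stdG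

lemma charFunDual_gaussPi {ι : Type*} [Fintype ι] [DecidableEq ι] (L : StrongDual ℝ (ι → ℝ)) :
    charFunDual (gaussPi ι) L = Complex.exp (-(∑ i, L (Pi.single i 1) ^ 2 : ℝ) / 2) := by
  rw [charFunDual_pi]
  have h : ∀ i, charFunDual stdG (L.comp (.single ℝ (fun _ : ι => ℝ) i))
      = Complex.exp (-(L (Pi.single i 1) ^ 2 : ℝ) / 2) := by
    intro i
    have h1 := charFun_gaussianReal (μ := 0) (v := 1) (L (Pi.single i 1))
    rw [charFunDual_apply]
    rw [charFun_apply] at h1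
    have h2 : ∀ v : ℝ, (L.comp (.single ℝ (fun _ : ι => ℝ) i)) v = L (Pi.single i 1) * v := by
      intro v
      have : Pi.single i v = v • (Pi.single i 1 : ι → ℝ) := by
        ext j; by_cases hj : j = i
        · subst hj; simp
        · simp [hj]
      simp [this, mul_comm]
    simp_rw [h2]
    have h3 : ∀ v : ℝ, inner ℝ v (L (Pi.single i 1)) = L (Pi.single i 1) * v := by
      intro v; simp [inner]
    simp_rw [h3] at h1
    rw [h1]; congr 1; push_cast; simp
    ring
  simp_rw [h]
  rw [← Complex.exp_sum]
  congr 1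
  push_cast
  rw [← Finset.sum_div, Finset.sum_neg_distrib]

/-- A linear map whose adjoint is isometric pushes a standard Gaussian to a standard Gaussian. -/
lemma map_gaussPi {ι κ : Type*} [Fintype ι] [Fintype κ]
    (f : (ι → ℝ) →ₗ[ℝ] (κ → ℝ))
    (hf : ∀ u : κ → ℝ, ∃ w : ι → ℝ, (∀ x, ∑ k, u k * f x k = ∑ i, w i * x i) ∧
      ∑ i, w i ^ 2 = ∑ k, u k ^ 2) :
    (gaussPi ι).map f = gaussPi κ := by
  classical
  have hc : Continuous f := f.continuous_of_finiteDimensional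
  have : IsProbabilityMeasure ((gaussPi ι).map f) :=
    Measure.isProbabilityMeasure_map hc.measurable.aemeasurable
  apply Measure.ext_of_charFunDual
  ext L
  let F : (ι → ℝ) →L[ℝ] (κ → ℝ) := ⟨f, hc⟩
  have h1 : charFunDual ((gaussPi ι).map f) L = charFunDual (gaussPi ι) (L.comp F) := by
    simp_rw [charFunDual_apply]
    rw [integral_map hc.measurable.aemeasurable]
    · rfl
    · exact Continuous.aestronglyMeasurable (by fun_prop)
  rw [h1, charFunDual_gaussPi, charFunDual_gaussPi]
  obtain ⟨w, hw1, hw2⟩ := hf (fun k => L (Pi.single k 1))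
  have hL : ∀ y : κ → ℝ, L y = ∑ k, L (Pi.single k 1) * y k := by
    intro y
    conv_lhs => rw [pi_eq_sum_univ' y]
    rw [map_sum]
    refine Finset.sum_congr rfl fun k _ => ?_
    rw [map_smul, smul_eq_mul, mul_comm]
  rw [← hw2]
  congr 4
  refine Finset.sum_congr rfl fun i _ => ?_
  have : (L.comp F) (Pi.single i 1) = L (f (Pi.single i 1)) := rfl
  rw [this, hL, hw1]
  simp [Pi.single_apply]

/-- Chernoff bound for sums of independent variables. -/
lemma chernoff {ι Ω : Type*} [Fintype ι] [MeasurableSpace Ω] (ν : ι → Measure Ω)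
    [∀ i, IsProbabilityMeasure (ν i)] (f : ι → Ω → ℝ) (c : ι → ℝ)
    (hi : ∀ i, Integrable (fun w => exp (f i w)) (ν i))
    (hc : ∀ i, ∫ w, exp (f i w) ∂(ν i) ≤ exp (c i)) (t : ℝ) :
    (Measure.pi ν).real {w | t ≤ ∑ i, f i (w i)} ≤ exp (∑ i, c i - t) := by
  have hI : Integrable (fun w : ι → Ω => ∏ i, exp (f i (w i))) (Measure.pi ν) :=
    Integrable.fintype_prod hi
  have h1 := mul_meas_ge_le_integral_of_nonneg (μ := Measure.pi ν)
    (f := fun w : ι → Ω => ∏ i, exp (f i (w i)))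
    (ae_of_all _ fun w => Finset.prod_nonneg fun i _ => (exp_pos _).le) hI (exp t)
  rw [integral_fintype_prod_eq_prod (μ := ν) (fun i w => exp (f i w))] at h1
  have h2 : ∏ i, ∫ w, exp (f i w) ∂(ν i) ≤ exp (∑ i, c i) := by
    rw [exp_sum]
    exact Finset.prod_le_prod (fun i _ => integral_nonneg fun w => (exp_pos _).le) fun i _ => hc i
  have h3 : {w : ι → Ω | exp t ≤ ∏ i, exp (f i (w i))} = {w | t ≤ ∑ i, f i (w i)} := by
    ext w; simp [← exp_sum]
  rw [h3] at h1
  rw [exp_sub, le_div_iff₀ (exp_pos _), mul_comm]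
  exact h1.trans h2

lemma integrable_exp_mul_stdG (a : ℝ) : Integrable (fun g => exp (a * g)) stdG :=
  integrable_exp_mul_gaussianReal a

lemma integral_exp_mul_stdG (a : ℝ) : ∫ g, exp (a * g) ∂stdG = exp (a ^ 2 / 2) := by
  have := congrFun (mgf_fun_id_gaussianReal (μ := 0) (v := 1)) a
  simpa [mgf] using this

lemma exp_mul_abs_le (a g : ℝ) : exp (a * |g|) ≤ exp (a * g) + exp (-a * g) := by
  rcases abs_cases g with ⟨h, _⟩ | ⟨h, _⟩ <;> rw [h]
  · linarith [exp_pos (-a * g)]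
  · rw [show a * -g = -a * g by ring]; linarith [exp_pos (a * g)]

lemma integrable_exp_mul_abs_stdG (a : ℝ) : Integrable (fun g => exp (a * |g|)) stdG := by
  refine ((integrable_exp_mul_stdG a).add (integrable_exp_mul_stdG (-a))).mono'
    (by fun_prop) (ae_of_all _ fun g => ?_)
  rw [norm_of_nonneg (exp_pos _).le]
  exact exp_mul_abs_le a g

lemma integral_exp_mul_abs_stdG_le (a : ℝ) :
    ∫ g, exp (a * |g|) ∂stdG ≤ 2 * exp (a ^ 2 / 2) := by
  calc ∫ g, exp (a * |g|) ∂stdG ≤ ∫ g, (exp (a * g) + exp (-a * g)) ∂stdG :=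
        integral_mono (integrable_exp_mul_abs_stdG a)
          ((integrable_exp_mul_stdG a).add (integrable_exp_mul_stdG (-a)))
          fun g => exp_mul_abs_le a g
    _ = 2 * exp (a ^ 2 / 2) := by
        rw [integral_add (integrable_exp_mul_stdG a) (integrable_exp_mul_stdG (-a)),
          integral_exp_mul_stdG, integral_exp_mul_stdG]
        ring_nf

lemma tail_stdG {a : ℝ} (ha : 0 ≤ a) : stdG.real {g | a ≤ |g|} ≤ 2 * exp (-(a ^ 2 / 2)) := by
  have h1 := mul_meas_ge_le_integral_of_nonneg (μ := stdG)
    (f := fun g => exp (a * |g|)) (ae_of_all _ fun w => (exp_pos _).le)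
    (integrable_exp_mul_abs_stdG a) (exp (a * a))
  have h2 := h1.trans (integral_exp_mul_abs_stdG_le a)
  have h3 : stdG.real {g | a ≤ |g|} ≤ stdG.real {g | exp (a * a) ≤ exp (a * |g|)} := by
    refine measureReal_mono fun g (hg : a ≤ |g|) => ?_
    change exp (a * a) ≤ exp (a * |g|)
    gcongr
  have h4 : 2 * exp (-(a ^ 2 / 2)) = (2 * exp (a ^ 2 / 2)) / exp (a * a) := by
    rw [mul_div_assoc, ← exp_sub]; ring_nf
  rw [h4, le_div_iff₀ (exp_pos _), mul_comm]
  exact (mul_le_mul_of_nonneg_left h3 (exp_pos _).le).trans h2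

/-- Lipschitz functions of a Gaussian are subgaussian. -/
lemma subgaussian_lipschitz {f : ℝ → ℝ} {K B : ℝ} (hfm : Measurable f) (hB : ∀ g, |f g| ≤ B)
    (hK : ∀ g g', |f g - f g'| ≤ K * |g - g'|) (θ : ℝ) :
    Integrable (fun g => exp (θ * (f g - ∫ y, f y ∂stdG))) stdG ∧
    ∫ g, exp (θ * (f g - ∫ y, f y ∂stdG)) ∂stdG ≤ exp (θ ^ 2 * K ^ 2) := by
  have hbd : ∀ u : ℝ, ∀ c : ℝ, |u| ≤ c → exp u ≤ exp c := fun u c h =>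
    exp_le_exp.2 ((le_abs_self u).trans h)
  have hB0 : 0 ≤ B := (abs_nonneg _).trans (hB 0)
  have hfi : Integrable f stdG := Integrable.of_bound hfm.aestronglyMeasurable B
    (ae_of_all _ fun g => hB g)
  have hEB : |∫ y, f y ∂stdG| ≤ B := by
    have := norm_integral_le_of_norm_le_const (μ := stdG) (f := f) (C := B) (ae_of_all _ hB)
    simpa using this
  have hI : Integrable (fun g => exp (θ * (f g - ∫ y, f y ∂stdG))) stdG := by
    refine Integrable.of_bound (by fun_prop) (exp (|θ| * (B + B))) (ae_of_all _ fun g => ?_)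
    rw [norm_of_nonneg (exp_pos _).le]
    refine hbd _ _ ?_
    rw [abs_mul]
    gcongr
    exact (abs_sub _ _).trans (add_le_add (hB g) hEB)
  refine ⟨hI, ?_⟩
  let D : ℝ × ℝ → ℝ := fun q => exp (θ * (f q.1 - f q.2))
  have hDI : Integrable D (stdG.prod stdG) := by
    refine Integrable.of_bound (by fun_prop) (exp (|θ| * (B + B))) (ae_of_all _ fun g => ?_)
    rw [norm_of_nonneg (exp_pos _).le]
    refine hbd _ _ ?_
    rw [abs_mul]
    gcongr
    exact (abs_sub _ _).trans (add_le_add (hB _) (hB _))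
  have hjen : ∀ g, exp (θ * (f g - ∫ y, f y ∂stdG)) ≤ ∫ y, D (g, y) ∂stdG := by
    intro g
    have h_int : Integrable (fun y => θ * (f g - f y)) stdG :=
      ((integrable_const _).sub hfi).const_mul _
    have h1 := convexOn_exp.map_integral_le (μ := stdG) (f := fun y => θ * (f g - f y))
      continuous_exp.continuousOn isClosed_univ (ae_of_all _ fun _ => Set.mem_univ _) h_int ?_
    · have : ∫ y, θ * (f g - f y) ∂stdG = θ * (f g - ∫ y, f y ∂stdG) := by
        rw [integral_const_mul, integral_sub (integrable_const _) hfi]; simp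
      rw [this] at h1
      exact h1
    · refine Integrable.of_bound (by fun_prop) (exp (|θ| * (B + B))) (ae_of_all _ fun y => ?_)
      rw [Function.comp, norm_of_nonneg (exp_pos _).le]
      refine hbd _ _ ?_
      rw [abs_mul]
      gcongr
      exact (abs_sub _ _).trans (add_le_add (hB _) (hB _))
  have h2 : ∫ g, exp (θ * (f g - ∫ y, f y ∂stdG)) ∂stdG ≤ ∫ q, D q ∂(stdG.prod stdG) := by
    rw [integral_prod _ hDI]
    exact integral_mono hI hDI.integral_prod_left hjen
  refine h2.trans ?_
  have hswap : ∫ q, D q ∂(stdG.prod stdG) = ∫ q, D q.swap ∂(stdG.prod stdG) :=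
    (integral_prod_swap (μ := stdG) (ν := stdG) D).symm
  have hprodI : ∀ c : ℝ, Integrable (fun q : ℝ × ℝ => exp (c * q.1) * exp (-c * q.2))
      (stdG.prod stdG) := fun c =>
    Integrable.mul_prod (integrable_exp_mul_stdG c) (integrable_exp_mul_stdG (-c))
  have hprod : ∀ c : ℝ, ∫ q : ℝ × ℝ, exp (c * q.1) * exp (-c * q.2) ∂(stdG.prod stdG)
      = exp (c ^ 2) := by
    intro c
    rw [integral_prod_mul (fun x : ℝ => exp (c * x)) (fun y : ℝ => exp (-c * y)),
      integral_exp_mul_stdG, integral_exp_mul_stdG, ← exp_add]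
    ring_nf
  have h3 : ∫ q, (D q + D q.swap) ∂(stdG.prod stdG) ≤
      ∫ q : ℝ × ℝ, (exp (θ * K * q.1) * exp (-(θ * K) * q.2) +
        exp (-(θ * K) * q.1) * exp (-(-(θ * K)) * q.2)) ∂(stdG.prod stdG) := by
    refine integral_mono (hDI.add hDI.swap) ((hprodI (θ * K)).add (hprodI (-(θ * K)))) fun q => ?_
    have hc : cosh (θ * (f q.1 - f q.2)) ≤ cosh (θ * K * (q.1 - q.2)) := by
      rw [cosh_le_cosh, abs_mul, abs_mul, abs_mul, mul_assoc]
      gcongr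
      exact (hK _ _).trans (mul_le_mul_of_nonneg_right (le_abs_self K) (abs_nonneg _))
    rw [cosh_eq, cosh_eq] at hc
    simp only [D, Prod.fst_swap, Prod.snd_swap, ← exp_add]
    rw [show θ * (f q.2 - f q.1) = -(θ * (f q.1 - f q.2)) by ring,
      show θ * K * q.1 + -(θ * K) * q.2 = θ * K * (q.1 - q.2) by ring,
      show -(θ * K) * q.1 + -(-(θ * K)) * q.2 = -(θ * K * (q.1 - q.2)) by ring]
    linarith
  have hDs : Integrable (fun q => D q.swap) (stdG.prod stdG) := hDI.swap
  rw [integral_add hDI hDs, integral_add (hprodI (θ * K)) (hprodI (-(θ * K))), hprod, hprod] at h3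
  have h5 : (-(θ * K)) ^ 2 = (θ * K) ^ 2 := by ring
  rw [h5] at h3
  rw [← mul_pow]
  linarith

/-- Moment generating function of the centred square of a standard Gaussian. -/
lemma mgf_sq_stdG {θ : ℝ} (h : |θ| ≤ 1 / 4) :
    Integrable (fun g => exp (θ * (g ^ 2 - 1))) stdG ∧
    ∫ g, exp (θ * (g ^ 2 - 1)) ∂stdG ≤ exp (2 * θ ^ 2) := by
  obtain ⟨hθ1, hθ2⟩ := abs_le.1 h
  have hb : 0 < 1 / 2 - θ := by linarith
  have hpdf : ∀ g : ℝ, gaussianPDFReal 0 1 g • exp (θ * (g ^ 2 - 1))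
      = (√(2 * π))⁻¹ * exp (-θ) * exp (-(1 / 2 - θ) * g ^ 2) := by
    intro g
    simp only [gaussianPDFReal, smul_eq_mul, NNReal.coe_one, mul_one, sub_zero]
    rw [mul_assoc, mul_assoc, ← exp_add, ← exp_add]
    ring_nf
  constructor
  · rw [stdG, gaussianReal_of_var_ne_zero 0 one_ne_zero]
    rw [integrable_withDensity_iff_integrable_smul₀' (by fun_prop)
      (ae_of_all _ fun x => by simp [gaussianPDF])]
    have : (fun x => (gaussianPDF 0 1 x).toReal • exp (θ * (x ^ 2 - 1)))
        = fun g => (√(2 * π))⁻¹ * exp (-θ) * exp (-(1 / 2 - θ) * g ^ 2) := by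
      ext x
      rw [← hpdf, toReal_gaussianPDF]
    rw [this]
    exact (integrable_exp_neg_mul_sq hb).const_mul _
  · rw [stdG, integral_gaussianReal_eq_integral_smul one_ne_zero]
    simp_rw [hpdf]
    rw [integral_const_mul, integral_gaussian]
    have hs : (√(2 * π))⁻¹ * √(π / (1 / 2 - θ)) = (√(1 - 2 * θ))⁻¹ := by
      rw [← sqrt_inv, ← sqrt_inv, ← sqrt_mul (by positivity)]
      congr 1
      have : (1 - 2 * θ) ≠ 0 := by linarith
      have : 1 / 2 - θ ≠ 0 := hb.ne'
      field_simp
    rw [mul_right_comm, hs]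
    have hq : exp (-(2 * θ) - (2 * θ) ^ 2) ≤ 1 - 2 * θ := by
      set y := 2 * θ with hy
      have hy1 : -(1 / 2) ≤ y := by linarith
      have hy2 : y ≤ 1 / 2 := by linarith
      have h1y : 0 < 1 - y := by linarith
      rw [show -y - y ^ 2 = -(y + y ^ 2) by ring, exp_neg, inv_le_comm₀ (exp_pos _) h1y]
      rw [inv_le_iff_one_le_mul₀ h1y]
      rcases le_total 0 y with hy0 | hy0
      · have := quadratic_le_exp_of_nonneg (x := y + y ^ 2) (by positivity)
        refine le_trans ?_ (mul_le_mul_of_nonneg_right this h1y.le)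
        have : y ≤ (1 - y) * (1 + y) ^ 2 / 2 := by nlinarith [mul_nonneg hy0 hy0]
        nlinarith [mul_nonneg hy0 hy0, mul_le_mul_of_nonneg_left this (mul_nonneg hy0 hy0)]
      · have := add_one_le_exp (y + y ^ 2)
        refine le_trans ?_ (mul_le_mul_of_nonneg_right this h1y.le)
        nlinarith [mul_nonneg (mul_self_nonneg y) (neg_nonneg.2 hy0)]
    have hq' : exp (-θ - 2 * θ ^ 2) ≤ √(1 - 2 * θ) := by
      apply le_sqrt_of_sq_le
      rw [← exp_nat_mul]
      refine le_trans (le_of_eq ?_) hq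
      push_cast; ring_nf
    rw [inv_mul_le_iff₀ ((exp_pos _).trans_le hq')]
    calc exp (-θ) = exp (-θ - 2 * θ ^ 2) * exp (2 * θ ^ 2) := by rw [← exp_add]; ring_nf
      _ ≤ _ := by gcongr

/-- The Euclidean norm of a coordinate vector. -/
noncomputable def nrm {ι : Type*} [Fintype ι] (x : ι → ℝ) : ℝ := √(∑ i, x i ^ 2)

section nrm
variable {ι : Type*} [Fintype ι]

lemma nrm_nonneg (x : ι → ℝ) : 0 ≤ nrm x := sqrt_nonneg _

lemma nrm_sq (x : ι → ℝ) : nrm x ^ 2 = ∑ i, x i ^ 2 :=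
  sq_sqrt (Finset.sum_nonneg fun _ _ => sq_nonneg _)

lemma nrm_smul (c : ℝ) (x : ι → ℝ) : nrm (fun i => c * x i) = |c| * nrm x := by
  simp only [nrm, mul_pow, ← Finset.mul_sum]
  rw [sqrt_mul (sq_nonneg c), sqrt_sq_eq_abs]

lemma nrm_pos {x : ι → ℝ} (hx : x ≠ 0) : 0 < nrm x := by
  obtain ⟨i, hi⟩ := Function.ne_iff.1 hx
  refine sqrt_pos.2 (Finset.sum_pos' (fun i _ => sq_nonneg _) ⟨i, Finset.mem_univ _, ?_⟩)
  have : x i ≠ 0 := hi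
  positivity

lemma sum_normalize_sq {x : ι → ℝ} (hx : x ≠ 0) : ∑ i, (x i / nrm x) ^ 2 = 1 := by
  simp only [div_pow, ← Finset.sum_div, ← nrm_sq]
  exact div_self (pow_ne_zero _ (nrm_pos hx).ne')

@[fun_prop]
lemma measurable_nrm : Measurable (nrm : (ι → ℝ) → ℝ) := by
  unfold nrm; fun_prop

end nrm

/-- The recovered scale of the Gaussian sketch `A z`. -/
noncomputable def baseScale {m : ℕ} {ι : Type*} [Fintype ι] (A : Fin m × ι → ℝ) (z : ι → ℝ) : ℝ :=
  nrm (fun r => ∑ i, A (r, i) * z i) / m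

/-- The vector decoded from the Gaussian sketch `A z`. -/
noncomputable def baseVec {m : ℕ} {ι : Type*} [Fintype ι] (A : Fin m × ι → ℝ) (z : ι → ℝ)
    (i : ι) : ℝ :=
  (∑ r, A (r, i) * ∑ j, A (r, j) * z j) / m

lemma prod_real_le {α β : Type*} [MeasurableSpace α] [MeasurableSpace β] (μ : Measure α)
    (ν : Measure β) [IsProbabilityMeasure μ] [IsProbabilityMeasure ν] {s : Set (α × β)}
    (hs : MeasurableSet s) {B : Set α} (hB : MeasurableSet B) {c : ℝ}
    (hc : ∀ a ∉ B, ν.real {b | (a, b) ∈ s} ≤ c) :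
    (μ.prod ν).real s ≤ μ.real B + max c 0 := by
  have h1 : (μ.prod ν).real s = ∫ a, ν.real {b | (a, b) ∈ s} ∂μ := by
    rw [measureReal_def, Measure.prod_apply hs]
    rw [← integral_toReal (measurable_measure_prodMk_left hs).aemeasurable
      (ae_of_all _ fun a => measure_lt_top _ _)]
    rfl
  have hm : Measurable fun a => ν.real {b | (a, b) ∈ s} :=
    (measurable_measure_prodMk_left hs).ennreal_toReal
  rw [h1]
  calc ∫ a, ν.real {b | (a, b) ∈ s} ∂μ ≤ ∫ a, (B.indicator 1 a + max c 0) ∂μ := by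
        refine integral_mono (Integrable.of_bound hm.aestronglyMeasurable 1
          (ae_of_all _ fun a => ?_)) (((integrable_const 1).indicator hB).add (integrable_const _))
          fun a => ?_
        · rw [norm_of_nonneg measureReal_nonneg]; exact measureReal_le_one
        · by_cases ha : a ∈ B
          · simp only [ha, Set.indicator_of_mem, Pi.one_apply]
            linarith [measureReal_le_one (μ := ν) (s := {b | (a, b) ∈ s}), le_max_right c 0]
          · simp only [ha, not_false_eq_true, Set.indicator_of_notMem, zero_add]
            exact (hc a ha).trans (le_max_left _ _)
    _ = _ := by
        rw [integral_add ((integrable_const 1).indicator hB) (integrable_const _),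
          integral_indicator_one hB]
        simp

/-- Replacing the component of every row along a unit vector by a fresh Gaussian preserves the
law of a Gaussian matrix. -/
lemma map_replace_component {m : ℕ} {ι : Type*} [Fintype ι] (e : ι → ℝ) (he : ∑ i, e i ^ 2 = 1) :
    MeasurePreserving
      (fun (q : (Fin m → ℝ) × (Fin m × ι → ℝ)) (k : Fin m × ι) =>
        q.2 k - (∑ j, q.2 (k.1, j) * e j) * e k.2 + q.1 k.1 * e k.2)
      ((gaussPi (Fin m)).prod (gaussPi (Fin m × ι))) (gaussPi (Fin m × ι)) := by
  refine ⟨by fun_prop, ?_⟩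
  have h1 := (measurePreserving_sumPiEquivProdPi (X := fun _ : Fin m ⊕ (Fin m × ι) => ℝ)
    (fun _ => stdG)).map_eq
  have h1' : (gaussPi (Fin m)).prod (gaussPi (Fin m × ι)) =
    (gaussPi (Fin m ⊕ (Fin m × ι))).map (MeasurableEquiv.sumPiEquivProdPi fun _ => ℝ) := h1.symm
  rw [h1', Measure.map_map (by fun_prop) (by fun_prop)]
  let f : ((Fin m ⊕ (Fin m × ι)) → ℝ) →ₗ[ℝ] (Fin m × ι → ℝ) :=
    { toFun := fun x k => x (Sum.inr k) - (∑ j, x (Sum.inr (k.1, j)) * e j) * e k.2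
        + x (Sum.inl k.1) * e k.2
      map_add' := by
        intro x y; ext k
        simp only [Pi.add_apply, add_mul, Finset.sum_add_distrib]; ring
      map_smul' := by
        intro c x; ext k
        simp only [Pi.smul_apply, smul_eq_mul, RingHom.id_apply, mul_assoc, ← Finset.mul_sum]
        ring }
  have := map_gaussPi f ?_
  · exact this
  intro u
  let a : Fin m → ℝ := fun r => ∑ j, u (r, j) * e j
  refine ⟨Sum.elim a (fun k => u k - a k.1 * e k.2), fun x => ?_, ?_⟩
  · simp only [Fintype.sum_sum_type, Fintype.sum_prod_type, Sum.elim_inl, Sum.elim_inr]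
    rw [← Finset.sum_add_distrib]
    refine Finset.sum_congr rfl fun r _ => ?_
    have e1 : ∑ i, u (r, i) * f x (r, i) = ∑ i, u (r, i) * x (Sum.inr (r, i))
        - (∑ j, x (Sum.inr (r, j)) * e j) * a r + x (Sum.inl r) * a r := by
      simp only [a, Finset.mul_sum, f, LinearMap.coe_mk, AddHom.coe_mk]
      rw [← Finset.sum_sub_distrib, ← Finset.sum_add_distrib]
      exact Finset.sum_congr rfl fun i _ => by ring
    have e2 : ∑ i, (u (r, i) - a r * e i) * x (Sum.inr (r, i)) = ∑ i, u (r, i) * x (Sum.inr (r, i))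
        - (∑ j, x (Sum.inr (r, j)) * e j) * a r := by
      rw [Finset.sum_mul, ← Finset.sum_sub_distrib]
      refine Finset.sum_congr rfl fun i _ => ?_
      ring
    rw [e1, e2]; ring
  · simp only [Fintype.sum_sum_type, Fintype.sum_prod_type, Sum.elim_inl, Sum.elim_inr]
    rw [← Finset.sum_add_distrib]
    refine Finset.sum_congr rfl fun r _ => ?_
    have e3 : ∀ b : ℝ, ∑ i, (u (r, i) - b * e i) ^ 2 =
        ∑ i, u (r, i) ^ 2 - 2 * b * ∑ i, u (r, i) * e i + b ^ 2 * ∑ i, e i ^ 2 := by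
      intro b
      rw [Finset.mul_sum, Finset.mul_sum, ← Finset.sum_sub_distrib, ← Finset.sum_add_distrib]
      exact Finset.sum_congr rfl fun i _ => by ring
    rw [e3, he]
    change a r ^ 2 + (_ - 2 * a r * a r + _) = _
    ring

lemma map_row_combination {m : ℕ} {ι : Type*} [Fintype ι] (c : Fin m → ℝ)
    (hc : ∑ r, c r ^ 2 = 1) :
    MeasurePreserving (fun (A : Fin m × ι → ℝ) i => ∑ r, A (r, i) * c r)
      (gaussPi (Fin m × ι)) (gaussPi ι) := by
  refine ⟨by fun_prop, ?_⟩
  let f : ((Fin m × ι) → ℝ) →ₗ[ℝ] (ι → ℝ) :=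
    { toFun := fun A i => ∑ r, A (r, i) * c r
      map_add' := by
        intro x y; ext k
        simp only [Pi.add_apply, add_mul, Finset.sum_add_distrib]
      map_smul' := by
        intro a x; ext k
        simp only [Pi.smul_apply, smul_eq_mul, RingHom.id_apply, mul_assoc, ← Finset.mul_sum] }
  refine map_gaussPi f fun u => ⟨fun k => c k.1 * u k.2, fun x => ?_, ?_⟩
  · simp only [f, LinearMap.coe_mk, AddHom.coe_mk, Fintype.sum_prod_type, Finset.mul_sum]
    rw [Finset.sum_comm]
    refine Finset.sum_congr rfl fun _ _ => Finset.sum_congr rfl fun _ _ => by ring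
  · simp only [Fintype.sum_prod_type, mul_pow, ← Finset.mul_sum, ← Finset.sum_mul, hc, one_mul]

/-- The decoded pair `(scale, vector)` is distributed as an explicit perturbation of `z + s g`. -/
lemma base_law {m : ℕ} {ι : Type*} [Fintype ι] {z : ι → ℝ} (hz : z ≠ 0)
    {E : Set (ℝ × (ι → ℝ))} (hE : MeasurableSet E) {V : Set (Fin m → ℝ)} (hV : MeasurableSet V)
    (hV0 : 0 ∈ V) {c : ℝ} (hc0 : 0 ≤ c)
    (hc : ∀ v ∉ V, (gaussPi ι).real {g | (nrm z * nrm v / m, fun i => z i + nrm z * nrm v / m * g i +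
      (nrm v ^ 2 / m - 1 - nrm v / m * ∑ j, g j * (z j / nrm z)) * z i) ∈ E} ≤ c) :
    (gaussPi (Fin m × ι)).real {A | (baseScale A z, baseVec A z) ∈ E} ≤
      (gaussPi (Fin m)).real V + c := by
  set e : ι → ℝ := fun i => z i / nrm z with he
  have hD := nrm_pos hz
  have he1 : ∑ i, e i ^ 2 = 1 := sum_normalize_sq hz
  have hez : ∑ i, e i * z i = nrm z := by
    have : ∑ i, e i * z i = (∑ i, z i ^ 2) / nrm z := by
      rw [Finset.sum_div]
      exact Finset.sum_congr rfl fun i _ => by simp only [he]; ring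
    rw [this, ← nrm_sq]; field_simp
  have hm1 : Measurable fun A : Fin m × ι → ℝ => (baseScale A z, baseVec A z) := by
    unfold baseScale baseVec
    refine Measurable.prodMk ?_ ?_
    · exact (measurable_nrm.comp (by fun_prop)).div_const _
    · exact measurable_pi_lambda _ fun i => by fun_prop
  have hM := map_replace_component (m := m) e he1
  change (gaussPi (Fin m × ι)).real ((fun A => (baseScale A z, baseVec A z)) ⁻¹' E) ≤ _
  rw [← hM.measureReal_preimage (hm1 hE).nullMeasurableSet]
  refine (prod_real_le _ _ (hM.measurable (hm1 hE)) hV (c := c) fun v hv => ?_).trans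
    (by rw [max_eq_left hc0])
  refine le_trans ?_ (hc v hv)
  have hv0 : v ≠ 0 := fun h => hv (h ▸ hV0)
  have hnv := nrm_pos hv0
  have hR := map_row_combination (m := m) (ι := ι) (fun r => v r / nrm v) (sum_normalize_sq hv0)
  have hmE : MeasurableSet {g : ι → ℝ | (nrm z * nrm v / m, fun i => z i + nrm z * nrm v / m * g i +
      (nrm v ^ 2 / m - 1 - nrm v / m * ∑ j, g j * (z j / nrm z)) * z i) ∈ E} := by
    refine measurableSet_preimage (Measurable.prodMk measurable_const ?_) hE
    exact measurable_pi_lambda _ fun i => by fun_prop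
  rw [← hR.measureReal_preimage hmE.nullMeasurableSet]
  refine le_of_eq ?_
  congr 1
  ext A
  have hrow : ∀ r, ∑ i, (A (r, i) - (∑ j, A (r, j) * e j) * e i + v r * e i) * z i
      = nrm z * v r := by
    intro r
    have : ∀ i, (A (r, i) - (∑ j, A (r, j) * e j) * e i + v r * e i) * z i
      = nrm z * (A (r, i) * e i) + (v r - ∑ j, A (r, j) * e j) * (e i * z i) := by
      intro i
      have : z i = nrm z * e i := by simp only [he]; field_simp
      calc _ = A (r, i) * z i + (v r - ∑ j, A (r, j) * e j) * (e i * z i) := by ring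
        _ = _ := by conv_lhs => rw [show A (r, i) * z i = nrm z * (A (r, i) * e i) by rw [this]; ring]
    simp_rw [this]
    rw [Finset.sum_add_distrib, ← Finset.mul_sum, ← Finset.mul_sum, hez]; ring
  have hS : nrm (fun r => nrm z * v r) = nrm z * nrm v := by
    rw [nrm_smul, abs_of_pos hD]
  change (baseScale (fun k : Fin m × ι => A k - (∑ j, A (k.1, j) * e j) * e k.2 + v k.1 * e k.2) z,
    baseVec (fun k : Fin m × ι => A k - (∑ j, A (k.1, j) * e j) * e k.2 + v k.1 * e k.2) z) ∈ E ↔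
    (nrm z * nrm v / m, fun i => z i + nrm z * nrm v / m * (∑ r, A (r, i) * (v r / nrm v)) +
      (nrm v ^ 2 / m - 1 - nrm v / m * ∑ j, (∑ r, A (r, j) * (v r / nrm v)) * (z j / nrm z)) * z i)
      ∈ E
  have h1 : baseScale (fun k : Fin m × ι => A k - (∑ j, A (k.1, j) * e j) * e k.2 + v k.1 * e k.2) z
      = nrm z * nrm v / m := by
    simp only [baseScale, hrow, hS]
  rw [h1]
  suffices h2 : baseVec (fun k : Fin m × ι =>
      A k - (∑ j, A (k.1, j) * e j) * e k.2 + v k.1 * e k.2) z = fun i =>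
      z i + nrm z * nrm v / m * (∑ r, A (r, i) * (v r / nrm v)) +
      (nrm v ^ 2 / m - 1 - nrm v / m * ∑ j, (∑ r, A (r, j) * (v r / nrm v)) * (z j / nrm z)) * z i by
    rw [h2]
  ext i
  simp only [baseVec, hrow]
  have hze : z i = nrm z * e i := by simp only [he]; field_simp
  have h3 : ∑ j, (∑ r, A (r, j) * (v r / nrm v)) * (z j / nrm z)
      = (∑ r, v r * ∑ j, A (r, j) * e j) / nrm v := by
    simp only [Finset.sum_mul, Finset.mul_sum, Finset.sum_div]
    rw [Finset.sum_comm]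
    exact Finset.sum_congr rfl fun r _ => Finset.sum_congr rfl fun j _ => by
      simp only [he]; ring
  have h4 : ∑ r, A (r, i) * (v r / nrm v) = (∑ r, A (r, i) * v r) / nrm v := by
    rw [Finset.sum_div]; exact Finset.sum_congr rfl fun r _ => by ring
  have h5 : ∑ r, (A (r, i) - (∑ j, A (r, j) * e j) * e i + v r * e i) * (nrm z * v r)
      = nrm z * (∑ r, A (r, i) * v r) - nrm z * e i * (∑ r, v r * ∑ j, A (r, j) * e j)
        + nrm z * e i * nrm v ^ 2 := by
    rw [nrm_sq v, Finset.mul_sum, Finset.mul_sum, Finset.mul_sum, ← Finset.sum_sub_distrib,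
      ← Finset.sum_add_distrib]
    exact Finset.sum_congr rfl fun r _ => by ring
  have hnz : nrm v ≠ 0 := hnv.ne'
  have hm : (m : ℝ) ≠ 0 := by
    rcases Nat.eq_zero_or_pos m with h | h
    · subst h; exact absurd (Subsingleton.elim v 0) hv0
    · positivity
  rw [h3, h4, h5, hze]
  field_simp
  ring

/-- `h s` is a bounded Lipschitz statistic whose Gaussian smoothing at scale `s` estimates `ψ` with
bias `O(s ^ J)`. -/
structure Estimates (h : ℝ → ℝ → ℝ) (ψ : ℝ → ℝ) (C : ℝ) (J : ℕ) : Prop where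
  one_le : 1 ≤ C
  meas : Measurable fun q : ℝ × ℝ => h q.1 q.2
  meas_target : Measurable ψ
  bdd : ∀ s y, 0 ≤ s → s ≤ 1 → |h s y| ≤ C
  bdd_target : ∀ z, |ψ z| ≤ C
  lip : ∀ s y y', 0 ≤ s → s ≤ 1 → |h s y - h s y'| ≤ C * |y - y'|
  rel : ∀ s y b, 0 ≤ s → s ≤ 1 → 1 / 2 ≤ b → b ≤ 2 → |h s (b * y) - h s y| ≤ C * |b - 1|
  zero : ∀ s y, 0 ≤ s → s ≤ 1 → |y| ≤ 1 → h s y = 0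
  zero_target : ∀ z, |z| ≤ 1 → ψ z = 0
  bias : ∀ s z, 0 < s → s ≤ 1 → |∫ g, h s (z + s * g) ∂stdG - ψ z| ≤ C * s ^ J

section
variable {ι : Type*} [Fintype ι] {h : ℝ → ℝ → ℝ} {ψ : ℝ → ℝ} {C : ℝ} {J : ℕ}

lemma chernoff_gauss (f : ι → ℝ → ℝ) (c : ι → ℝ)
    (hi : ∀ i, Integrable (fun g => exp (f i g)) stdG)
    (hc : ∀ i, ∫ g, exp (f i g) ∂stdG ≤ exp (c i)) (t : ℝ) :
    (gaussPi ι).real {g | t ≤ ∑ i, f i (g i)} ≤ exp (∑ i, c i - t) :=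
  chernoff (fun _ => stdG) f c hi hc t

lemma tail_linear_form (e : ι → ℝ) (he : ∑ i, e i ^ 2 = 1) {a : ℝ} (ha : 0 ≤ a) :
    (gaussPi ι).real {g | a ≤ |∑ i, g i * e i|} ≤ 2 * exp (-(a ^ 2 / 2)) := by
  have key : ∀ s : ℝ, s ^ 2 = 1 →
      (gaussPi ι).real {g | a * a ≤ ∑ i, s * a * e i * g i} ≤ exp (-(a ^ 2 / 2)) := by
    intro s hs
    refine (chernoff_gauss (fun i g => s * a * e i * g) (fun i => (s * a * e i) ^ 2 / 2)
      (fun i => integrable_exp_mul_stdG _) (fun i => (integral_exp_mul_stdG _).le) _).trans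
      (le_of_eq ?_)
    have : ∑ i, (s * a * e i) ^ 2 / 2 = a ^ 2 / 2 := by
      simp only [mul_pow, hs, ← Finset.sum_div, ← Finset.mul_sum, he]; ring
    rw [this]; ring_nf
  have hsub : {g : ι → ℝ | a ≤ |∑ i, g i * e i|} ⊆
      {g | a * a ≤ ∑ i, 1 * a * e i * g i} ∪ {g | a * a ≤ ∑ i, -1 * a * e i * g i} := by
    intro g (hg : a ≤ |∑ i, g i * e i|)
    have h1 : ∀ s : ℝ, ∑ i, s * a * e i * g i = s * a * ∑ i, g i * e i := fun s => by
      rw [Finset.mul_sum]; exact Finset.sum_congr rfl fun i _ => by ring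
    rcases le_abs.1 hg with h2 | h2
    · left
      change a * a ≤ ∑ i, 1 * a * e i * g i
      rw [h1]; nlinarith
    · right
      change a * a ≤ ∑ i, -1 * a * e i * g i
      rw [h1]; nlinarith
  refine (measureReal_mono hsub).trans ((measureReal_union_le _ _).trans ?_)
  linarith [key 1 (by norm_num), key (-1) (by norm_num)]

lemma tail_sum_sq (m : ℕ) {η : ℝ} (h0 : 0 ≤ η) (h1 : η ≤ 1) :
    (gaussPi (Fin m)).real {v | η * m ≤ |∑ r, (v r ^ 2 - 1)|} ≤ 2 * exp (-(η ^ 2 * m / 8)) := by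
  have key : ∀ s : ℝ, s ^ 2 = 1 →
      (gaussPi (Fin m)).real {v | η / 4 * (η * m) ≤ ∑ r, s * (η / 4) * (v r ^ 2 - 1)}
        ≤ exp (-(η ^ 2 * m / 8)) := by
    intro s hs
    have hs' : |s * (η / 4)| ≤ 1 / 4 := by
      have : |s| = 1 := by rw [← sqrt_sq_eq_abs, hs, sqrt_one]
      rw [abs_mul, this, abs_of_nonneg (by positivity)]; linarith
    refine (chernoff_gauss (fun (_ : Fin m) g => s * (η / 4) * (g ^ 2 - 1))
      (fun _ => 2 * (s * (η / 4)) ^ 2)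
      (fun i => (mgf_sq_stdG hs').1) (fun i => (mgf_sq_stdG hs').2) _).trans (le_of_eq ?_)
    simp only [mul_pow, hs, Finset.sum_const, Finset.card_univ, Fintype.card_fin, nsmul_eq_mul]
    ring_nf
  have hsub : {v : Fin m → ℝ | η * m ≤ |∑ r, (v r ^ 2 - 1)|} ⊆
      {v | η / 4 * (η * m) ≤ ∑ r, 1 * (η / 4) * (v r ^ 2 - 1)} ∪
      {v | η / 4 * (η * m) ≤ ∑ r, -1 * (η / 4) * (v r ^ 2 - 1)} := by
    intro v (hv : η * m ≤ |∑ r, (v r ^ 2 - 1)|)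
    have h4 : 0 ≤ η / 4 := by positivity
    rcases le_abs.1 hv with h2 | h2
    · left
      change η / 4 * (η * m) ≤ ∑ r, 1 * (η / 4) * (v r ^ 2 - 1)
      rw [← Finset.mul_sum, one_mul]
      exact mul_le_mul_of_nonneg_left h2 h4
    · right
      change η / 4 * (η * m) ≤ ∑ r, -1 * (η / 4) * (v r ^ 2 - 1)
      rw [← Finset.mul_sum, neg_one_mul, neg_mul, ← mul_neg]
      exact mul_le_mul_of_nonneg_left h2 h4
  refine (measureReal_mono hsub).trans ((measureReal_union_le _ _).trans ?_)
  linarith [key 1 (by norm_num), key (-1) (by norm_num)]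

/-- Few coordinates of a scaled Gaussian vector are large. -/
lemma tail_count {s s0 : ℝ} (hs : 0 < s) (hss : s ≤ s0)
    (hn : Fintype.card ι * exp (-(1 / (64 * s0 ^ 2))) ≤ 1) (t : ℝ) :
    (gaussPi ι).real {g | t ≤ ∑ i, if 1 / 4 ≤ s * |g i| then (1 : ℝ) else 0} ≤
      exp (2 - t / (64 * s ^ 2)) := by
  set θ : ℝ := 1 / (64 * s ^ 2) with hθ
  have hθ0 : 0 < θ := by positivity
  have hset : MeasurableSet {g : ℝ | 1 / 4 ≤ s * |g|} := measurableSet_le (by fun_prop) (by fun_prop)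
  have hfun : ∀ g : ℝ, exp (θ * if 1 / 4 ≤ s * |g| then (1 : ℝ) else 0) =
      1 + {g : ℝ | 1 / 4 ≤ s * |g|}.indicator (fun _ => exp θ - 1) g := by
    intro g
    by_cases hg : 1 / 4 ≤ s * |g|
    · rw [Set.indicator_of_mem (by exact hg), if_pos hg]; simp
    · rw [Set.indicator_of_notMem (by exact hg), if_neg hg]; simp
  have h_int : Integrable ({g : ℝ | 1 / 4 ≤ s * |g|}.indicator (fun _ => exp θ - 1)) stdG :=
    (integrable_const _).indicator hset
  have hP : stdG.real {g : ℝ | 1 / 4 ≤ s * |g|} ≤ 2 * exp (-(2 * θ)) := by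
    have h1 : {g : ℝ | 1 / 4 ≤ s * |g|} ⊆ {g | 1 / (4 * s) ≤ |g|} := by
      intro g (hg : 1 / 4 ≤ s * |g|)
      change 1 / (4 * s) ≤ |g|
      rw [div_le_iff₀ (by positivity)]; linarith
    refine (measureReal_mono h1).trans ((tail_stdG (by positivity)).trans (le_of_eq ?_))
    congr 2
    rw [hθ]; field_simp; norm_num
  have hb : ∀ i : ι, ∫ g, exp (θ * if 1 / 4 ≤ s * |g| then (1 : ℝ) else 0) ∂stdG ≤
      exp (2 * exp (-θ)) := by
    intro _
    simp_rw [hfun]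
    rw [integral_add (integrable_const _) h_int, integral_indicator_const _ hset]
    simp only [integral_const, probReal_univ, smul_eq_mul, mul_one]
    refine le_trans ?_ (add_one_le_exp _)
    have h2 : stdG.real {g : ℝ | 1 / 4 ≤ s * |g|} * (exp θ - 1) ≤ 2 * exp (-(2 * θ)) * exp θ := by
      refine mul_le_mul hP (by linarith) ?_ (by positivity)
      linarith [one_le_exp hθ0.le]
    rw [mul_assoc, ← exp_add] at h2
    ring_nf at h2 ⊢
    linarith
  have := chernoff_gauss (ι := ι) (fun _ g => θ * if 1 / 4 ≤ s * |g| then (1 : ℝ) else 0)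
    (fun _ => 2 * exp (-θ)) (fun _ => by
      simp_rw [hfun]; exact (integrable_const _).add h_int) hb (θ * t)
  simp only [← Finset.mul_sum] at this
  have h3 : {g : ι → ℝ | θ * t ≤ θ * ∑ i, if 1 / 4 ≤ s * |g i| then (1 : ℝ) else 0} =
      {g | t ≤ ∑ i, if 1 / 4 ≤ s * |g i| then (1 : ℝ) else 0} := by
    ext g
    exact mul_le_mul_iff_right₀ hθ0
  rw [h3] at this
  refine this.trans (exp_le_exp.2 ?_)
  simp only [Finset.sum_const, Finset.card_univ, nsmul_eq_mul]
  have h4 : exp (-θ) ≤ exp (-(1 / (64 * s0 ^ 2))) := by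
    rw [exp_le_exp, neg_le_neg_iff, hθ]
    gcongr
  have h5 : (Fintype.card ι : ℝ) * exp (-θ) ≤ 1 :=
    (mul_le_mul_of_nonneg_left h4 (Nat.cast_nonneg _)).trans hn
  have h6 : θ * t = t / (64 * s ^ 2) := by rw [hθ]; ring
  rw [h6]; linarith

lemma tail_sum_abs (B : Finset ι) {s N : ℝ} (hs : 0 < s) (hs1 : s ≤ 1) (hN : (B.card : ℝ) ≤ N) :
    (gaussPi ι).real {g | 2 * N ≤ ∑ i ∈ B, s * |g i|} ≤ exp (-(N / (2 * s ^ 2))) := by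
  classical
  have hN0 : 0 ≤ N := le_trans (Nat.cast_nonneg _) hN
  have hs2 : 1 ≤ 1 / s ^ 2 := by
    rw [one_le_div (by positivity)]; exact pow_le_one₀ hs.le hs1
  have := chernoff_gauss (ι := ι) (fun i g => if i ∈ B then 1 / s * |g| else 0)
    (fun i => if i ∈ B then 1 + (1 / s) ^ 2 / 2 else 0)
    (fun i => by
      by_cases hi : i ∈ B
      · simpa only [hi, if_true] using integrable_exp_mul_abs_stdG (1 / s)
      · simp only [hi, if_false]; exact integrable_const _)
    (fun i => by
      by_cases hi : i ∈ B
      · simp only [hi, if_true]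
        refine (integral_exp_mul_abs_stdG_le (1 / s)).trans ?_
        rw [exp_add]
        have := add_one_le_exp (1 : ℝ)
        gcongr
        linarith
      · simp [hi]) (2 * N / s ^ 2)
  simp only [Finset.sum_ite_mem, Finset.univ_inter, Finset.sum_const, nsmul_eq_mul] at this
  refine le_trans (measureReal_mono fun g (hg : 2 * N ≤ ∑ i ∈ B, s * |g i|) => ?_)
    (this.trans (exp_le_exp.2 ?_))
  · change 2 * N / s ^ 2 ≤ ∑ i ∈ B, 1 / s * |g i|
    rw [← Finset.mul_sum] at hg ⊢
    rw [div_le_iff₀ (by positivity)]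
    calc 2 * N ≤ _ := hg
      _ = _ := by field_simp
  · have e1 : (B.card : ℝ) * (1 + (1 / s) ^ 2 / 2) ≤ N * (1 / s ^ 2 + 1 / s ^ 2 / 2) := by
      rw [one_div_pow]
      gcongr
    calc _ ≤ N * (1 / s ^ 2 + 1 / s ^ 2 / 2) - 2 * N / s ^ 2 := by linarith
      _ = _ := by ring

lemma tail_centered (hh : Estimates h ψ C J) (B : Finset ι) (z : ι → ℝ) {s N t : ℝ} (hs : 0 < s)
    (hs1 : s ≤ 1) (hN : (B.card : ℝ) ≤ N) (ht : 0 < t) :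
    (gaussPi ι).real {g | t * N ≤ |∑ i ∈ B, (h s (z i + s * g i) -
      ∫ y, h s (z i + s * y) ∂stdG)|} ≤ 2 * exp (-(t ^ 2 * N / (4 * C ^ 2 * s ^ 2))) := by
  classical
  have hC : 0 < C := lt_of_lt_of_le one_pos hh.one_le
  set θ : ℝ := t / (2 * C ^ 2 * s ^ 2) with hθ
  have hθ0 : 0 < θ := by positivity
  have hm : ∀ w, Measurable fun y : ℝ => h s (w + s * y) := fun w =>
    hh.meas.comp (measurable_const.prodMk (by fun_prop))
  have hsub : ∀ (w a : ℝ), _ := fun w a => subgaussian_lipschitz (f := fun y => h s (w + s * y))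
    (K := C * s) (hm w) (fun g => hh.bdd s _ hs.le hs1) (fun g g' => by
      refine (hh.lip s _ _ hs.le hs1).trans (le_of_eq ?_)
      rw [show w + s * g - (w + s * g') = s * (g - g') by ring, abs_mul, abs_of_pos hs]; ring) a
  have key : ∀ σ : ℝ, σ ^ 2 = 1 → (gaussPi ι).real {g | θ * (t * N) ≤ ∑ i ∈ B, σ * θ *
      (h s (z i + s * g i) - ∫ y, h s (z i + s * y) ∂stdG)} ≤
      exp (-(t ^ 2 * N / (4 * C ^ 2 * s ^ 2))) := by
    intro σ hσ
    have := chernoff_gauss (ι := ι) (fun i g => if i ∈ B then σ * θ *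
      (h s (z i + s * g) - ∫ y, h s (z i + s * y) ∂stdG) else 0)
      (fun i => if i ∈ B then (σ * θ) ^ 2 * (C * s) ^ 2 else 0)
      (fun i => by
        by_cases hi : i ∈ B
        · simpa only [hi, if_true] using (hsub (z i) (σ * θ)).1
        · simp only [hi, if_false]; exact integrable_const _)
      (fun i => by
        by_cases hi : i ∈ B
        · simpa only [hi, if_true] using (hsub (z i) (σ * θ)).2
        · simp [hi]) (θ * (t * N))
    simp only [Finset.sum_ite_mem, Finset.univ_inter, Finset.sum_const, nsmul_eq_mul] at this
    refine this.trans (exp_le_exp.2 ?_)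
    rw [mul_pow, hσ, one_mul]
    calc (B.card : ℝ) * (θ ^ 2 * (C * s) ^ 2) - θ * (t * N)
        ≤ N * (θ ^ 2 * (C * s) ^ 2) - θ * (t * N) := by gcongr
      _ = _ := by rw [hθ]; field_simp; ring
  refine (measureReal_mono fun g (hg : t * N ≤ |_|) => ?_).trans
    ((measureReal_union_le _ _).trans (add_le_add (key 1 (by norm_num))
      (key (-1) (by norm_num)) |>.trans (by rw [two_mul])))
  rcases le_abs.1 hg with h2 | h2
  · left
    change θ * (t * N) ≤ ∑ i ∈ B, 1 * θ * (h s (z i + s * g i) - ∫ y, h s (z i + s * y) ∂stdG)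
    rw [← Finset.mul_sum, one_mul]
    exact mul_le_mul_of_nonneg_left h2 hθ0.le
  · right
    change θ * (t * N) ≤ ∑ i ∈ B, -1 * θ * (h s (z i + s * g i) - ∫ y, h s (z i + s * y) ∂stdG)
    rw [← Finset.mul_sum, neg_one_mul, neg_mul, ← mul_neg]
    exact mul_le_mul_of_nonneg_left h2 hθ0.le

lemma sum_error_le (hh : Estimates h ψ C J) (z : ι → ℝ) {s N t d : ℝ} (hs : 0 < s) (hs1 : s ≤ 1)
    (hN0 : 0 ≤ N) (ht : 0 < t) (ht1 : t ≤ 1) (hd : |d| ≤ t / 8) (hst : s ^ J ≤ t)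
    (B : Finset ι) (hB : ∀ i, i ∈ B ↔ 1 / 2 ≤ |z i|) (hN : (B.card : ℝ) ≤ N) (g : ι → ℝ)
    (h1 : ∑ i, (if 1 / 4 ≤ s * |g i| then (1 : ℝ) else 0) < t * N)
    (h2 : ∑ i ∈ B, s * |g i| < 2 * N)
    (h3 : |∑ i ∈ B, (h s (z i + s * g i) - ∫ y, h s (z i + s * y) ∂stdG)| < t * N) :
    |∑ i, h s (z i + s * g i + d * z i) - ∑ i, ψ (z i)| ≤ 4 * C * t * N := by
  classical
  have hC := hh.one_le
  have hdb := abs_le.1 hd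
  rw [← Finset.sum_sub_distrib, ← Finset.sum_add_sum_compl B]
  have hsmall : |∑ i ∈ Bᶜ, (h s (z i + s * g i + d * z i) - ψ (z i))| ≤ C * (t * N) := by
    calc |∑ i ∈ Bᶜ, (h s (z i + s * g i + d * z i) - ψ (z i))|
        ≤ ∑ i ∈ Bᶜ, |h s (z i + s * g i + d * z i) - ψ (z i)| := Finset.abs_sum_le_sum_abs _ _
      _ ≤ ∑ i ∈ Bᶜ, C * (if 1 / 4 ≤ s * |g i| then (1 : ℝ) else 0) := by
          refine Finset.sum_le_sum fun i hi => ?_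
          have hzi : |z i| < 1 / 2 := by
            rw [Finset.mem_compl, hB] at hi; exact not_le.1 hi
          rw [hh.zero_target _ (by linarith), sub_zero]
          split_ifs with hg
          · rw [mul_one]; exact hh.bdd _ _ hs.le hs1
          · rw [hh.zero _ _ hs.le hs1]; · simp
            push Not at hg
            have e1 : |s * g i| < 1 / 4 := by rwa [abs_mul, abs_of_pos hs]
            have e2 : |d * z i| ≤ 1 / 8 * (1 / 2) := by
              rw [abs_mul]; gcongr; linarith
            have := abs_add_three (z i) (s * g i) (d * z i)
            linarith
      _ ≤ ∑ i, C * (if 1 / 4 ≤ s * |g i| then (1 : ℝ) else 0) :=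
          Finset.sum_le_sum_of_subset_of_nonneg (Finset.subset_univ _) fun i _ _ => by
            split_ifs <;> simp; linarith
      _ ≤ C * (t * N) := by rw [← Finset.mul_sum]; gcongr
  have hbig : |∑ i ∈ B, (h s (z i + s * g i + d * z i) - ψ (z i))| ≤ 3 * C * (t * N) := by
    have e1 : ∑ i ∈ B, (h s (z i + s * g i + d * z i) - ψ (z i)) =
        ∑ i ∈ B, (h s (z i + s * g i + d * z i) - h s (z i + s * g i)) +
        ∑ i ∈ B, (h s (z i + s * g i) - ∫ y, h s (z i + s * y) ∂stdG) +
        ∑ i ∈ B, (∫ y, h s (z i + s * y) ∂stdG - ψ (z i)) := by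
      rw [← Finset.sum_add_distrib, ← Finset.sum_add_distrib]
      exact Finset.sum_congr rfl fun i _ => by ring
    have e2 : |∑ i ∈ B, (h s (z i + s * g i + d * z i) - h s (z i + s * g i))| ≤
        C * (t / 8) * (2 * N + N) := by
      calc _ ≤ ∑ i ∈ B, |h s (z i + s * g i + d * z i) - h s (z i + s * g i)| :=
            Finset.abs_sum_le_sum_abs _ _
        _ ≤ ∑ i ∈ B, (C * (t / 8) * (s * |g i|) + C * (t / 8)) := by
            refine Finset.sum_le_sum fun i _ => ?_
            have a1 := hh.lip s (z i + s * g i + d * z i) ((1 + d) * (z i + s * g i)) hs.le hs1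
            have a2 := hh.rel s (z i + s * g i) (1 + d) hs.le hs1 (by linarith) (by linarith)
            have a3 : |z i + s * g i + d * z i - (1 + d) * (z i + s * g i)| = |d| * (s * |g i|) := by
              rw [show z i + s * g i + d * z i - (1 + d) * (z i + s * g i) = -(d * (s * g i)) by ring,
                abs_neg, abs_mul, abs_mul, abs_of_pos hs]
            rw [a3] at a1
            rw [show 1 + d - 1 = d by ring] at a2
            have a4 : C * (|d| * (s * |g i|)) ≤ C * (t / 8) * (s * |g i|) := by
              rw [mul_assoc]; gcongr
            have a5 : C * |d| ≤ C * (t / 8) := by gcongr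
            refine (abs_sub_le _ (h s ((1 + d) * (z i + s * g i))) _).trans ?_
            linarith
        _ = C * (t / 8) * (∑ i ∈ B, s * |g i| + B.card) := by
            rw [Finset.sum_add_distrib, ← Finset.mul_sum]; simp; ring
        _ ≤ _ := by gcongr
    have e3 : |∑ i ∈ B, (∫ y, h s (z i + s * y) ∂stdG - ψ (z i))| ≤ C * (t * N) := by
      calc _ ≤ ∑ i ∈ B, |∫ y, h s (z i + s * y) ∂stdG - ψ (z i)| := Finset.abs_sum_le_sum_abs _ _
        _ ≤ ∑ i ∈ B, C * t := by
            refine Finset.sum_le_sum fun i _ => (hh.bias s _ hs hs1).trans ?_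
            gcongr
        _ = C * t * B.card := by simp; ring
        _ ≤ C * t * N := by gcongr
        _ = _ := by ring
    rw [e1]
    refine (abs_add_three _ _ _).trans ?_
    have e4 : t * N ≤ C * (t * N) := le_mul_of_one_le_left (by positivity) hC
    have e5 : 0 ≤ C * (t * N) := by positivity
    nlinarith
  refine (abs_add_le _ _).trans ?_
  linarith

lemma shifted_conc (hh : Estimates h ψ C J) (z : ι → ℝ) {s s0 N t : ℝ} (hs : 0 < s) (hss : s ≤ s0)
    (hs1 : s0 ≤ 1) (hn : Fintype.card ι * exp (-(1 / (64 * s0 ^ 2))) ≤ 1)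
    (ht : 0 < t) (ht1 : t ≤ 1) (hst : s0 ^ J ≤ t)
    (B : Finset ι) (hB : ∀ i, i ∈ B ↔ 1 / 2 ≤ |z i|) (hN : (B.card : ℝ) ≤ N) (d : (ι → ℝ) → ℝ) :
    (gaussPi ι).real {g | |d g| ≤ t / 8 ∧
      4 * C * t * N < |∑ i, h s (z i + s * g i + d g * z i) - ∑ i, ψ (z i)|} ≤
      11 * exp (-(t ^ 2 * N / (64 * C ^ 2 * s0 ^ 2))) := by
  have hC := hh.one_le
  have hN0 : 0 ≤ N := le_trans (Nat.cast_nonneg _) hN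
  have hs0 : 0 < s0 := hs.trans_le hss
  refine (measureReal_mono (s₂ := {g : ι → ℝ | t * N ≤ ∑ i, if 1 / 4 ≤ s * |g i| then (1 : ℝ) else 0} ∪
    {g | 2 * N ≤ ∑ i ∈ B, s * |g i|} ∪ {g | t * N ≤ |∑ i ∈ B, (h s (z i + s * g i) -
      ∫ y, h s (z i + s * y) ∂stdG)|}) fun g hg => ?_).trans ?_
  · by_contra hcon
    rw [Set.mem_union, Set.mem_union, not_or, not_or] at hcon
    obtain ⟨⟨c1, c2⟩, c3⟩ := hcon
    exact absurd (sum_error_le hh z hs (hss.trans hs1) hN0 ht ht1 hg.1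
      ((pow_le_pow_left₀ hs.le hss J).trans hst) B hB hN g (not_le.1 c1) (not_le.1 c2) (not_le.1 c3))
      (not_le.2 hg.2)
  · refine (measureReal_union_le _ _).trans ((add_le_add ((measureReal_union_le _ _).trans
      (add_le_add (tail_count hs hss hn _) (tail_sum_abs B hs (hss.trans hs1) hN)))
      (tail_centered hh B z hs (hss.trans hs1) hN ht)).trans ?_)
    set X := t ^ 2 * N / (64 * C ^ 2 * s0 ^ 2) with hX
    have ht2 : t ^ 2 ≤ t := by nlinarith
    have hC2 : 1 ≤ C ^ 2 := one_le_pow₀ hC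
    have hsq : s ^ 2 ≤ s0 ^ 2 := by gcongr
    have hCs : s ^ 2 ≤ C ^ 2 * s0 ^ 2 := hsq.trans (le_mul_of_one_le_left (by positivity) hC2)
    have b1 : X ≤ t * N / (64 * s ^ 2) := by
      rw [hX]
      gcongr ?_ / ?_
      · exact mul_le_mul_of_nonneg_right ht2 hN0
      · linarith
    have b2 : X ≤ N / (2 * s ^ 2) := by
      rw [hX]
      gcongr ?_ / ?_
      · exact mul_le_of_le_one_left hN0 (ht2.trans ht1)
      · nlinarith [sq_nonneg s]
    have b3 : X ≤ t ^ 2 * N / (4 * C ^ 2 * s ^ 2) := by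
      rw [hX]
      gcongr ?_ / (?_ * ?_ * ?_) <;> norm_num
    have c1 : exp (2 - t * N / (64 * s ^ 2)) ≤ 8 * exp (-X) := by
      have e2 : exp 2 ≤ 8 := by
        have h1 := exp_one_lt_d9
        have h2 : exp 2 = exp 1 * exp 1 := by rw [← exp_add]; norm_num
        rw [h2]; nlinarith [exp_pos 1]
      rw [sub_eq_add_neg, exp_add]
      gcongr
    have c2 : exp (-(N / (2 * s ^ 2))) ≤ exp (-X) := by gcongr
    have c3 : exp (-(t ^ 2 * N / (4 * C ^ 2 * s ^ 2))) ≤ exp (-X) := by gcongr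
    linarith

/-- Concentration of the statistic `∑ i, h s (ẑ i)` computed from one Gaussian sketch. -/
lemma base_conc (hh : Estimates h ψ C J) {m : ℕ} (hm : 0 < m) (z : ι → ℝ) {s0 N t : ℝ}
    (hs1 : s0 ≤ 1) (hn : Fintype.card ι * exp (-(1 / (64 * s0 ^ 2))) ≤ 1)
    (ht : 0 < t) (ht1 : t ≤ 1) (hst : s0 ^ J ≤ t) (hz : 2 * nrm z ≤ s0 * √m)
    (B : Finset ι) (hB : ∀ i, i ∈ B ↔ 1 / 2 ≤ |z i|) (hN : (B.card : ℝ) ≤ N) :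
    (gaussPi (Fin m × ι)).real {A | 4 * C * t * N <
      |∑ i, h (baseScale A z) (baseVec A z i) - ∑ i, ψ (z i)|} ≤
      11 * exp (-(t ^ 2 * N / (64 * C ^ 2 * s0 ^ 2))) + 4 * exp (-(t ^ 2 * m / 2048)) := by
  have hC := hh.one_le
  have hN0 : 0 ≤ N := le_trans (Nat.cast_nonneg _) hN
  have hmR : (0 : ℝ) < m := by exact_mod_cast hm
  by_cases hz0 : z = 0
  · have hemp : {A : Fin m × ι → ℝ | 4 * C * t * N <
      |∑ i, h (baseScale A z) (baseVec A z i) - ∑ i, ψ (z i)|} = ∅ := by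
      ext A
      subst hz0
      have a1 : baseScale A 0 = 0 := by simp [baseScale, nrm]
      have a2 : ∀ i, baseVec A 0 i = 0 := fun i => by simp [baseVec]
      have a3 : h 0 0 = 0 := hh.zero _ _ le_rfl zero_le_one (by simp)
      have a4 : ψ 0 = 0 := hh.zero_target _ (by simp)
      have a5 : 0 ≤ 4 * C * t * N := by positivity
      change 4 * C * t * N < |∑ i, h (baseScale A 0) (baseVec A 0 i) - ∑ i, ψ ((0 : ι → ℝ) i)| ↔ False
      simp only [a1, a2, a3, Pi.zero_apply, a4]
      simpa using a5
    rw [hemp, measureReal_empty]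
    positivity
  have hD := nrm_pos hz0
  have hE : MeasurableSet {q : ℝ × (ι → ℝ) | 4 * C * t * N <
      |∑ i, h q.1 (q.2 i) - ∑ i, ψ (z i)|} := by
    have hm' : ∀ i, Measurable fun q : ℝ × (ι → ℝ) => h q.1 (q.2 i) := fun i =>
      hh.meas.comp (measurable_fst.prodMk (by fun_prop))
    refine measurableSet_lt measurable_const ?_
    exact Measurable.abs ((Finset.measurable_sum _ fun i _ => hm' i).sub measurable_const)
  have hV : MeasurableSet {v : Fin m → ℝ | t / 16 * m ≤ |∑ r, (v r ^ 2 - 1)|} :=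
    measurableSet_le measurable_const (by fun_prop)
  have hbound := base_law (m := m) hz0 hE hV ?_
    (c := 11 * exp (-(t ^ 2 * N / (64 * C ^ 2 * s0 ^ 2))) + 2 * exp (-(t ^ 2 * m / 2048)))
    (by positivity) ?_
  · refine hbound.trans ?_
    have := tail_sum_sq m (η := t / 16) (by positivity) (by linarith)
    rw [show (t / 16) ^ 2 * m / 8 = t ^ 2 * m / 2048 by ring] at this
    linarith
  · change t / 16 * m ≤ |∑ r : Fin m, ((0 : ℝ) ^ 2 - 1)|
    simp
    nlinarith
  · intro v hv
    have hv' : |∑ r, (v r ^ 2 - 1)| < t / 16 * m := not_le.1 hv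
    have hsum : ∑ r, (v r ^ 2 - 1) = nrm v ^ 2 - m := by
      rw [Finset.sum_sub_distrib, nrm_sq]; simp
    rw [hsum] at hv'
    obtain ⟨hv1, hv2⟩ := abs_lt.1 hv'
    have hvpos : 0 < nrm v ^ 2 := by nlinarith
    have hvn : 0 < nrm v := by
      rcases (nrm_nonneg v).eq_or_lt with h0 | h0
      · rw [← h0] at hvpos; norm_num at hvpos
      · exact h0
    have hvle : nrm v ≤ 2 * √m := by
      refine abs_le_of_sq_le_sq' ?_ (by positivity) |>.2
      rw [mul_pow, sq_sqrt hmR.le]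
      nlinarith
    have hsq : √m * √m = (m : ℝ) := mul_self_sqrt hmR.le
    have hsqp : 0 < √(m : ℝ) := sqrt_pos.2 hmR
    have hs : 0 < nrm z * nrm v / m := by positivity
    have hss : nrm z * nrm v / m ≤ s0 := by
      rw [div_le_iff₀ hmR]
      calc nrm z * nrm v ≤ nrm z * (2 * √m) := by gcongr
        _ = 2 * nrm z * √m := by ring
        _ ≤ s0 * √m * √m := by gcongr
        _ = s0 * m := by rw [mul_assoc, hsq]
    refine (measureReal_mono (s₂ := {g : ι → ℝ | |nrm v ^ 2 / m - 1 - nrm v / m *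
        ∑ j, g j * (z j / nrm z)| ≤ t / 8 ∧ 4 * C * t * N < |∑ i, h (nrm z * nrm v / m)
        (z i + nrm z * nrm v / m * g i + (nrm v ^ 2 / m - 1 - nrm v / m *
        ∑ j, g j * (z j / nrm z)) * z i) - ∑ i, ψ (z i)|} ∪
        {g | t * √m / 32 ≤ |∑ j, g j * (z j / nrm z)|}) fun g hg => ?_).trans
        ((measureReal_union_le _ _).trans (add_le_add
          (shifted_conc hh z hs hss hs1 hn ht ht1 hst B hB hN _) ?_))
    · rw [Set.mem_union, or_iff_not_imp_right]
      intro hg2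
      have hg2' : |∑ j, g j * (z j / nrm z)| < t * √m / 32 := not_le.1 hg2
      refine ⟨?_, hg⟩
      have a1 : |nrm v ^ 2 / m - 1| ≤ t / 16 := by
        rw [show nrm v ^ 2 / m - 1 = (nrm v ^ 2 - m) / m by field_simp, abs_div, abs_of_pos hmR,
          div_le_iff₀ hmR]
        exact hv'.le
      have a2 : |nrm v / m * ∑ j, g j * (z j / nrm z)| ≤ t / 16 := by
        rw [abs_mul, abs_of_pos (by positivity)]
        calc nrm v / m * |∑ j, g j * (z j / nrm z)| ≤ 2 * √m / m * (t * √m / 32) := by gcongr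
          _ = t / 16 * (√m * √m / m) := by ring
          _ = t / 16 := by rw [hsq, div_self hmR.ne', mul_one]
      exact (abs_sub _ _).trans (by linarith)
    · refine (tail_linear_form _ (sum_normalize_sq hz0) (by positivity)).trans (le_of_eq ?_)
      rw [div_pow, mul_pow, sq_sqrt hmR.le]
      ring_nf

end

section Bump

/-- A smooth compactly supported function vanishing on `[-1, 1]`. -/
structure Bump (f : ℝ → ℝ) : Prop where
  smooth : ContDiff ℝ ((⊤ : ℕ∞) : WithTop ℕ∞) f
  compact : HasCompactSupport f
  zero : ∀ y, |y| ≤ 1 → f y = 0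

lemma Bump.deriv {f : ℝ → ℝ} (hf : Bump f) : Bump (deriv f) := by
  have hc : ContDiff ℝ ((⊤ : ℕ∞) : WithTop ℕ∞) (_root_.deriv f) :=
    ((contDiff_succ_iff_deriv (n := ((⊤ : ℕ∞) : WithTop ℕ∞))).1 (by simpa using hf.smooth)).2.2
  refine ⟨hc, hf.compact.deriv, fun y hy => ?_⟩
  have hcl : IsClosed {y | _root_.deriv f y = 0} := isClosed_eq hc.continuous continuous_const
  have hsub : Set.Ioo (-1 : ℝ) 1 ⊆ {y | _root_.deriv f y = 0} := by
    intro x hx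
    change _root_.deriv f x = 0
    have : f =ᶠ[nhds x] fun _ => 0 := by
      filter_upwards [isOpen_Ioo.mem_nhds hx] with w hw
      exact hf.zero w (abs_le.2 ⟨hw.1.le, hw.2.le⟩)
    rw [this.deriv_eq]; simp
  have := closure_minimal hsub hcl
  rw [closure_Ioo (by norm_num)] at this
  exact this (abs_le.1 hy)

lemma Bump.lipschitz {f : ℝ → ℝ} (hf : Bump f) : ∃ K : ℝ, 0 ≤ K ∧ ∀ x y, |f x - f y| ≤ K * |x - y| := by
  obtain ⟨K, hK⟩ := ContDiff.lipschitzWith_of_hasCompactSupport hf.compact hf.smooth (by simp)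
  exact ⟨K, K.2, fun x y => by simpa [Real.dist_eq] using hK.dist_le_mul x y⟩

lemma Bump.bounded {f : ℝ → ℝ} (hf : Bump f) : ∃ K : ℝ, 0 ≤ K ∧ ∀ x, |f x| ≤ K := by
  obtain ⟨K, hK⟩ := hf.compact.exists_bound_of_continuous hf.smooth.continuous
  exact ⟨K, (abs_nonneg _).trans (hK 0), hK⟩

lemma Bump.hasDerivAt {f : ℝ → ℝ} (hf : Bump f) (x : ℝ) : HasDerivAt f (_root_.deriv f x) x :=
  (hf.smooth.differentiable (by simp) x).hasDerivAt

lemma rel_lipschitz {f : ℝ → ℝ} {K R c : ℝ} (hK0 : 0 ≤ K) (hR : 0 ≤ R)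
    (hK : ∀ x y, |f x - f y| ≤ K * |x - y|) (hc : ∀ y, R ≤ |y| → f y = c) {b : ℝ}
    (hb : 1 / 2 ≤ b) (y : ℝ) : |f (b * y) - f y| ≤ 2 * R * K * |b - 1| := by
  by_cases h : |y| ≤ 2 * R
  · calc |f (b * y) - f y| ≤ K * |b * y - y| := hK _ _
      _ = K * |b - 1| * |y| := by rw [show b * y - y = (b - 1) * y by ring, abs_mul]; ring
      _ ≤ K * |b - 1| * (2 * R) := by gcongr
      _ = _ := by ring
  · have h' := not_le.1 h
    rw [hc y (by linarith), hc (b * y) (by rw [abs_mul, abs_of_pos (by linarith)]; nlinarith)]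
    simp only [sub_self, abs_zero]
    positivity

lemma Bump.rel {f : ℝ → ℝ} (hf : Bump f) :
    ∃ K : ℝ, 0 ≤ K ∧ ∀ b y, 1 / 2 ≤ b → |f (b * y) - f y| ≤ K * |b - 1| := by
  obtain ⟨K, hK0, hK⟩ := hf.lipschitz
  obtain ⟨R, hR⟩ := hf.compact.isCompact.isBounded.exists_norm_le
  refine ⟨2 * (|R| + 1) * K, by positivity, fun b y hb =>
    rel_lipschitz hK0 (by positivity) hK (c := 0) (fun y hy => ?_) hb y⟩
  by_contra hne
  have := hR y (subset_tsupport _ hne)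
  rw [Real.norm_eq_abs] at this
  linarith [le_abs_self R]

/-- Gaussian integration by parts. -/
lemma Bump.stein {f : ℝ → ℝ} (hf : Bump f) (z s : ℝ) :
    ∫ g, g * f (z + s * g) ∂stdG = s * ∫ g, _root_.deriv f (z + s * g) ∂stdG := by
  have hv : (1 : NNReal) ≠ 0 := one_ne_zero
  rw [integral_gaussianReal_eq_integral_smul hv, integral_gaussianReal_eq_integral_smul hv]
  have hpdf : ∀ x : ℝ, HasDerivAt (gaussianPDFReal 0 1) (-(x * gaussianPDFReal 0 1 x)) x := by
    intro x
    have h1 : HasDerivAt (fun x : ℝ => -(x - 0) ^ 2 / (2 * ((1 : NNReal) : ℝ))) (-x) x := by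
      have := ((((hasDerivAt_id x).sub_const 0).pow 2).neg).div_const (2 * ((1 : NNReal) : ℝ))
      refine this.congr_deriv ?_
      simp; ring
    have h2 := (h1.exp).const_mul (√(2 * π * ((1 : NNReal) : ℝ)))⁻¹
    rw [gaussianPDFReal_def]
    refine h2.congr_deriv ?_
    beta_reduce
    ring
  have hcp : Continuous (gaussianPDFReal 0 1) :=
    continuous_iff_continuousAt.2 fun x => (hpdf x).continuousAt
  have hfs : ∀ x, HasDerivAt (fun g => f (z + s * g)) (s * _root_.deriv f (z + s * x)) x := by
    intro x
    have h1 : HasDerivAt (fun g : ℝ => z + s * g) s x := by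
      simpa using ((hasDerivAt_id x).const_mul s).const_add z
    exact ((hf.hasDerivAt (z + s * x)).comp x h1).congr_deriv (by ring)
  obtain ⟨K, hK0, hK⟩ := hf.bounded
  obtain ⟨K', hK0', hK'⟩ := hf.deriv.bounded
  have hcf : Continuous fun g => f (z + s * g) := hf.smooth.continuous.comp (by fun_prop)
  have hcf' : Continuous fun g => s * _root_.deriv f (z + s * g) :=
    continuous_const.mul (hf.deriv.smooth.continuous.comp (by fun_prop))
  have hip : Integrable (gaussianPDFReal 0 1) := integrable_gaussianPDFReal 0 1
  have hig : Integrable fun x : ℝ => x * gaussianPDFReal 0 1 x := by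
    have := integrable_mul_exp_neg_mul_sq (b := 1 / 2) (by norm_num)
    refine (this.const_mul (√(2 * π * ((1 : NNReal) : ℝ)))⁻¹).congr (ae_of_all _ fun x => ?_)
    simp only [gaussianPDFReal_def]
    rw [show -(x - 0) ^ 2 / (2 * ((1 : NNReal) : ℝ)) = -(1 / 2) * x ^ 2 by simp; ring]
    ring
  have := integral_mul_deriv_eq_deriv_mul_of_integrable (u := fun g => f (z + s * g))
    (v := gaussianPDFReal 0 1) (u' := fun g => s * _root_.deriv f (z + s * g))
    (v' := fun x => -(x * gaussianPDFReal 0 1 x)) (fun x _ => hfs x) (fun x _ => hpdf x)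
    (hig.neg.bdd_mul hcf.aestronglyMeasurable (ae_of_all _ fun x => hK _))
    (hip.bdd_mul hcf'.aestronglyMeasurable (c := |s| * K')
      (ae_of_all _ fun x => by rw [norm_mul]; gcongr; exacts [le_rfl, hK' _]))
    (hip.bdd_mul hcf.aestronglyMeasurable (ae_of_all _ fun x => hK _))
  rw [← integral_const_mul]
  have e1 : ∀ x, gaussianPDFReal 0 1 x • (x * f (z + s * x)) =
    -(f (z + s * x) * -(x * gaussianPDFReal 0 1 x)) := fun x => by rw [smul_eq_mul]; ring
  simp_rw [e1]
  rw [integral_neg, this, neg_neg]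
  refine integral_congr_ae (ae_of_all _ fun x => ?_)
  simp only [smul_eq_mul]; ring

lemma Bump.hasDerivAt_integral {f : ℝ → ℝ} (hf : Bump f) (z s : ℝ) :
    HasDerivAt (fun s => ∫ g, f (z + s * g) ∂stdG)
      (s * ∫ g, _root_.deriv (_root_.deriv f) (z + s * g) ∂stdG) s := by
  rw [← hf.deriv.stein]
  obtain ⟨K, hK0, hK⟩ := hf.bounded
  obtain ⟨K', hK0', hK'⟩ := hf.deriv.bounded
  have hcf : ∀ s : ℝ, Continuous fun g => f (z + s * g) :=
    fun s => hf.smooth.continuous.comp (by fun_prop)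
  have hcf' : Continuous fun g => g * _root_.deriv f (z + s * g) :=
    continuous_id.mul (hf.deriv.smooth.continuous.comp (by fun_prop))
  have h_int : Integrable (fun g : ℝ => K' * |g|) stdG := by
    have : Integrable (fun g : ℝ => g) stdG :=
      (memLp_id_gaussianReal (μ := 0) (v := 1) 1).integrable le_rfl
    exact (this.abs).const_mul K'
  refine (hasDerivAt_integral_of_dominated_loc_of_deriv_le (μ := stdG) (s := Set.univ)
    (F := fun s g => f (z + s * g)) (F' := fun s g => g * _root_.deriv f (z + s * g))
    (bound := fun g => K' * |g|) Filter.univ_mem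
    (Filter.Eventually.of_forall fun s => (hcf s).aestronglyMeasurable)
    ((integrable_const K).mono' (hcf s).aestronglyMeasurable (ae_of_all _ fun x => hK _))
    hcf'.aestronglyMeasurable (ae_of_all _ fun g s _ => ?_) h_int
    (ae_of_all _ fun g s _ => ?_)).2
  · rw [norm_mul, mul_comm]
    exact mul_le_mul_of_nonneg_right (hK' _) (norm_nonneg g)
  · have h1 : HasDerivAt (fun s : ℝ => z + s * g) g s := by
      simpa using ((hasDerivAt_id s).mul_const g).const_add z
    exact ((hf.hasDerivAt (z + s * g)).comp s h1).congr_deriv (by ring)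

/-- Iterated second derivatives. -/
noncomputable def lap (f : ℝ → ℝ) (j : ℕ) : ℝ → ℝ := (fun f => deriv (deriv f))^[j] f

lemma lap_succ (f : ℝ → ℝ) (j : ℕ) : lap f (j + 1) = deriv (deriv (lap f j)) :=
  Function.iterate_succ_apply' _ _ _

lemma Bump.lap {f : ℝ → ℝ} (hf : Bump f) (j : ℕ) : Bump (lap f j) := by
  induction j with
  | zero => exact hf
  | succ j ih => rw [lap_succ]; exact ih.deriv.deriv

/-- Truncated inverse heat flow. -/
noncomputable def heatInv (f : ℝ → ℝ) (J : ℕ) (s y : ℝ) : ℝ :=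
  ∑ j ∈ Finset.range J, (-1 / 2) ^ j / (j.factorial : ℝ) * s ^ (2 * j) * lap f j y

lemma Bump.integrable {f : ℝ → ℝ} (hf : Bump f) (z s : ℝ) :
    Integrable (fun g => f (z + s * g)) stdG := by
  obtain ⟨K, hK0, hK⟩ := hf.bounded
  have hcf : Continuous fun g => f (z + s * g) := hf.smooth.continuous.comp (by fun_prop)
  exact (integrable_const K).mono' hcf.aestronglyMeasurable (ae_of_all _ fun x => hK _)

lemma Bump.bias {f : ℝ → ℝ} (hf : Bump f) (J : ℕ) : ∃ K : ℝ, 0 ≤ K ∧ ∀ s z : ℝ, 0 < s →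
    |∫ g, heatInv f (J + 1) s (z + s * g) ∂stdG - f z| ≤ K * s ^ (2 * (J + 1)) := by
  obtain ⟨K, hK0, hK⟩ := (hf.lap (J + 1)).bounded
  refine ⟨K, hK0, fun s z hs => ?_⟩
  set u : ℕ → ℝ → ℝ := fun j s => ∫ g, FpSketch.lap f j (z + s * g) ∂stdG with hu
  set a : ℕ → ℝ := fun j => (-1 / 2) ^ j / (j.factorial : ℝ) with ha
  have hua : ∀ j s, HasDerivAt (u j) (s * u (j + 1) s) s := fun j s => by
    have := (hf.lap j).hasDerivAt_integral z s
    rw [← lap_succ] at this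
    exact this
  have haa : ∀ j : ℕ, (2 * (j + 1) : ℝ) * a (j + 1) = -a j := fun j => by
    simp only [ha, Nat.factorial_succ, Nat.cast_mul, Nat.cast_add, Nat.cast_one, pow_succ]
    have : (j.factorial : ℝ) ≠ 0 := by positivity
    field_simp
  have hder : ∀ J : ℕ, ∀ s, HasDerivAt (fun s => ∑ j ∈ Finset.range (J + 1), a j * s ^ (2 * j) * u j s)
      (a J * s ^ (2 * J + 1) * u (J + 1) s) s := by
    intro J s
    induction J with
    | zero => simpa [ha] using hua 0 s
    | succ J ih =>
      have h1 : HasDerivAt (fun s => a (J + 1) * s ^ (2 * (J + 1)) * u (J + 1) s)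
          (a (J + 1) * ((2 * (J + 1) : ℝ) * s ^ (2 * J + 1)) * u (J + 1) s +
            a (J + 1) * s ^ (2 * (J + 1)) * (s * u (J + 2) s)) s := by
        have h2 := (hasDerivAt_pow (2 * (J + 1)) s).const_mul (a (J + 1))
        have h3 := h2.mul (hua (J + 1) s)
        refine h3.congr_deriv ?_
        have : 2 * (J + 1) - 1 = 2 * J + 1 := by omega
        rw [this]; push_cast; ring
      have h4 := ih.add h1
      simp only [Finset.sum_range_succ _ (J + 1)]
      refine h4.congr_deriv ?_
      have := haa J
      linear_combination (s ^ (2 * J + 1) * u (J + 1) s) * this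
  have hsum : ∫ g, heatInv f (J + 1) s (z + s * g) ∂stdG =
      ∑ j ∈ Finset.range (J + 1), a j * s ^ (2 * j) * u j s := by
    simp only [heatInv]
    rw [integral_finsetSum _ fun j _ => ((hf.lap j).integrable z s).const_mul _]
    exact Finset.sum_congr rfl fun j _ => integral_const_mul _ _
  have h0 : ∑ j ∈ Finset.range (J + 1), a j * (0 : ℝ) ^ (2 * j) * u j 0 = f z := by
    rw [Finset.sum_range_succ']
    simp [ha, hu, FpSketch.lap]
  have haJ : |a J| ≤ 1 := by
    simp only [ha, abs_div, abs_pow]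
    rw [div_le_one (by positivity), Nat.abs_cast]
    refine (pow_le_one₀ (by positivity) (by norm_num [abs_le])).trans ?_
    exact_mod_cast Nat.one_le_iff_ne_zero.2 (Nat.factorial_ne_zero J)
  have huK : ∀ s, |u (J + 1) s| ≤ K := fun s => by
    have := norm_integral_le_of_norm_le_const (μ := stdG)
      (f := fun g => FpSketch.lap f (J + 1) (z + s * g)) (ae_of_all _ fun x => hK _)
    simpa using this
  have hmv := Convex.norm_image_sub_le_of_norm_hasDerivWithin_le (𝕜 := ℝ) (s := Set.Icc 0 s)
    (x := 0) (y := s) (C := K * s ^ (2 * J + 1)) (fun x _ => (hder J x).hasDerivWithinAt)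
    (fun x hx => by
      rw [norm_mul, norm_mul, norm_pow]
      simp only [Real.norm_eq_abs]
      rw [abs_of_nonneg hx.1]
      calc |a J| * x ^ (2 * J + 1) * |u (J + 1) x| ≤ 1 * s ^ (2 * J + 1) * K := by
            have := hx.1
            have := hx.2
            gcongr
            exact huK x
        _ = _ := by ring)
    (convex_Icc 0 s) ⟨le_rfl, hs.le⟩ ⟨hs.le, le_rfl⟩
  rw [h0] at hmv
  rw [hsum]
  simp only [Real.norm_eq_abs, sub_zero, abs_of_pos hs] at hmv
  refine hmv.trans (le_of_eq ?_)
  ring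

lemma Bump.estimates {f : ℝ → ℝ} (hf : Bump f) (J : ℕ) :
    ∃ C, Estimates (heatInv f (J + 1)) f C (2 * (J + 1)) := by
  choose B hB0 hB using fun j => (hf.lap j).bounded
  choose L hL0 hL using fun j => (hf.lap j).lipschitz
  choose R hR0 hR using fun j => (hf.lap j).rel
  obtain ⟨K, hK0, hK⟩ := hf.bias J
  set C : ℝ := 1 + K + B 0 + ∑ j ∈ Finset.range (J + 1), (B j + L j + R j) with hC
  have hS0 : 0 ≤ ∑ j ∈ Finset.range (J + 1), (B j + L j + R j) :=
    Finset.sum_nonneg fun j _ => add_nonneg (add_nonneg (hB0 j) (hL0 j)) (hR0 j)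
  have hco : ∀ (j : ℕ) (s : ℝ), 0 ≤ s → s ≤ 1 →
      |(-1 / 2 : ℝ) ^ j / (j.factorial : ℝ) * s ^ (2 * j)| ≤ 1 := by
    intro j s h0 h1
    rw [abs_mul, abs_div, abs_pow, abs_of_nonneg (pow_nonneg h0 _), Nat.abs_cast]
    refine mul_le_one₀ ?_ (by positivity) (pow_le_one₀ h0 h1)
    rw [div_le_one (by positivity)]
    refine (pow_le_one₀ (by positivity) (by norm_num [abs_le])).trans ?_
    exact_mod_cast Nat.one_le_iff_ne_zero.2 (Nat.factorial_ne_zero j)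
  have hdiff : ∀ (s y y' d : ℝ), 0 ≤ s → s ≤ 1 → 0 ≤ d →
      (∀ j, |FpSketch.lap f j y - FpSketch.lap f j y'| ≤ (B j + L j + R j) * d) →
      |heatInv f (J + 1) s y - heatInv f (J + 1) s y'| ≤ C * d := by
    intro s y y' d h0 h1 hd hj
    have : heatInv f (J + 1) s y - heatInv f (J + 1) s y' = ∑ j ∈ Finset.range (J + 1),
        (-1 / 2) ^ j / (j.factorial : ℝ) * s ^ (2 * j) *
        (FpSketch.lap f j y - FpSketch.lap f j y') := by
      simp only [heatInv, mul_sub, Finset.sum_sub_distrib]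
    rw [this]
    calc _ ≤ ∑ j ∈ Finset.range (J + 1), (B j + L j + R j) * d := by
          refine (Finset.abs_sum_le_sum_abs _ _).trans (Finset.sum_le_sum fun j _ => ?_)
          rw [abs_mul]
          exact (mul_le_of_le_one_left (abs_nonneg _) (hco j s h0 h1)).trans (hj j)
      _ ≤ C * d := by
          rw [← Finset.sum_mul]
          have := hB0 0
          gcongr; linarith
  have hzero : ∀ s y, |y| ≤ 1 → heatInv f (J + 1) s y = 0 := fun s y hy =>
    Finset.sum_eq_zero fun j _ => by rw [(hf.lap j).zero y hy, mul_zero]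
  have hB00 := hB0 0
  refine ⟨C, ⟨by linarith, ?_, hf.smooth.continuous.measurable, fun s y h0 h1 => ?_,
    fun z => (hB 0 z).trans (by linarith), fun s y y' h0 h1 => ?_, fun s y b h0 h1 hb _ => ?_,
    fun s y _ _ hy => hzero s y hy, hf.zero, fun s z h0 _ => (hK s z h0).trans ?_⟩⟩
  · refine Finset.measurable_sum _ fun j _ => ?_
    have := (hf.lap j).smooth.continuous.measurable
    exact Measurable.mul (by fun_prop) (this.comp measurable_snd)
  · have := hdiff s y 0 1 h0 h1 zero_le_one fun j => by
      rw [(hf.lap j).zero 0 (by simp), sub_zero]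
      linarith [hB j y, hL0 j, hR0 j]
    rwa [hzero s 0 (by simp), sub_zero, mul_one] at this
  · refine hdiff s y y' _ h0 h1 (abs_nonneg _) fun j => (hL j y y').trans ?_
    gcongr
    linarith [hB0 j, hR0 j]
  · refine hdiff s _ _ _ h0 h1 (abs_nonneg _) fun j => (hR j b y hb).trans ?_
    gcongr
    linarith [hB0 j, hL0 j]
  · have : 0 ≤ s ^ (2 * (J + 1)) := by positivity
    gcongr
    linarith

end Bump

/-- Smooth cutoff, vanishing on `|z| ≤ 1` and equal to one for `|z| ≥ 2`. -/
noncomputable def cut (z : ℝ) : ℝ := smoothTransition ((z ^ 2 - 1) / 3)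

lemma cut_nonneg (z : ℝ) : 0 ≤ cut z := smoothTransition.nonneg _

lemma cut_le_one (z : ℝ) : cut z ≤ 1 := smoothTransition.le_one _

lemma cut_eq_zero {z : ℝ} (hz : |z| ≤ 1) : cut z = 0 :=
  smoothTransition.zero_of_nonpos (by
    have : z ^ 2 ≤ 1 := by rw [← sq_abs]; exact pow_le_one₀ (abs_nonneg _) hz
    linarith)

lemma cut_eq_one {z : ℝ} (hz : 2 ≤ |z|) : cut z = 1 :=
  smoothTransition.one_of_one_le (by
    have : 2 ^ 2 ≤ z ^ 2 := by rw [← sq_abs z]; gcongr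
    linarith)

lemma cut_mono {z w : ℝ} (h : |z| ≤ |w|) : cut z ≤ cut w :=
  smoothTransition.monotone (by
    have : z ^ 2 ≤ w ^ 2 := sq_le_sq.2 h
    linarith)

lemma contDiff_cut : ContDiff ℝ ((⊤ : ℕ∞) : WithTop ℕ∞) cut :=
  smoothTransition.contDiff.comp (by fun_prop)

lemma estimates_cut : ∃ C, Estimates (fun _ => cut) cut C 1 := by
  have hc : HasCompactSupport fun z => 1 - cut z := by
    refine HasCompactSupport.intro (isCompact_Icc (a := -2) (b := 2)) fun z hz => ?_
    rw [cut_eq_one, sub_self]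
    by_contra h
    exact hz (abs_le.1 (not_le.1 h).le)
  obtain ⟨K, hK⟩ := ContDiff.lipschitzWith_of_hasCompactSupport hc
    (contDiff_const.sub contDiff_cut) (by simp)
  have hlip : ∀ x y, |cut x - cut y| ≤ K * |x - y| := fun x y => by
    have := hK.dist_le_mul x y
    rw [Real.dist_eq, Real.dist_eq, abs_sub_comm] at this
    refine le_trans (le_of_eq ?_) this
    congr 1; ring
  set M : ℝ := ∫ g : ℝ, |g| ∂stdG with hM
  have hM0 : 0 ≤ M := integral_nonneg fun _ => abs_nonneg _
  have h_int : Integrable (fun g : ℝ => |g|) stdG :=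
    ((memLp_id_gaussianReal (μ := 0) (v := 1) 1).integrable le_rfl).abs
  have hK0 : (0 : ℝ) ≤ K := K.2
  have hKM : 0 ≤ K * M := mul_nonneg hK0 hM0
  have habs : ∀ z, |cut z| ≤ 1 := fun z => by rw [abs_of_nonneg (cut_nonneg z)]; exact cut_le_one z
  refine ⟨1 + 4 * K + K * M, ⟨by linarith, contDiff_cut.continuous.measurable.comp measurable_snd,
    contDiff_cut.continuous.measurable, fun s y _ _ => (habs y).trans (by linarith),
    fun z => (habs z).trans (by linarith), fun s y y' _ _ => (hlip y y').trans ?_,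
    fun s y b _ _ hb _ => (rel_lipschitz hK0 zero_le_two hlip (c := 1)
      (fun y hy => cut_eq_one hy) hb y).trans ?_, fun s y _ _ hy => cut_eq_zero hy,
    fun z hz => cut_eq_zero hz, fun s z h0 _ => ?_⟩⟩
  · gcongr; linarith
  · gcongr; linarith
  · have hi : Integrable (fun g => cut (z + s * g)) stdG :=
      (integrable_const 1).mono' (contDiff_cut.continuous.comp
        (by fun_prop : Continuous fun g => z + s * g)).aestronglyMeasurable
        (ae_of_all _ fun _ => habs _)
    have e : ∫ g, cut (z + s * g) ∂stdG - cut z = ∫ g, (cut (z + s * g) - cut z) ∂stdG := by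
      rw [integral_sub hi (integrable_const _)]; simp
    rw [e]
    calc _ ≤ ∫ g, |cut (z + s * g) - cut z| ∂stdG := abs_integral_le_integral_abs
      _ ≤ ∫ g, K * s * |g| ∂stdG := by
          refine integral_mono (hi.sub (integrable_const _)).abs (h_int.const_mul _) fun g => ?_
          have := hlip (z + s * g) z
          rwa [add_sub_cancel_left, abs_mul, abs_of_pos h0, ← mul_assoc] at this
      _ = K * M * s := by rw [integral_const_mul]; ring
      _ ≤ _ := by
          rw [pow_one]
          gcongr; linarith

/-- A smooth piece of `|z| ^ p` supported on the shell `1 ≤ |z| ≤ 4`. -/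
noncomputable def shell (p z : ℝ) : ℝ := |z| ^ p * (cut z - cut (z / 2))

lemma bump_shell (p : ℝ) : Bump (shell p) := by
  have hz : ∀ y, |y| ≤ 1 → shell p y = 0 := fun y hy => by
    have : |y / 2| ≤ 1 := by rw [abs_div, abs_two]; linarith
    rw [shell, cut_eq_zero hy, cut_eq_zero this, sub_self, mul_zero]
  refine ⟨contDiff_iff_contDiffAt.2 fun z => ?_, ?_, hz⟩
  · by_cases h : z = 0
    · have : shell p =ᶠ[nhds z] fun _ => 0 := by
        filter_upwards [isOpen_Ioo.mem_nhds (show z ∈ Set.Ioo (-1 : ℝ) 1 by simp [h])] with w hw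
        exact hz w (abs_le.2 ⟨hw.1.le, hw.2.le⟩)
      exact contDiffAt_const.congr_of_eventuallyEq this
    · exact ((contDiffAt_abs h).rpow_const_of_ne (abs_ne_zero.2 h)).mul
        (contDiff_cut.contDiffAt.sub
          ((contDiff_cut.comp (contDiff_id.div_const 2)).contDiffAt))
  · refine HasCompactSupport.intro (isCompact_Icc (a := -4) (b := 4)) fun z hz => ?_
    have h4 : 4 ≤ |z| := by
      by_contra h
      exact hz (abs_le.1 (not_le.1 h).le)
    rw [shell, cut_eq_one (by linarith), cut_eq_one (by rw [abs_div, abs_two]; linarith), sub_self,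
      mul_zero]

/-- The sampling rate `2 ^ (-p)`. -/
noncomputable def rate (p : ℝ) : ℝ := 2 ^ (-p)

lemma rate_pos (p : ℝ) : 0 < rate p := by unfold rate; positivity

lemma rate_le {p : ℝ} (hp : 2 < p) : rate p ≤ 1 / 4 := by
  calc rate p ≤ (2 : ℝ) ^ (-2 : ℝ) := rpow_le_rpow_of_exponent_le (by norm_num) (by linarith)
    _ = 1 / 4 := by rw [rpow_neg (by norm_num), rpow_two]; norm_num

lemma rate_pow (p : ℝ) (l : ℕ) : rate p ^ l = ((2 : ℝ) ^ l)⁻¹ ^ p := by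
  rw [rate, ← rpow_natCast, ← rpow_mul (by norm_num), ← rpow_natCast 2 l, inv_rpow (by positivity),
    ← rpow_mul (by norm_num), ← rpow_neg (by norm_num)]
  ring_nf

lemma sum_pow_le {b : ℝ} (h0 : 0 ≤ b) (h1 : b < 1) (I : Finset ℕ) {a : ℕ} (hI : ∀ l ∈ I, a ≤ l) :
    ∑ l ∈ I, b ^ l ≤ b ^ a / (1 - b) := by
  refine le_trans (Finset.sum_le_sum_of_subset_of_nonneg (t := Finset.Ico a (I.sup id + 1))
    (fun l hl => Finset.mem_Ico.2 ⟨hI l hl, Nat.lt_succ_of_le (Finset.le_sup (f := id) hl)⟩)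
    fun _ _ _ => by positivity) (geom_sum_Ico_le_of_lt_one h0 h1)

lemma sum_rate_le {p : ℝ} (hp : 2 < p) {I : Finset ℕ} (hI : ∀ l ∈ I, 1 ≤ l) :
    ∑ l ∈ I, rate p ^ l ≤ 1 := by
  have h := rate_le hp
  refine (sum_pow_le (rate_pos p).le (by linarith) I hI).trans ?_
  rw [pow_one, div_le_one (by linarith)]
  linarith

/-- Geometric sums of rates over the levels at which `y` is visible. -/
lemma sum_rate_visible_le {p : ℝ} (hp : 2 < p) (I : Finset ℕ) {c : ℝ} (hc : 0 < c) (y : ℝ) :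
    ∑ l ∈ I, rate p ^ l * (if c ≤ |2 ^ l * y| then 1 else 0) ≤ 4 / 3 * (|y| / c) ^ p := by
  have h := rate_le hp
  have h0 := rate_pos p
  simp only [mul_ite, mul_one, mul_zero, ← Finset.sum_filter]
  set F := I.filter fun l => c ≤ |2 ^ l * y|
  rcases F.eq_empty_or_nonempty with hF | hF
  · rw [hF, Finset.sum_empty]; positivity
  · refine (sum_pow_le h0.le (by linarith) F (a := F.min' hF) fun l hl => F.min'_le l hl).trans ?_
    set a := F.min' hF with ha
    have ha' : c ≤ |2 ^ a * y| := (Finset.mem_filter.1 (F.min'_mem hF)).2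
    rw [abs_mul, abs_of_pos (by positivity)] at ha'
    have : rate p ^ a ≤ (|y| / c) ^ p := by
      rw [rate_pow]
      gcongr
      rw [inv_eq_one_div, div_le_div_iff₀ (by positivity) hc]
      linarith
    rw [div_le_iff₀ (by linarith)]
    have h2 : 0 ≤ (|y| / c) ^ p := by positivity
    nlinarith

/-- The law of one sampling weight: `2 ^ l` with probability `2 ^ (-p l)` for `l ∈ I`, else `0`. -/
noncomputable def samp (p : ℝ) (I : Finset ℕ) : Measure ℝ :=
  ∑ l ∈ I, ENNReal.ofReal (rate p ^ l) • Measure.dirac (2 ^ l : ℝ) +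
    ENNReal.ofReal (1 - ∑ l ∈ I, rate p ^ l) • Measure.dirac 0

section samp
variable {p : ℝ} {I : Finset ℕ}

lemma isProbabilityMeasure_samp (hp : 2 < p) (hI : ∀ l ∈ I, 1 ≤ l) :
    IsProbabilityMeasure (samp p I) := by
  constructor
  simp only [samp, Measure.add_apply, Measure.finsetSum_apply, Measure.smul_apply, measure_univ,
    smul_eq_mul, mul_one]
  have h0 := rate_pos p
  rw [← ENNReal.ofReal_sum_of_nonneg fun _ _ => by positivity, ← ENNReal.ofReal_add
    (Finset.sum_nonneg fun _ _ => by positivity) (by linarith [sum_rate_le hp hI])]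
  simp

lemma integrable_samp (p : ℝ) (I : Finset ℕ) (f : ℝ → ℝ) : Integrable f (samp p I) := by
  have : ∀ a : ℝ, Integrable f (Measure.dirac a) := fun a => integrable_dirac (by simp)
  refine Integrable.add_measure ?_ ((this 0).smul_measure ENNReal.ofReal_ne_top)
  exact integrable_finsetSum_measure.2 fun l _ => (this _).smul_measure ENNReal.ofReal_ne_top

lemma integral_samp (hp : 2 < p) (hI : ∀ l ∈ I, 1 ≤ l) (f : ℝ → ℝ) :
    ∫ v, f v ∂(samp p I) =
      ∑ l ∈ I, rate p ^ l * f (2 ^ l) + (1 - ∑ l ∈ I, rate p ^ l) * f 0 := by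
  have : ∀ a : ℝ, Integrable f (Measure.dirac a) := fun a => integrable_dirac (by simp)
  have h0 := rate_pos p
  rw [samp, integral_add_measure (integrable_finsetSum_measure.2 fun l _ =>
      (this _).smul_measure ENNReal.ofReal_ne_top)
    ((this 0).smul_measure ENNReal.ofReal_ne_top), integral_finsetSum_measure fun l _ =>
      (this _).smul_measure ENNReal.ofReal_ne_top]
  simp only [integral_smul_measure, integral_dirac, smul_eq_mul]
  rw [ENNReal.toReal_ofReal (by linarith [sum_rate_le hp hI])]
  congr 1
  exact Finset.sum_congr rfl fun l _ => by rw [ENNReal.toReal_ofReal (by positivity)]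

/-- Mean of `ψ` under sampling. -/
noncomputable def sampMean (p : ℝ) (I : Finset ℕ) (ψ : ℝ → ℝ) (y : ℝ) : ℝ :=
  ∑ l ∈ I, rate p ^ l * ψ (2 ^ l * y)

lemma integral_samp_comp (hp : 2 < p) (hI : ∀ l ∈ I, 1 ≤ l) {ψ : ℝ → ℝ} (h : ψ 0 = 0) (y : ℝ) :
    ∫ v, ψ (v * y) ∂(samp p I) = sampMean p I ψ y := by
  rw [integral_samp hp hI fun v => ψ (v * y), zero_mul, h, mul_zero, add_zero, sampMean]

lemma integral_visible_le (hp : 2 < p) (hI : ∀ l ∈ I, 1 ≤ l) (y : ℝ) :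
    ∫ v, (if 1 / 2 ≤ |v * y| then (1 : ℝ) else 0) ∂(samp p I) ≤ 4 / 3 * 2 ^ p * |y| ^ p := by
  have := integral_samp_comp hp hI (ψ := fun z => if 1 / 2 ≤ |z| then (1 : ℝ) else 0) (by norm_num) y
  beta_reduce at this
  rw [this, mul_assoc, ← mul_rpow (by norm_num) (abs_nonneg y)]
  refine (sum_rate_visible_le hp I (c := 1 / 2) (by norm_num) y).trans (le_of_eq ?_)
  congr 2; ring

lemma integral_exp_le_of_quadratic {μ : Measure ℝ} [IsProbabilityMeasure μ] {u v : ℝ → ℝ}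
    (hi : Integrable (fun x => exp (u x)) μ) (hu : Integrable u μ) (hv : Integrable v μ)
    (h : ∀ x, exp (u x) ≤ 1 + u x + v x) :
    ∫ x, exp (u x) ∂μ ≤ exp (∫ x, u x ∂μ + ∫ x, v x ∂μ) := by
  calc ∫ x, exp (u x) ∂μ ≤ ∫ x, (1 + u x + v x) ∂μ :=
        integral_mono hi (((integrable_const 1).add hu).add hv) h
    _ = 1 + ∫ x, u x ∂μ + ∫ x, v x ∂μ := by
        rw [integral_add (f := fun x => 1 + u x) ((integrable_const 1).add hu) hv,
          integral_add (f := fun _ => (1 : ℝ)) (integrable_const 1) hu]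
        simp
    _ ≤ _ := by linarith [add_one_le_exp (∫ x, u x ∂μ + ∫ x, v x ∂μ)]

variable {ι : Type*} [Fintype ι]

lemma samp_count (hp : 2 < p) (hI : ∀ l ∈ I, 1 ≤ l) (x : ι → ℝ) {N : ℝ}
    (hN : 4 * 2 ^ p * ∑ i, |x i| ^ p ≤ N) :
    (Measure.pi fun _ : ι => samp p I).real
      {v | N ≤ ∑ i, if 1 / 2 ≤ |v i * x i| then (1 : ℝ) else 0} ≤ exp (-(N / 3)) := by
  have := isProbabilityMeasure_samp hp hI
  refine (chernoff (fun _ : ι => samp p I) (fun i v => if 1 / 2 ≤ |v * x i| then (1 : ℝ) else 0)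
    (fun i => 2 * (4 / 3 * 2 ^ p * |x i| ^ p)) (fun i => integrable_samp _ _ _)
    (fun i => ?_) N).trans ?_
  · refine (integral_exp_le_of_quadratic (integrable_samp _ _ _) (integrable_samp _ _ _)
      (integrable_samp p I fun v => if 1 / 2 ≤ |v * x i| then (1 : ℝ) else 0) fun v => ?_).trans ?_
    · split_ifs
      · linarith [exp_one_lt_d9]
      · simp
    · have := integral_visible_le hp hI (x i)
      gcongr; linarith
  · rw [← Finset.mul_sum, ← Finset.mul_sum]
    gcongr
    linarith

lemma samp_bernstein (hp : 2 < p) (hI : ∀ l ∈ I, 1 ≤ l) (x : ι → ℝ) {N C t : ℝ} {ψ : ℝ → ℝ}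
    (hC : 1 ≤ C) (hψ : ∀ z, |ψ z| ≤ C) (hz : ∀ z, |z| ≤ 1 → ψ z = 0) (ht : 0 < t) (ht1 : t ≤ 1)
    (hN : 4 * 2 ^ p * ∑ i, |x i| ^ p ≤ N) :
    (Measure.pi fun _ : ι => samp p I).real
      {v | C * t * N ≤ |∑ i, ψ (v i * x i) - ∑ i, sampMean p I ψ (x i)|} ≤
      2 * exp (-(t ^ 2 * N / 2)) := by
  have := isProbabilityMeasure_samp hp hI
  have hC0 : 0 < C := by linarith
  have h00 : ψ 0 = 0 := hz 0 (by simp)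
  have key : ∀ s : ℝ, |s| = 1 → (Measure.pi fun _ : ι => samp p I).real
      {v | t ^ 2 * N + s * (t / C) * ∑ i, sampMean p I ψ (x i) ≤
        ∑ i, s * (t / C) * ψ (v i * x i)} ≤ exp (-(t ^ 2 * N / 2)) := by
    intro s hs
    refine (chernoff (fun _ : ι => samp p I) (fun i v => s * (t / C) * ψ (v * x i))
      (fun i => s * (t / C) * sampMean p I ψ (x i) + t ^ 2 * (4 / 3 * 2 ^ p * |x i| ^ p))
      (fun i => integrable_samp _ _ _) (fun i => ?_) _).trans ?_
    · refine (integral_exp_le_of_quadratic (integrable_samp _ _ _) (integrable_samp _ _ _)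
        (integrable_samp p I fun v => t ^ 2 * if 1 / 2 ≤ |v * x i| then (1 : ℝ) else 0)
        fun v => ?_).trans ?_
      · have hle : |s * (t / C) * ψ (v * x i)| ≤ t := by
          rw [abs_mul, abs_mul, hs, one_mul, abs_of_pos (by positivity)]
          calc t / C * |ψ (v * x i)| ≤ t / C * C := by gcongr; exact hψ _
            _ = t := by field_simp
        split_ifs with h
        · have h1 := abs_exp_sub_one_sub_id_le (hle.trans ht1)
          have h2 : (s * (t / C) * ψ (v * x i)) ^ 2 ≤ t ^ 2 := by
            rw [← sq_abs]; gcongr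
          linarith [le_abs_self (exp (s * (t / C) * ψ (v * x i)) - 1 - s * (t / C) * ψ (v * x i))]
        · rw [hz _ (by linarith [not_le.1 h])]; simp
      · have := integral_visible_le hp hI (x i)
        rw [integral_const_mul, integral_const_mul, integral_samp_comp hp hI h00]
        gcongr
    · rw [Finset.sum_add_distrib, ← Finset.mul_sum, ← Finset.mul_sum, ← Finset.mul_sum]
      gcongr
      have : t ^ 2 * (4 * 2 ^ p * ∑ i, |x i| ^ p) ≤ t ^ 2 * N := by gcongr
      have h0 : 0 ≤ t ^ 2 * (4 * 2 ^ p * ∑ i, |x i| ^ p) := by positivity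
      linarith
  refine (measureReal_mono (s₂ := {v : ι → ℝ | t ^ 2 * N + 1 * (t / C) * ∑ i, sampMean p I ψ (x i) ≤
        ∑ i, 1 * (t / C) * ψ (v i * x i)} ∪
      {v : ι → ℝ | t ^ 2 * N + -1 * (t / C) * ∑ i, sampMean p I ψ (x i) ≤
        ∑ i, -1 * (t / C) * ψ (v i * x i)}) fun v hv => ?_).trans
    ((measureReal_union_le _ _).trans ?_)
  · have e : t ^ 2 * N = t / C * (C * t * N) := by field_simp
    have hv' : C * t * N ≤ |∑ i, ψ (v i * x i) - ∑ i, sampMean p I ψ (x i)| := hv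
    have htC : 0 ≤ t / C := by positivity
    rcases le_abs.1 hv' with h | h
    · left
      change t ^ 2 * N + _ ≤ ∑ i, 1 * (t / C) * ψ (v i * x i)
      rw [← Finset.mul_sum, e]
      have := mul_le_mul_of_nonneg_left h htC
      linarith
    · right
      change t ^ 2 * N + _ ≤ ∑ i, -1 * (t / C) * ψ (v i * x i)
      rw [← Finset.mul_sum, e]
      have := mul_le_mul_of_nonneg_left h htC
      linarith
  · linarith [key 1 (by simp), key (-1) (by simp)]

/-- The second moment of a sampling weight. -/
noncomputable def sampSq (p : ℝ) (I : Finset ℕ) : ℝ := ∑ l ∈ I, (4 * rate p) ^ l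

lemma integral_samp_sq (hp : 2 < p) (hI : ∀ l ∈ I, 1 ≤ l) (y : ℝ) :
    ∫ v, (v * y) ^ 2 ∂(samp p I) = sampSq p I * y ^ 2 := by
  rw [integral_samp_comp hp hI (ψ := fun z => z ^ 2) (by norm_num), sampMean, sampSq,
    Finset.sum_mul]
  refine Finset.sum_congr rfl fun l _ => ?_
  rw [mul_pow, mul_pow, ← pow_mul, mul_comm l 2, pow_mul]
  norm_num
  ring

lemma samp_energy_markov (hp : 2 < p) (hI : ∀ l ∈ I, 1 ≤ l) (x : ι → ℝ) {a : ℝ} (ha : 0 < a) :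
    (Measure.pi fun _ : ι => samp p I).real {v | a ≤ ∑ i, (v i * x i) ^ 2} ≤
      sampSq p I * (∑ i, x i ^ 2) / a := by
  have := isProbabilityMeasure_samp hp hI
  have h_int : ∀ i, Integrable (fun v : ι → ℝ => (v i * x i) ^ 2) (Measure.pi fun _ => samp p I) :=
    fun i => integrable_comp_eval (μ := fun _ : ι => samp p I) (i := i)
      (f := fun v => (v * x i) ^ 2) (integrable_samp p I _)
  have h := mul_meas_ge_le_integral_of_nonneg (μ := Measure.pi fun _ : ι => samp p I)
    (f := fun v => ∑ i, (v i * x i) ^ 2) (ae_of_all _ fun v => Finset.sum_nonneg fun _ _ => sq_nonneg _)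
    (integrable_finsetSum _ fun i _ => h_int i) a
  rw [integral_finsetSum _ fun i _ => h_int i] at h
  have e : ∀ i, ∫ v : ι → ℝ, (v i * x i) ^ 2 ∂(Measure.pi fun _ => samp p I) =
      sampSq p I * x i ^ 2 := fun i => by
    rw [integral_comp_eval (μ := fun _ : ι => samp p I) (i := i) (f := fun v => (v * x i) ^ 2) (integrable_samp p I _).aestronglyMeasurable,
      integral_samp_sq hp hI]
  simp only [e] at h
  rw [← Finset.mul_sum] at h
  rw [le_div_iff₀ ha]
  linarith

lemma samp_energy_chernoff (hp : 2 < p) (hI : ∀ l ∈ I, 1 ≤ l) (x : ι → ℝ) {a θ : ℝ} (hθ : 0 ≤ θ)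
    (h : ∀ l ∈ I, ∀ i, θ * (2 ^ l * x i) ^ 2 ≤ 1) :
    (Measure.pi fun _ : ι => samp p I).real {v | a ≤ ∑ i, (v i * x i) ^ 2} ≤
      exp (θ * (2 * sampSq p I * (∑ i, x i ^ 2) - a)) := by
  have := isProbabilityMeasure_samp hp hI
  rcases hθ.eq_or_lt with rfl | hθ
  · simp
  have hS : {v : ι → ℝ | a ≤ ∑ i, (v i * x i) ^ 2} = {v | θ * a ≤ ∑ i, θ * (v i * x i) ^ 2} := by
    ext v
    change a ≤ _ ↔ θ * a ≤ _
    rw [← Finset.mul_sum, mul_le_mul_iff_right₀ hθ]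
  rw [hS]
  refine (chernoff (fun _ : ι => samp p I) (fun i v => θ * (v * x i) ^ 2)
    (fun i => θ * (2 * sampSq p I * x i ^ 2)) (fun i => integrable_samp _ _ _)
    (fun i => ?_) _).trans (le_of_eq ?_)
  · have hr := rate_pos p
    have e1 := integral_samp hp hI fun v => exp (θ * (v * x i) ^ 2)
    have e2 := integral_samp_comp hp hI (ψ := fun z => 2 * θ * z ^ 2) (by simp) (x i)
    rw [integral_const_mul, integral_samp_sq hp hI, sampMean] at e2
    rw [e1]
    have h3 : ∑ l ∈ I, rate p ^ l * exp (θ * (2 ^ l * x i) ^ 2) ≤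
        ∑ l ∈ I, (rate p ^ l + rate p ^ l * (2 * θ * (2 ^ l * x i) ^ 2)) := by
      refine Finset.sum_le_sum fun l hl => ?_
      have hu := h l hl i
      have hu0 : 0 ≤ θ * (2 ^ l * x i) ^ 2 := by positivity
      have := abs_exp_sub_one_sub_id_le (x := θ * (2 ^ l * x i) ^ 2) (by rwa [abs_of_nonneg hu0])
      have h4 := (le_abs_self _).trans this
      have h5 : exp (θ * (2 ^ l * x i) ^ 2) ≤ 1 + 2 * θ * (2 ^ l * x i) ^ 2 := by nlinarith
      calc _ ≤ rate p ^ l * (1 + 2 * θ * (2 ^ l * x i) ^ 2) := by gcongr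
        _ = _ := by ring
    rw [Finset.sum_add_distrib, ← e2] at h3
    have h6 := add_one_le_exp (θ * (2 * sampSq p I * x i ^ 2))
    rw [zero_mul, zero_pow two_ne_zero, mul_zero, exp_zero, mul_one]
    linarith
  · rw [← Finset.mul_sum, ← Finset.mul_sum]
    ring_nf

end samp

section
variable {ι : Type*} [Fintype ι] {h : ℝ → ℝ → ℝ} {ψ : ℝ → ℝ} {C : ℝ} {J : ℕ} {p : ℝ}

/-- The data decoded from one Gaussian sketch. -/
noncomputable def base {m : ℕ} (A : Fin m × ι → ℝ) (z : ι → ℝ) : ℝ × (ι → ℝ) :=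
  (baseScale A z, baseVec A z)

/-- The statistic `∑ i, h (c s) (c y i)`. -/
noncomputable def stat (h : ℝ → ℝ → ℝ) (c : ℝ) (y : ℝ × (ι → ℝ)) : ℝ :=
  ∑ i, h (c * y.1) (c * y.2 i)

lemma measurable_base (m : ℕ) :
    Measurable fun q : (Fin m × ι → ℝ) × (ι → ℝ) => base q.1 q.2 := by
  refine Measurable.prodMk ?_ (measurable_pi_iff.2 fun i => ?_)
  · unfold baseScale
    exact (measurable_nrm.comp (measurable_pi_iff.2 fun r => by fun_prop)).div_const _
  · unfold baseVec
    fun_prop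

lemma base_smul {m : ℕ} (A : Fin m × ι → ℝ) (z : ι → ℝ) {c : ℝ} (hc : 0 ≤ c) :
    base A (fun i => c * z i) = (c * (base A z).1, fun i => c * (base A z).2 i) := by
  have e : ∀ r, ∑ i, A (r, i) * (c * z i) = c * ∑ i, A (r, i) * z i := fun r => by
    rw [Finset.mul_sum]; exact Finset.sum_congr rfl fun i _ => by ring
  refine Prod.ext ?_ (funext fun i => ?_)
  · change baseScale A _ = c * baseScale A z
    simp only [baseScale, e]
    rw [nrm_smul, abs_of_nonneg hc, mul_div_assoc]
  · change baseVec A _ i = c * baseVec A z i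
    simp only [baseVec, e]
    rw [← mul_div_assoc, Finset.mul_sum]
    congr 1
    exact Finset.sum_congr rfl fun r _ => by ring

lemma stat_base_smul {m : ℕ} (A : Fin m × ι → ℝ) (z : ι → ℝ) {c : ℝ} (hc : 0 ≤ c) (d : ℝ) :
    stat h d (base A (fun i => c * z i)) = stat h (d * c) (base A z) := by
  rw [base_smul A z hc]
  simp only [stat, mul_assoc]

lemma stat_one_base {m : ℕ} (A : Fin m × ι → ℝ) (z : ι → ℝ) :
    stat h 1 (base A z) = ∑ i, h (baseScale A z) (baseVec A z i) := by
  simp only [stat, one_mul, base]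

lemma measurable_stat (hh : Measurable fun q : ℝ × ℝ => h q.1 q.2) :
    Measurable fun q : ℝ × (ℝ × (ι → ℝ)) => stat h q.1 q.2 := by
  refine Finset.measurable_sum _ fun i _ => hh.comp (Measurable.prodMk ?_ ?_) <;> fun_prop

/-- Concentration of the statistic for a randomly reweighted signal. -/
lemma sampled_conc (hp : 2 < p) {I : Finset ℕ} (hI : ∀ l ∈ I, 1 ≤ l) (hh : Estimates h ψ C J)
    {m : ℕ} (hm : 0 < m) (x : ι → ℝ) {q N t a : ℝ} (hq1 : q ≤ 1) (hq0 : 0 < q)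
    (hn : Fintype.card ι * exp (-(1 / (64 * q ^ 2))) ≤ 1) (ht : 0 < t) (ht1 : t ≤ 1)
    (hqt : q ^ J ≤ t) (hN : 4 * 2 ^ p * ∑ i, |x i| ^ p ≤ N) (ha : 2 * √a ≤ q * √m)
    (hmN : N ≤ m) :
    ((Measure.pi fun _ : ι => samp p I).prod (gaussPi (Fin m × ι))).real
      {ω | 5 * C * t * N < |stat h 1 (base ω.2 fun i => ω.1 i * x i) -
        ∑ i, sampMean p I ψ (x i)|} ≤
      (Measure.pi fun _ : ι => samp p I).real {v | a ≤ ∑ i, (v i * x i) ^ 2} +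
        18 * exp (-(t ^ 2 * N / (2048 * C ^ 2))) := by
  have := isProbabilityMeasure_samp hp hI
  have hC := hh.one_le
  have hC2 : 1 ≤ C ^ 2 := one_le_pow₀ hC
  have hN0 : 0 ≤ N := le_trans (by positivity) hN
  have ht2 : t ^ 2 ≤ 1 := pow_le_one₀ ht.le ht1
  have hm1 : MeasurableSet {v : ι → ℝ | a ≤ ∑ i, (v i * x i) ^ 2} :=
    measurableSet_le measurable_const (by fun_prop)
  have hm2 : MeasurableSet {v : ι → ℝ | N ≤ ∑ i, if 1 / 2 ≤ |v i * x i| then (1 : ℝ) else 0} := by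
    refine measurableSet_le measurable_const (Finset.measurable_sum _ fun i _ => ?_)
    exact Measurable.ite (measurableSet_le measurable_const (by fun_prop)) measurable_const
      measurable_const
  have hm3 : MeasurableSet {v : ι → ℝ | C * t * N ≤
      |∑ i, ψ (v i * x i) - ∑ i, sampMean p I ψ (x i)|} := by
    have h1 : Measurable fun v : ι → ℝ => ∑ i, ψ (v i * x i) :=
      Finset.measurable_sum _ fun i _ => hh.meas_target.comp ((measurable_pi_apply i).mul_const _)
    exact measurableSet_le measurable_const (h1.sub_const _).abs
  have hm4 : MeasurableSet {ω : (ι → ℝ) × (Fin m × ι → ℝ) | 5 * C * t * N <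
      |stat h 1 (base ω.2 fun i => ω.1 i * x i) - ∑ i, sampMean p I ψ (x i)|} := by
    have h1 : Measurable fun ω : (ι → ℝ) × (Fin m × ι → ℝ) => (fun i => ω.1 i * x i : ι → ℝ) :=
      measurable_pi_iff.2 fun i => ((measurable_pi_apply i).comp measurable_fst).mul_const _
    have h2 := (measurable_stat hh.meas).comp
      ((measurable_const (a := (1 : ℝ))).prodMk ((measurable_base m).comp (measurable_snd.prodMk h1)))
    exact measurableSet_lt measurable_const (h2.sub_const _).abs
  set X := t ^ 2 * N / (2048 * C ^ 2) with hX
  refine (prod_real_le _ _ hm4 ((hm1.union hm2).union hm3) (c := 15 * exp (-X)) fun v hv => ?_).trans ?_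
  · rw [Set.mem_union, Set.mem_union, not_or, not_or] at hv
    obtain ⟨⟨h1, h2⟩, h3⟩ := hv
    have h1 : ∑ i, (v i * x i) ^ 2 < a := not_le.1 h1
    have h2 : (∑ i, if 1 / 2 ≤ |v i * x i| then (1 : ℝ) else 0) < N := not_le.1 h2
    have h3 : |∑ i, ψ (v i * x i) - ∑ i, sampMean p I ψ (x i)| < C * t * N := not_le.1 h3
    rw [← Finset.natCast_card_filter] at h2
    have hb := base_conc hh hm (fun i => v i * x i) hq1 hn ht ht1 hqt
      ((mul_le_mul_of_nonneg_left (sqrt_le_sqrt h1.le) zero_le_two).trans ha)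
      (Finset.univ.filter fun i => 1 / 2 ≤ |v i * x i|) (fun i => by simp) h2.le
    refine (measureReal_mono fun A hA => ?_).trans (hb.trans ?_)
    · have hA' : 5 * C * t * N < |stat h 1 (base A fun i => v i * x i) -
        ∑ i, sampMean p I ψ (x i)| := hA
      rw [stat_one_base] at hA'
      change 4 * C * t * N < |_ - ∑ i, ψ (v i * x i)|
      have := abs_sub_le (∑ i, h (baseScale A fun i => v i * x i) (baseVec A (fun i => v i * x i) i))
        (∑ i, ψ (v i * x i)) (∑ i, sampMean p I ψ (x i))
      linarith
    · have c1 : X ≤ t ^ 2 * N / (64 * C ^ 2 * q ^ 2) := by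
        rw [hX]
        have : q ^ 2 ≤ 1 := pow_le_one₀ hq0.le hq1
        exact div_le_div_of_nonneg_left (by positivity) (by positivity) (by nlinarith)
      have c2 : X ≤ t ^ 2 * m / 2048 := by
        rw [hX]
        gcongr
        linarith
      have d1 : exp (-(t ^ 2 * N / (64 * C ^ 2 * q ^ 2))) ≤ exp (-X) := by gcongr
      have d2 : exp (-(t ^ 2 * m / 2048)) ≤ exp (-X) := by gcongr
      linarith
  · have hu := (measureReal_union_le (μ := Measure.pi fun _ : ι => samp p I)
      ({v : ι → ℝ | a ≤ ∑ i, (v i * x i) ^ 2} ∪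
        {v : ι → ℝ | N ≤ ∑ i, if 1 / 2 ≤ |v i * x i| then (1 : ℝ) else 0})
      {v : ι → ℝ | C * t * N ≤ |∑ i, ψ (v i * x i) - ∑ i, sampMean p I ψ (x i)|})
    have hu' := measureReal_union_le (μ := Measure.pi fun _ : ι => samp p I)
      {v : ι → ℝ | a ≤ ∑ i, (v i * x i) ^ 2}
      {v : ι → ℝ | N ≤ ∑ i, if 1 / 2 ≤ |v i * x i| then (1 : ℝ) else 0}
    have e1 := samp_count hp hI x hN
    have e2 := samp_bernstein hp hI x hC hh.bdd_target hh.zero_target ht ht1 hN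
    have hXle : X ≤ t ^ 2 * N / 3 := by
      rw [hX]
      gcongr
      linarith
    have d1 : exp (-(N / 3)) ≤ exp (-X) := by
      gcongr
      refine hXle.trans ?_
      gcongr
      exact mul_le_of_le_one_left hN0 ht2
    have d2 : exp (-(t ^ 2 * N / 2)) ≤ exp (-X) := by
      gcongr
      refine hXle.trans ?_
      gcongr
      norm_num
    rw [max_eq_left (by positivity)]
    linarith

lemma sum_exp_geom_le {X b : ℝ} (hX : 1 ≤ X) (hb : 1 < b) (n : ℕ) :
    ∑ j ∈ Finset.range n, exp (-(X * b ^ j)) ≤ 1 / (1 - exp (-(b - 1))) * exp (-X) := by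
  have hr : exp (-(b - 1)) < 1 := exp_lt_one_iff.2 (by linarith)
  calc ∑ j ∈ Finset.range n, exp (-(X * b ^ j))
      ≤ ∑ j ∈ Finset.range n, exp (-(b - 1)) ^ j * exp (-X) := by
        refine Finset.sum_le_sum fun j _ => ?_
        rw [← exp_nat_mul, ← exp_add]
        gcongr
        have := one_add_mul_le_pow (a := b - 1) (by linarith) j
        rw [add_sub_cancel] at this
        have h0 : 0 ≤ (j : ℝ) * (b - 1) := mul_nonneg (Nat.cast_nonneg _) (by linarith)
        nlinarith
    _ ≤ _ := by
        rw [← Finset.sum_mul]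
        gcongr
        have := geom_sum_Ico_le_of_lt_one (exp_pos _).le hr (m := 0) (n := n)
        rwa [pow_zero, ← Finset.range_eq_Ico] at this

/-- Concentration of the statistics at all high levels, read off one Gaussian sketch. -/
lemma high_conc (hh : Estimates h ψ C J) {m : ℕ} (hm : 0 < m) (x : ι → ℝ) {q N t w : ℝ} {L : ℕ}
    (hw : 1 < w) (hwp : (2 : ℝ) ^ p = 4 * w ^ 4) (hp : 0 ≤ p) (hq1 : q ≤ 1) (hq0 : 0 < q)
    (hn : Fintype.card ι * exp (-(1 / (64 * q ^ 2))) ≤ 1) (ht : 0 < t) (ht1 : t ≤ 1)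
    (hqt : q ^ J ≤ t / w ^ L) (hN : 2 ^ p * ∑ i, |x i| ^ p ≤ N) (hx : 2 * nrm x ≤ q * √m)
    (hmN : N * w ^ (2 * L) ≤ m) (hqw : q ^ 2 * w ^ (4 * L) ≤ 1)
    (hX : 1 ≤ t ^ 2 * N / (2048 * C ^ 2)) :
    (gaussPi (Fin m × ι)).real
      {A | 4 * C * (1 / (1 - w⁻¹)) * t * N <
        |∑ l ∈ Finset.range (L + 1), ((2 : ℝ) ^ p) ^ l * stat h (2 ^ l)⁻¹ (base A x) -
        ∑ l ∈ Finset.range (L + 1), ((2 : ℝ) ^ p) ^ l * ∑ i, ψ ((2 ^ l)⁻¹ * x i)|} ≤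
      15 * (1 / (1 - exp (-(w ^ 2 - 1)))) * exp (-(t ^ 2 * N / (2048 * C ^ 2))) := by
  have hC := hh.one_le
  have hC2 : 1 ≤ C ^ 2 := one_le_pow₀ hC
  have hN0 : 0 ≤ N := le_trans (by positivity) hN
  have hw0 : 0 < w := by linarith
  set X := t ^ 2 * N / (2048 * C ^ 2) with hXd
  set T : ℕ → ℝ := fun l => t / w ^ (L - l) with hT
  set M : ℕ → ℝ := fun l => N / ((2 : ℝ) ^ p) ^ l with hM
  set S : ℕ → Set (Fin m × ι → ℝ) := fun l => {A | 4 * C * T l * M l <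
    |∑ i, h (baseScale A fun i => (2 ^ l)⁻¹ * x i) (baseVec A (fun i => (2 ^ l)⁻¹ * x i) i) -
      ∑ i, ψ ((2 ^ l)⁻¹ * x i)|} with hS
  have hsub : {A : Fin m × ι → ℝ | 4 * C * (1 / (1 - w⁻¹)) * t * N <
        |∑ l ∈ Finset.range (L + 1), ((2 : ℝ) ^ p) ^ l * stat h (2 ^ l)⁻¹ (base A x) -
        ∑ l ∈ Finset.range (L + 1), ((2 : ℝ) ^ p) ^ l * ∑ i, ψ ((2 ^ l)⁻¹ * x i)|} ⊆
      ⋃ l ∈ Finset.range (L + 1), S l := by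
    intro A hA
    by_contra hcon
    simp only [Set.mem_iUnion, not_exists] at hcon
    change (_ : ℝ) < _ at hA
    refine absurd hA (not_lt.2 ?_)
    rw [← Finset.sum_sub_distrib]
    refine (Finset.abs_sum_le_sum_abs _ _).trans ?_
    calc _ ≤ ∑ l ∈ Finset.range (L + 1), 4 * C * t * N * w⁻¹ ^ (L - l) := by
          refine Finset.sum_le_sum fun l hl => ?_
          have h1 := hcon l hl
          change ¬ (_ : ℝ) < _ at h1
          replace h1 := not_lt.1 h1
          rw [← stat_one_base, stat_base_smul A x (by positivity), one_mul] at h1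
          rw [← mul_sub, abs_mul, abs_of_pos (by positivity)]
          calc _ ≤ ((2 : ℝ) ^ p) ^ l * (4 * C * T l * M l) := by gcongr
            _ = 4 * C * t * N * w⁻¹ ^ (L - l) := by
              simp only [hT, hM, inv_pow]
              field_simp
      _ = 4 * C * t * N * ∑ l ∈ Finset.range (L + 1), w⁻¹ ^ l := by
          rw [← Finset.mul_sum, ← Finset.sum_range_reflect]
          congr 1
          refine Finset.sum_congr rfl fun l hl => ?_
          have := Finset.mem_range.1 hl
          congr 1; omega
      _ ≤ 4 * C * t * N * (1 / (1 - w⁻¹)) := by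
          gcongr
          have := geom_sum_Ico_le_of_lt_one (x := w⁻¹) (by positivity) (inv_lt_one_of_one_lt₀ hw)
            (m := 0) (n := L + 1)
          rwa [pow_zero, ← Finset.range_eq_Ico] at this
      _ = _ := by ring
  refine (measureReal_mono hsub (measure_ne_top _ _)).trans ((measureReal_biUnion_finset_le _ _).trans ?_)
  have hl : ∀ l ∈ Finset.range (L + 1), (gaussPi (Fin m × ι)).real (S l) ≤
      11 * exp (-(X * (w ^ 2) ^ (L - l))) + 4 * exp (-(X * (w ^ 2) ^ l)) := by
    intro l hl
    have hlL : l ≤ L := Nat.lt_succ_iff.1 (Finset.mem_range.1 hl)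
    have h2l : (1 : ℝ) ≤ 2 ^ l := one_le_pow₀ one_le_two
    have hi1 : ((2 : ℝ) ^ l)⁻¹ ≤ 1 := inv_le_one_of_one_le₀ h2l
    have hi0 : (0 : ℝ) < ((2 : ℝ) ^ l)⁻¹ := by positivity
    have hsq : (2 ^ l)⁻¹ * q ≤ q := mul_le_of_le_one_left hq0.le hi1
    have hqL : q ^ J ≤ T l := hqt.trans (by simp only [hT]; gcongr; exacts [hw.le, Nat.sub_le _ _])
    have hb := base_conc hh hm (fun i => (2 ^ l)⁻¹ * x i) (s0 := (2 ^ l)⁻¹ * q) (N := M l) (t := T l)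
      (hsq.trans hq1) (le_trans (by gcongr) hn) (by positivity)
      ((div_le_self ht.le (one_le_pow₀ hw.le)).trans ht1)
      ((pow_le_pow_left₀ (by positivity) hsq J).trans hqL)
      (by
        rw [nrm_smul, abs_of_pos hi0]
        calc 2 * ((2 ^ l)⁻¹ * nrm x) = (2 ^ l)⁻¹ * (2 * nrm x) := by ring
          _ ≤ (2 ^ l)⁻¹ * (q * √m) := by gcongr
          _ = _ := by ring)
      (Finset.univ.filter fun i => 1 / 2 ≤ |(2 ^ l)⁻¹ * x i|) (fun i => by simp) (by
        rw [Finset.natCast_card_filter, le_div_iff₀ (by positivity)]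
        refine le_trans ?_ hN
        rw [Finset.sum_mul, Finset.mul_sum]
        refine Finset.sum_le_sum fun i _ => ?_
        split_ifs with hc
        · rw [one_mul, ← rpow_natCast, ← rpow_mul (by norm_num), mul_comm p, rpow_mul (by norm_num),
            rpow_natCast, ← mul_rpow (by norm_num) (abs_nonneg _)]
          gcongr
          rw [abs_mul, abs_of_pos hi0, inv_mul_eq_div, le_div_iff₀ (by positivity)] at hc
          linarith
        · rw [zero_mul]; positivity)
    refine hb.trans ?_
    have hPl : ((2 : ℝ) ^ p) ^ l = 4 ^ l * w ^ (4 * l) := by rw [hwp, mul_pow, pow_mul]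
    have h4 : ((2 : ℝ) ^ l) ^ 2 = 4 ^ l := by rw [← pow_mul, mul_comm, pow_mul]; norm_num
    have c1 : X * (w ^ 2) ^ (L - l) ≤ T l ^ 2 * M l / (64 * C ^ 2 * ((2 ^ l)⁻¹ * q) ^ 2) := by
      obtain ⟨d, rfl⟩ := Nat.exists_eq_add_of_le hlL
      have e : T l ^ 2 * M l / (64 * C ^ 2 * ((2 ^ l)⁻¹ * q) ^ 2) =
          t ^ 2 * N / (64 * C ^ 2) * (1 / (q ^ 2 * w ^ (4 * l) * w ^ (2 * d))) := by
        simp only [hT, hM, hPl, mul_pow, inv_pow, h4, div_pow, Nat.add_sub_cancel_left]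
        rw [← pow_mul w d 2, mul_comm d 2]
        field_simp
      rw [e, Nat.add_sub_cancel_left, ← pow_mul]
      have h5 : w ^ (2 * d) ≤ 1 / (q ^ 2 * w ^ (4 * l) * w ^ (2 * d)) := by
        rw [le_div_iff₀ (by positivity)]
        refine le_trans (le_of_eq ?_) hqw
        ring
      rw [hXd]
      gcongr
      norm_num
    have c2 : X * (w ^ 2) ^ l ≤ T l ^ 2 * m / 2048 := by
      obtain ⟨d, rfl⟩ := Nat.exists_eq_add_of_le hlL
      have h6 : X ≤ t ^ 2 * N / 2048 := by
        rw [hXd]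
        gcongr
        linarith
      calc X * (w ^ 2) ^ l ≤ t ^ 2 * N / 2048 * (w ^ 2) ^ l := by gcongr
        _ = T l ^ 2 * (N * w ^ (2 * (l + d))) / 2048 := by
          simp only [hT, Nat.add_sub_cancel_left, div_pow]
          rw [← pow_mul w d 2, mul_comm d 2, mul_add, pow_add, ← pow_mul]
          field_simp
        _ ≤ _ := by gcongr
    gcongr
  refine (Finset.sum_le_sum hl).trans ?_
  have hw2 : 1 < w ^ 2 := one_lt_pow₀ hw two_ne_zero
  rw [Finset.sum_add_distrib, ← Finset.mul_sum, ← Finset.mul_sum]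
  have g2 := sum_exp_geom_le hX hw2 (L + 1)
  have g1 : ∑ l ∈ Finset.range (L + 1), exp (-(X * (w ^ 2) ^ (L - l))) =
      ∑ l ∈ Finset.range (L + 1), exp (-(X * (w ^ 2) ^ l)) := by
    rw [← Finset.sum_range_reflect]
    refine Finset.sum_congr rfl fun l hl => ?_
    have := Finset.mem_range.1 hl
    congr 4; omega
  rw [g1]
  linarith

end

section median
variable {κ : Type*} [Fintype κ] [Nonempty κ]

/-- Subfamilies comprising at least half of the indices. -/
def halves (κ : Type*) [Fintype κ] : Finset (Finset κ) :=
  Finset.univ.filter fun s => s.Nonempty ∧ Fintype.card κ ≤ 2 * s.card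

lemma halves_nonempty : (halves κ).Nonempty :=
  ⟨Finset.univ, Finset.mem_filter.2 ⟨Finset.mem_univ _, Finset.univ_nonempty, by
    rw [Finset.card_univ]; omega⟩⟩

/-- An (upper) median of a finite family, as a maximum over large subfamilies of minima. -/
noncomputable def med (Y : κ → ℝ) : ℝ :=
  (halves κ).sup' halves_nonempty fun s => if hs : s.Nonempty then s.inf' hs Y else 0

lemma le_med {Y : κ → ℝ} {a : ℝ} {s : Finset κ} (hs : Fintype.card κ ≤ 2 * s.card)
    (h : ∀ i ∈ s, a ≤ Y i) : a ≤ med Y := by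
  have h0 : s.Nonempty := by
    have := Fintype.card_pos (α := κ)
    exact Finset.card_pos.1 (by omega)
  refine (Finset.le_sup'_iff _).2 ⟨s, by simp [halves, h0, hs], ?_⟩
  rw [dif_pos h0]
  exact Finset.le_inf' _ _ h

lemma med_le {Y : κ → ℝ} {b : ℝ}
    (h : ∀ s : Finset κ, Fintype.card κ ≤ 2 * s.card → ∃ i ∈ s, Y i ≤ b) : med Y ≤ b := by
  refine Finset.sup'_le _ _ fun s hs => ?_
  obtain ⟨h0, hs⟩ := (Finset.mem_filter.1 hs).2
  obtain ⟨i, hi, hb⟩ := h s hs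
  rw [dif_pos h0]
  exact (Finset.inf'_le _ hi).trans hb

lemma med_mono {Y Y' : κ → ℝ} (h : ∀ i, Y i ≤ Y' i) : med Y ≤ med Y' := by
  refine Finset.sup'_mono_fun fun s hs => ?_
  obtain ⟨h0, -⟩ := (Finset.mem_filter.1 hs).2
  rw [dif_pos h0, dif_pos h0]
  exact Finset.inf'_mono_fun fun i _ => h i

lemma measurable_med : Measurable (med : (κ → ℝ) → ℝ) := by
  unfold med
  have : ∀ s : Finset κ, Measurable fun Y : κ → ℝ => if hs : s.Nonempty then s.inf' hs Y else 0 := by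
    intro s
    split_ifs with hs
    · have : Measurable (s.inf' hs fun i (Y : κ → ℝ) => Y i) :=
        Finset.inf'_induction hs _ (fun _ hf _ hg => hf.inf hg) fun i _ => measurable_pi_apply i
      convert this using 1
      ext Y
      rw [Finset.inf'_apply]
    · exact measurable_const
  have h := Finset.measurable_sup' (halves_nonempty (κ := κ))
    (f := fun s (Y : κ → ℝ) => if hs : s.Nonempty then s.inf' hs Y else 0) fun s _ => this s
  convert h using 1
  ext Y
  rw [Finset.sup'_apply]

variable {Ω : Type*} [MeasurableSpace Ω]

/-- Concentration of the median of independent copies. -/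
lemma med_conc (ν : Measure Ω) [IsProbabilityMeasure ν] {f : Ω → ℝ} (hf : Measurable f) {c b : ℝ}
    (h : ν.real {w | b < |f w - c|} ≤ 1 / 16) :
    (Measure.pi fun _ : κ => ν).real {w | b < |med (fun t => f (w t)) - c|} ≤
      exp (-(Fintype.card κ / 2)) := by
  set B : Set Ω := {w | b < |f w - c|} with hB
  have hBm : MeasurableSet B := measurableSet_lt measurable_const (hf.sub_const _).abs
  have hexp : (fun w => exp (B.indicator (fun _ => log 16) w)) =
      fun w => 1 + B.indicator (fun _ => (15 : ℝ)) w := by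
    ext w
    by_cases hw : w ∈ B
    · rw [Set.indicator_of_mem hw, Set.indicator_of_mem hw, exp_log (by norm_num)]; norm_num
    · rw [Set.indicator_of_notMem hw, Set.indicator_of_notMem hw, exp_zero, add_zero]
  have h_int : Integrable (B.indicator fun _ => (15 : ℝ)) ν := (integrable_const _).indicator hBm
  have hc := chernoff (fun _ : κ => ν) (fun _ => B.indicator fun _ => log 16) (fun _ => log 2)
    (fun _ => by rw [hexp]; exact (integrable_const _).add h_int)
    (fun _ => by
      rw [hexp, integral_add (integrable_const _) h_int, integral_indicator_const _ hBm,
        exp_log (by norm_num), integral_const, smul_eq_mul, smul_eq_mul, probReal_univ]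
      linarith) (log 16 * (Fintype.card κ / 2))
  have hlog : log 16 = 4 * log 2 := by
    rw [show (16 : ℝ) = 2 ^ 4 by norm_num, log_pow]; norm_num
  have hl2 := log_two_gt_d9
  refine (measureReal_mono (fun w hw => ?_) (measure_ne_top _ _)).trans (hc.trans ?_)
  · change _ ≤ ∑ i, B.indicator (fun _ => log 16) (w i)
    by_contra hcon
    push Not at hcon
    classical
    have hs : ∑ i, B.indicator (fun _ => log 16) (w i) =
        log 16 * (Finset.univ.filter fun t => w t ∈ B).card := by
      rw [Finset.natCast_card_filter, Finset.mul_sum]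
      refine Finset.sum_congr rfl fun i _ => ?_
      by_cases hi : w i ∈ B <;> simp [hi]
    rw [hs] at hcon
    have hcard : 2 * (Finset.univ.filter fun t => w t ∈ B).card < Fintype.card κ := by
      have h1 : ((Finset.univ.filter fun t => w t ∈ B).card : ℝ) < Fintype.card κ / 2 :=
        lt_of_mul_lt_mul_left hcon (by rw [hlog]; positivity)
      have h2 : (2 * (Finset.univ.filter fun t => w t ∈ B).card : ℝ) < Fintype.card κ := by linarith
      exact_mod_cast h2
    have hgood : ∀ t, w t ∉ B → |f (w t) - c| ≤ b := fun t ht => not_lt.1 ht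
    have hcompl := Finset.card_filter_add_card_filter_not (s := (Finset.univ : Finset κ))
      (fun t => w t ∈ B)
    rw [Finset.card_univ] at hcompl
    have hlow : c - b ≤ med fun t => f (w t) :=
      le_med (s := Finset.univ.filter fun t => ¬ w t ∈ B) (by omega) fun i hi => by
        have := (abs_le.1 (hgood i (Finset.mem_filter.1 hi).2)).1
        linarith
    have hupp : (med fun t => f (w t)) ≤ c + b := by
      refine med_le fun s hs => ?_
      by_contra hno
      push Not at hno
      have hsub : s ⊆ Finset.univ.filter fun t => w t ∈ B := fun i hi => by
        refine Finset.mem_filter.2 ⟨Finset.mem_univ _, ?_⟩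
        by_contra hiB
        have := (abs_le.1 (hgood i hiB)).2
        have := hno i hi
        linarith
      have := Finset.card_le_card hsub
      omega
    have hw' : b < |(med fun t => f (w t)) - c| := hw
    exact absurd hw' (not_lt.2 (abs_le.2 ⟨by linarith, by linarith⟩))
  · simp only [Finset.sum_const, Finset.card_univ, nsmul_eq_mul]
    gcongr
    rw [hlog]
    have : (0 : ℝ) ≤ Fintype.card κ := Nat.cast_nonneg _
    nlinarith

end median

lemma prod_fst_real {α β : Type*} [MeasurableSpace α] [MeasurableSpace β] (μ : Measure α)
    (ν : Measure β) [IsProbabilityMeasure μ] [IsProbabilityMeasure ν] (s : Set α) :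
    (μ.prod ν).real {q | q.1 ∈ s} = μ.real s := by
  have : {q : α × β | q.1 ∈ s} = s ×ˢ Set.univ := by ext; simp
  rw [this, measureReal_def, Measure.prod_prod, measure_univ, mul_one, measureReal_def]

lemma prod_snd_real {α β : Type*} [MeasurableSpace α] [MeasurableSpace β] (μ : Measure α)
    (ν : Measure β) [IsProbabilityMeasure μ] [IsProbabilityMeasure ν] (s : Set β) :
    (μ.prod ν).real {q | q.2 ∈ s} = ν.real s := by
  have : {q : α × β | q.2 ∈ s} = Set.univ ×ˢ s := by ext; simp
  rw [this, measureReal_def, Measure.prod_prod, measure_univ, one_mul, measureReal_def]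

section est
variable {ι κ : Type*} [Fintype ι] [Fintype κ] [Nonempty κ] {h : ℝ → ℝ → ℝ} {ψ : ℝ → ℝ}
  {C : ℝ} {J : ℕ} {p : ℝ}

/-- Decoded data: high levels, sampled levels, and independent copies of deeply sampled levels. -/
abbrev Dat (κ ι : Type*) := (ℝ × (ι → ℝ)) × (ℝ × (ι → ℝ)) × (κ → ℝ × (ι → ℝ))

/-- The randomness behind the data. -/
abbrev Seed (m mT : ℕ) (κ ι : Type*) := (Fin m × ι → ℝ) × ((ι → ℝ) × (Fin m × ι → ℝ)) ×
  (κ → (ι → ℝ) × (Fin mT × ι → ℝ))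

/-- The law of the randomness behind the data. -/
noncomputable def seedLaw (p : ℝ) (I I' : Finset ℕ) (m mT : ℕ) (κ ι : Type*) [Fintype κ] [Fintype ι] :
    Measure (Seed m mT κ ι) :=
  (gaussPi (Fin m × ι)).prod (((Measure.pi fun _ : ι => samp p I).prod (gaussPi (Fin m × ι))).prod
    (Measure.pi fun _ : κ => (Measure.pi fun _ : ι => samp p I').prod (gaussPi (Fin mT × ι))))

/-- The data of the signal `x`. -/
noncomputable def dat {m mT : ℕ} (ω : Seed m mT κ ι) (x : ι → ℝ) : Dat κ ι :=
  (base ω.1 x, base ω.2.1.2 (fun i => ω.2.1.1 i * x i),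
    fun t => base (ω.2.2 t).2 fun i => (ω.2.2 t).1 i * x i)

/-- The estimator at inverse scale `c`. -/
noncomputable def est (h : ℝ → ℝ → ℝ) (p : ℝ) (L : ℕ) (c : ℝ) (y : Dat κ ι) : ℝ :=
  ∑ l ∈ Finset.range (L + 1), ((2 : ℝ) ^ p) ^ l * stat h ((2 ^ l)⁻¹ * c) y.1 +
    (stat h c y.2.1 + med fun t => stat h c (y.2.2 t))

/-- What the estimator estimates, per coordinate. -/
noncomputable def gain (p : ℝ) (I I' : Finset ℕ) (L : ℕ) (ψ : ℝ → ℝ) (y : ℝ) : ℝ :=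
  ∑ l ∈ Finset.range (L + 1), ((2 : ℝ) ^ p) ^ l * ψ ((2 ^ l)⁻¹ * y) +
    (sampMean p I ψ y + sampMean p I' ψ y)

lemma isProbabilityMeasure_seedLaw (hp : 2 < p) {I I' : Finset ℕ} (hI : ∀ l ∈ I, 1 ≤ l)
    (hI' : ∀ l ∈ I', 1 ≤ l) (m mT : ℕ) : IsProbabilityMeasure (seedLaw p I I' m mT κ ι) := by
  have := isProbabilityMeasure_samp hp hI
  have := isProbabilityMeasure_samp hp hI'
  unfold seedLaw
  infer_instance

lemma measurable_est (hh : Measurable fun q : ℝ × ℝ => h q.1 q.2) (L : ℕ) :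
    Measurable fun q : ℝ × Dat κ ι => est h p L q.1 q.2 := by
  unfold est
  have h0 := measurable_stat (ι := ι) hh
  have h1 : ∀ b : ℝ, Measurable fun q : ℝ × Dat κ ι => (b * q.1, q.2.1) := fun b =>
    (measurable_fst.const_mul b).prodMk (measurable_fst.comp measurable_snd)
  have h2 : Measurable fun q : ℝ × Dat κ ι => (q.1, q.2.2.1) :=
    measurable_fst.prodMk (measurable_fst.comp (measurable_snd.comp measurable_snd))
  have h3 : ∀ t, Measurable fun q : ℝ × Dat κ ι => (q.1, q.2.2.2 t) := fun t =>
    measurable_fst.prodMk ((measurable_pi_apply t).comp (measurable_snd.comp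
      (measurable_snd.comp measurable_snd)))
  have e1 : Measurable fun q : ℝ × Dat κ ι =>
      ∑ l ∈ Finset.range (L + 1), ((2 : ℝ) ^ p) ^ l * stat h ((2 ^ l)⁻¹ * q.1) q.2.1 :=
    Finset.measurable_sum _ fun l _ => by
      have := (h0.comp (h1 (2 ^ l)⁻¹)).const_mul (((2 : ℝ) ^ p) ^ l)
      exact this
  have e2 : Measurable fun q : ℝ × Dat κ ι => stat h q.1 q.2.2.1 := by
    have := h0.comp h2
    exact this
  have e3 : Measurable fun q : ℝ × Dat κ ι => med fun t => stat h q.1 (q.2.2.2 t) := by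
    have h4 := measurable_pi_iff.2 fun t => h0.comp (h3 t)
    have := measurable_med.comp h4
    exact this
  exact e1.add (e2.add e3)

lemma measurable_sample_base (m : ℕ) : Measurable fun q : ((ι → ℝ) × (Fin m × ι → ℝ)) × (ι → ℝ) =>
    base q.1.2 fun i => q.1.1 i * q.2 i := by
  have h1 : Measurable fun q : ((ι → ℝ) × (Fin m × ι → ℝ)) × (ι → ℝ) =>
      (fun i => q.1.1 i * q.2 i : ι → ℝ) := by
    refine measurable_pi_iff.2 fun i => ?_
    have a1 : Measurable fun q : ((ι → ℝ) × (Fin m × ι → ℝ)) × (ι → ℝ) => q.1.1 i := by fun_prop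
    have a2 : Measurable fun q : ((ι → ℝ) × (Fin m × ι → ℝ)) × (ι → ℝ) => q.2 i := by fun_prop
    exact a1.mul a2
  have h2 : Measurable fun q : ((ι → ℝ) × (Fin m × ι → ℝ)) × (ι → ℝ) => q.1.2 :=
    measurable_snd.comp measurable_fst
  have h3 := (measurable_base m).comp (h2.prodMk h1)
  exact h3

lemma measurable_dat (m mT : ℕ) :
    Measurable fun q : Seed m mT κ ι × (ι → ℝ) => dat q.1 q.2 := by
  have h1 : Measurable fun q : Seed m mT κ ι × (ι → ℝ) => (q.1.1, q.2) :=
    (measurable_fst.comp measurable_fst).prodMk measurable_snd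
  have h2 : Measurable fun q : Seed m mT κ ι × (ι → ℝ) => (q.1.2.1, q.2) :=
    (measurable_fst.comp (measurable_snd.comp measurable_fst)).prodMk measurable_snd
  have h3 : ∀ t, Measurable fun q : Seed m mT κ ι × (ι → ℝ) => (q.1.2.2 t, q.2) := fun t =>
    ((measurable_pi_apply t).comp (measurable_snd.comp (measurable_snd.comp measurable_fst))).prodMk
      measurable_snd
  have e1 := (measurable_base m).comp h1
  have e2 := (measurable_sample_base m).comp h2
  have e3 := measurable_pi_iff.2 fun t => (measurable_sample_base mT).comp (h3 t)
  have e4 := e1.prodMk (e2.prodMk e3)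
  exact e4

lemma est_dat_smul {m mT : ℕ} (ω : Seed m mT κ ι) (x : ι → ℝ) (L : ℕ) {c : ℝ} (hc : 0 ≤ c) :
    est h p L c (dat ω x) = est h p L 1 (dat ω fun i => c * x i) := by
  have e : ∀ v : ι → ℝ, (fun i => v i * (c * x i)) = fun i => c * (v i * x i) :=
    fun v => funext fun i => by ring
  simp only [est, dat, e, stat_base_smul _ _ hc, mul_one, one_mul]

/-- Concentration of the estimator. -/
lemma est_conc (hp : 2 < p) {I I' : Finset ℕ} (hI : ∀ l ∈ I, 1 ≤ l) (hI' : ∀ l ∈ I', 1 ≤ l)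
    (hh : Estimates h ψ C J) {m mT : ℕ} (hm : 0 < m) (hmT : 0 < mT) (x : ι → ℝ)
    {q N t w a a' E : ℝ} {L : ℕ}
    (hw : 1 < w) (hwp : (2 : ℝ) ^ p = 4 * w ^ 4) (hq1 : q ≤ 1) (hq0 : 0 < q)
    (hn : Fintype.card ι * exp (-(1 / (64 * q ^ 2))) ≤ 1) (ht : 0 < t) (ht1 : t ≤ 1)
    (hqt : q ^ J ≤ t / w ^ L) (hN : 4 * 2 ^ p * ∑ i, |x i| ^ p ≤ N) (hx : 2 * nrm x ≤ q * √m)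
    (hmN : N * w ^ (2 * L) ≤ m) (hqw : q ^ 2 * w ^ (4 * L) ≤ 1)
    (hX : 1 ≤ t ^ 2 * N / (2048 * C ^ 2)) (ha : 2 * √a ≤ q * √m) (ha' : 2 * √a' ≤ q * √mT)
    (hmT' : N ≤ mT)
    (hE : (Measure.pi fun _ : ι => samp p I).real {v | a ≤ ∑ i, (v i * x i) ^ 2} ≤ E)
    (hE' : (Measure.pi fun _ : ι => samp p I').real {v | a' ≤ ∑ i, (v i * x i) ^ 2} +
      18 * exp (-(t ^ 2 * N / (2048 * C ^ 2))) ≤ 1 / 16) :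
    (seedLaw p I I' m mT κ ι).real {ω | (4 * (1 / (1 - w⁻¹)) + 10) * C * t * N <
        |est h p L 1 (dat ω x) - ∑ i, gain p I I' L ψ (x i)|} ≤
      (15 * (1 / (1 - exp (-(w ^ 2 - 1)))) + 18) * exp (-(t ^ 2 * N / (2048 * C ^ 2))) + E +
        exp (-(Fintype.card κ / 2)) := by
  have i1 := isProbabilityMeasure_samp hp hI
  have i2 := isProbabilityMeasure_samp hp hI'
  have hN0 : 0 ≤ N := le_trans (by positivity) hN
  have hF0 : 0 ≤ ∑ i, |x i| ^ p := by positivity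
  have hwL : 1 ≤ w ^ L := one_le_pow₀ hw.le
  have hN1 : 2 ^ p * ∑ i, |x i| ^ p ≤ N :=
    le_trans (by have : (0 : ℝ) ≤ 2 ^ p * ∑ i, |x i| ^ p := by positivity
                 linarith) hN
  have hqt' : q ^ J ≤ t := hqt.trans (div_le_self ht.le hwL)
  have hNm : N ≤ m := (le_mul_of_one_le_right hN0 (one_le_pow₀ hw.le)).trans hmN
  have c1 := high_conc hh hm x hw hwp (by linarith) hq1 hq0 hn ht ht1 hqt hN1 hx hmN hqw hX
  have c2 := sampled_conc hp hI hh hm x hq1 hq0 hn ht ht1 hqt' hN ha hNm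
  have c3 := (sampled_conc hp hI' hh hmT x hq1 hq0 hn ht ht1 hqt' hN ha' hmT').trans hE'
  have hmeas : Measurable fun ω : (ι → ℝ) × (Fin mT × ι → ℝ) =>
      stat h 1 (base ω.2 fun i => ω.1 i * x i) :=
    (measurable_stat hh.meas).comp ((measurable_const (a := (1 : ℝ))).prodMk
      ((measurable_sample_base mT).comp (measurable_id.prodMk measurable_const)))
  have c4 := med_conc (κ := κ) _ hmeas c3
  set B1 := {A : Fin m × ι → ℝ | 4 * C * (1 / (1 - w⁻¹)) * t * N <
        |∑ l ∈ Finset.range (L + 1), ((2 : ℝ) ^ p) ^ l * stat h (2 ^ l)⁻¹ (base A x) -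
        ∑ l ∈ Finset.range (L + 1), ((2 : ℝ) ^ p) ^ l * ∑ i, ψ ((2 ^ l)⁻¹ * x i)|}
  set B2 := {ω : (ι → ℝ) × (Fin m × ι → ℝ) | 5 * C * t * N <
    |stat h 1 (base ω.2 fun i => ω.1 i * x i) - ∑ i, sampMean p I ψ (x i)|}
  set B3 := {w : κ → (ι → ℝ) × (Fin mT × ι → ℝ) | 5 * C * t * N <
    |med (fun t => stat h 1 (base (w t).2 fun i => (w t).1 i * x i)) - ∑ i, sampMean p I' ψ (x i)|}
  have hsub : {ω : Seed m mT κ ι | (4 * (1 / (1 - w⁻¹)) + 10) * C * t * N <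
        |est h p L 1 (dat ω x) - ∑ i, gain p I I' L ψ (x i)|} ⊆
      {ω | ω.1 ∈ B1} ∪ {ω | ω.2 ∈ {ω' : _ × _ | ω'.1 ∈ B2} ∪ {ω' | ω'.2 ∈ B3}} := by
    intro ω hω
    by_contra hcon
    simp only [Set.mem_union, not_or] at hcon
    obtain ⟨h1, h23⟩ := hcon
    have h2 : ω.2.1 ∉ B2 := fun hh => h23 (Or.inl hh)
    have h3 : ω.2.2 ∉ B3 := fun hh => h23 (Or.inr hh)
    change ¬ (ω.1 ∈ B1) at h1
    change ¬ (_ : ℝ) < _ at h1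
    change ¬ (_ : ℝ) < _ at h2
    change ¬ (_ : ℝ) < _ at h3
    change (_ : ℝ) < _ at hω
    refine absurd hω (not_lt.2 ?_)
    have hG : ∑ i, gain p I I' L ψ (x i) =
        ∑ l ∈ Finset.range (L + 1), ((2 : ℝ) ^ p) ^ l * ∑ i, ψ ((2 ^ l)⁻¹ * x i) +
        (∑ i, sampMean p I ψ (x i) + ∑ i, sampMean p I' ψ (x i)) := by
      simp only [gain, Finset.sum_add_distrib, Finset.mul_sum]
      rw [Finset.sum_comm]
    rw [hG]
    simp only [est, dat, mul_one]
    rw [add_sub_add_comm, add_sub_add_comm]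
    refine (abs_add_le _ _).trans ?_
    have := abs_add_le (stat h 1 (base ω.2.1.2 fun i => ω.2.1.1 i * x i) - ∑ i, sampMean p I ψ (x i))
      ((med fun t => stat h 1 (base (ω.2.2 t).2 fun i => (ω.2.2 t).1 i * x i)) -
        ∑ i, sampMean p I' ψ (x i))
    linarith
  have hprob := isProbabilityMeasure_seedLaw (κ := κ) (ι := ι) hp hI hI' m mT
  refine (measureReal_mono hsub (measure_ne_top _ _)).trans ?_
  refine (measureReal_union_le _ _).trans ?_
  unfold seedLaw
  rw [prod_fst_real, prod_snd_real]
  have := measureReal_union_le (μ := ((Measure.pi fun _ : ι => samp p I).prod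
    (gaussPi (Fin m × ι))).prod (Measure.pi fun _ : κ => (Measure.pi fun _ : ι =>
      samp p I').prod (gaussPi (Fin mT × ι)))) {ω' | ω'.1 ∈ B2} {ω' | ω'.2 ∈ B3}
  rw [prod_fst_real, prod_snd_real] at this
  linarith

end est

lemma rate_pow_mul (p : ℝ) (l : ℕ) : rate p ^ l * ((2 : ℝ) ^ l) ^ p = 1 := by
  rw [rate_pow, ← mul_rpow (by positivity) (by positivity), inv_mul_cancel₀ (by positivity), one_rpow]

lemma two_rpow_pow (p : ℝ) (l : ℕ) : ((2 : ℝ) ^ p) ^ l = ((2 : ℝ) ^ l) ^ p := by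
  rw [← rpow_natCast, ← rpow_mul (by norm_num), mul_comm, rpow_mul (by norm_num), rpow_natCast]

lemma sum_Icc_sub (g : ℕ → ℝ) (n : ℕ) :
    ∑ l ∈ Finset.Icc 1 n, (g l - g (l - 1)) = g n - g 0 := by
  induction n with
  | zero => simp
  | succ n ih => rw [Finset.sum_Icc_succ_top (by omega), ih, Nat.add_sub_cancel]; ring

lemma sampMean_Icc_add_Ioc (p : ℝ) (l1 l2 : ℕ) (h : l1 ≤ l2) (ψ : ℝ → ℝ) (y : ℝ) :
    sampMean p (Finset.Icc 1 l1) ψ y + sampMean p (Finset.Ioc l1 l2) ψ y =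
      sampMean p (Finset.Icc 1 l2) ψ y := by
  have hd : Disjoint (Finset.Icc 1 l1) (Finset.Ioc l1 l2) := by
    rw [Finset.disjoint_left]
    intro a ha hb
    rw [Finset.mem_Icc] at ha
    rw [Finset.mem_Ioc] at hb
    omega
  have hu : Finset.Icc 1 l2 = Finset.Icc 1 l1 ∪ Finset.Ioc l1 l2 := by
    ext a
    simp only [Finset.mem_union, Finset.mem_Icc, Finset.mem_Ioc]
    omega
  rw [sampMean, sampMean, sampMean, hu, Finset.sum_union hd]

lemma gain_shell_eq (p : ℝ) {l1 l2 : ℕ} (h : l1 ≤ l2) (L : ℕ) (y : ℝ) :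
    gain p (Finset.Icc 1 l1) (Finset.Ioc l1 l2) L (shell p) y =
      |y| ^ p * (cut (2 ^ l2 * y) - cut ((2 ^ (L + 1))⁻¹ * y)) := by
  have h1 : ∑ l ∈ Finset.range (L + 1), ((2 : ℝ) ^ p) ^ l * shell p ((2 ^ l)⁻¹ * y) =
      |y| ^ p * (cut y - cut ((2 ^ (L + 1))⁻¹ * y)) := by
    have : ∀ l ∈ Finset.range (L + 1), ((2 : ℝ) ^ p) ^ l * shell p ((2 ^ l)⁻¹ * y) =
        |y| ^ p * (cut ((2 ^ l)⁻¹ * y) - cut ((2 ^ (l + 1))⁻¹ * y)) := fun l _ => by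
      have e : (2 ^ l)⁻¹ * y / 2 = (2 ^ (l + 1))⁻¹ * y := by rw [pow_succ]; field_simp
      rw [shell, e, two_rpow_pow, ← mul_assoc, ← mul_rpow (by positivity) (abs_nonneg _), abs_mul,
        abs_of_pos (show (0 : ℝ) < (2 ^ l)⁻¹ by positivity), mul_inv_cancel_left₀ (by positivity)]
    rw [Finset.sum_congr rfl this, ← Finset.mul_sum,
      Finset.sum_range_sub' (fun l => cut ((2 ^ l)⁻¹ * y))]
    simp
  have h2 : sampMean p (Finset.Icc 1 l2) (shell p) y = |y| ^ p * (cut (2 ^ l2 * y) - cut y) := by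
    have : ∀ l ∈ Finset.Icc 1 l2, rate p ^ l * shell p (2 ^ l * y) =
        |y| ^ p * (cut (2 ^ l * y) - cut (2 ^ (l - 1) * y)) := fun l hl => by
      obtain ⟨j, rfl⟩ := Nat.exists_eq_add_of_le' (Finset.mem_Icc.1 hl).1
      have e : 2 ^ (j + 1) * y / 2 = 2 ^ j * y := by rw [pow_succ]; field_simp
      rw [shell, e, abs_mul, abs_of_pos (show (0 : ℝ) < 2 ^ (j + 1) by positivity),
        mul_rpow (by positivity) (abs_nonneg _), ← mul_assoc, ← mul_assoc, rate_pow_mul, one_mul,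
        Nat.add_sub_cancel]
    rw [sampMean, Finset.sum_congr rfl this, ← Finset.mul_sum,
      sum_Icc_sub fun l => cut (2 ^ l * y)]
    simp
  rw [gain, sampMean_Icc_add_Ioc p l1 l2 h, h1, h2]
  ring

lemma gain_shell_error {p : ℝ} (hp : 0 ≤ p) {l1 l2 : ℕ} (h : l1 ≤ l2) {L : ℕ} {y : ℝ}
    (hy : |y| ≤ 2 ^ (L + 1)) :
    |gain p (Finset.Icc 1 l1) (Finset.Ioc l1 l2) L (shell p) y - |y| ^ p| ≤ (2 / 2 ^ l2) ^ p := by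
  rw [gain_shell_eq p h, cut_eq_zero (z := (2 ^ (L + 1))⁻¹ * y), sub_zero]
  · rcases le_or_gt 2 |2 ^ l2 * y| with h2 | h2
    · rw [cut_eq_one h2, mul_one, sub_self, abs_zero]
      positivity
    · have h0 := cut_nonneg (2 ^ l2 * y)
      have h1 := cut_le_one (2 ^ l2 * y)
      have h3 : 0 ≤ |y| ^ p := by positivity
      have h4 : |y| ^ p ≤ (2 / 2 ^ l2) ^ p := by
        gcongr
        rw [le_div_iff₀ (by positivity)]
        rw [abs_mul, abs_of_pos (show (0 : ℝ) < 2 ^ l2 by positivity)] at h2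
        linarith
      rw [abs_le]
      constructor <;> nlinarith
  · rw [abs_mul, abs_of_pos (show (0 : ℝ) < (2 ^ (L + 1))⁻¹ by positivity), inv_mul_le_iff₀ (by positivity)]
    simpa using hy

lemma four_le_two_rpow {p : ℝ} (hp : 2 < p) : (4 : ℝ) ≤ 2 ^ p := by
  calc (4 : ℝ) = 2 ^ (2 : ℝ) := by rw [rpow_two]; norm_num
    _ ≤ 2 ^ p := rpow_le_rpow_of_exponent_le (by norm_num) hp.le

lemma sum_high_cut_le {p : ℝ} (hp : 2 < p) (n : ℕ) (y : ℝ) :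
    ∑ l ∈ Finset.range n, ((2 : ℝ) ^ p) ^ l * cut ((2 ^ l)⁻¹ * y) ≤
      if |y| ≤ 1 then 0 else 4 / 3 * |y| ^ p - 1 / 3 := by
  have h4 := four_le_two_rpow hp
  induction n generalizing y with
  | zero =>
    rw [Finset.sum_range_zero]
    split_ifs with h
    · rfl
    · have := one_le_rpow (not_le.1 h).le (by linarith : 0 ≤ p)
      linarith
  | succ n ih =>
    have e : ∀ l ∈ Finset.range n, ((2 : ℝ) ^ p) ^ (l + 1) * cut ((2 ^ (l + 1))⁻¹ * y) =
        2 ^ p * (((2 : ℝ) ^ p) ^ l * cut ((2 ^ l)⁻¹ * (y / 2))) := fun l _ => by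
      have e1 : (2 ^ (l + 1))⁻¹ * y = (2 ^ l)⁻¹ * (y / 2) := by rw [pow_succ]; field_simp
      rw [e1, pow_succ]
      ring
    rw [Finset.sum_range_succ', Finset.sum_congr rfl e, ← Finset.mul_sum]
    have h1 := ih (y / 2)
    have hc := cut_le_one y
    have hy2 : |y / 2| = |y| / 2 := by rw [abs_div, abs_two]
    rw [hy2] at h1
    simp only [pow_zero, inv_one, one_mul]
    have h5 : (2 : ℝ) ^ p * (|y| / 2) ^ p = |y| ^ p := by
      rw [← mul_rpow (by norm_num) (by positivity), mul_div_cancel₀ _ two_ne_zero]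
    rcases le_or_gt |y| 1 with h | h
    · rw [if_pos (by linarith)] at h1
      rw [if_pos h, cut_eq_zero h]
      nlinarith
    · rw [if_neg (not_le.2 h)]
      have h6 := one_le_rpow h.le (by linarith : 0 ≤ p)
      split_ifs at h1 with h7 <;> nlinarith

lemma sampMean_cut_le {p : ℝ} (hp : 2 < p) (I : Finset ℕ) (y : ℝ) :
    sampMean p I cut y ≤ 4 / 3 * |y| ^ p := by
  have := sum_rate_visible_le hp I one_pos y
  rw [div_one] at this
  refine le_trans (Finset.sum_le_sum fun l _ => ?_) this
  have := rate_pos p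
  gcongr
  split_ifs with h
  · exact cut_le_one _
  · exact (cut_eq_zero (not_le.1 h).le).le

lemma gain_cut_le {p : ℝ} (hp : 2 < p) {l1 l2 : ℕ} (h : l1 ≤ l2) (L : ℕ) (y : ℝ) :
    gain p (Finset.Icc 1 l1) (Finset.Ioc l1 l2) L cut y ≤ 3 * |y| ^ p := by
  rw [gain, sampMean_Icc_add_Ioc p l1 l2 h]
  have h1 := sum_high_cut_le hp (L + 1) y
  have h2 := sampMean_cut_le hp (Finset.Icc 1 l2) y
  have h3 : 0 ≤ |y| ^ p := by positivity
  split_ifs at h1 <;> linarith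

lemma le_gain_cut {p : ℝ} (hp : 2 < p) {l1 l2 : ℕ} (h : l1 ≤ l2) {L : ℕ} {y : ℝ}
    (hy : |y| < 2 ^ (L + 2)) :
    (4⁻¹ : ℝ) ^ p * (|y| ^ p - (2 / 2 ^ l2) ^ p) ≤
      gain p (Finset.Icc 1 l1) (Finset.Ioc l1 l2) L cut y := by
  rw [gain, sampMean_Icc_add_Ioc p l1 l2 h]
  have hr := rate_pos p
  have n1 : ∀ l ∈ Finset.range (L + 1), 0 ≤ ((2 : ℝ) ^ p) ^ l * cut ((2 ^ l)⁻¹ * y) :=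
    fun l _ => mul_nonneg (by positivity) (cut_nonneg _)
  have n2 : ∀ l ∈ Finset.Icc 1 l2, 0 ≤ rate p ^ l * cut (2 ^ l * y) :=
    fun l _ => mul_nonneg (by positivity) (cut_nonneg _)
  have s1 := Finset.sum_nonneg n1
  have s2 := Finset.sum_nonneg n2
  have h0 : 0 ≤ (2 / 2 ^ l2 : ℝ) ^ p := by positivity
  have h4 : (0 : ℝ) < 4⁻¹ ^ p := by positivity
  have hyp : (4⁻¹ : ℝ) ^ p * |y| ^ p = (|y| / 4) ^ p := by
    rw [← mul_rpow (by norm_num) (abs_nonneg _)]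
    congr 1
    ring
  have key : (4⁻¹ : ℝ) ^ p * (|y| ^ p - (2 / 2 ^ l2) ^ p) ≤ (|y| / 4) ^ p := by
    rw [← hyp]; nlinarith
  rcases le_or_gt |y| (2 / 2 ^ l2) with hs | hs
  · have : |y| ^ p ≤ (2 / 2 ^ l2) ^ p := by gcongr
    have : (4⁻¹ : ℝ) ^ p * (|y| ^ p - (2 / 2 ^ l2) ^ p) ≤ 0 :=
      mul_nonpos_of_nonneg_of_nonpos h4.le (by linarith)
    have s2' : 0 ≤ sampMean p (Finset.Icc 1 l2) cut y := s2
    linarith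
  have hy0 : 0 < |y| := lt_trans (by positivity) hs
  rcases le_or_gt 2 |y| with h2 | h2
  · obtain ⟨l, hl1, hl2⟩ := exists_nat_pow_near (x := |y| / 2) (y := 2) (by linarith) one_lt_two
    have hlL : l < L + 1 := by
      have : (2 : ℝ) ^ l < 2 ^ (L + 1) := lt_of_le_of_lt hl1 (by rw [pow_succ] at hy; linarith)
      exact (pow_lt_pow_iff_right₀ one_lt_two).1 this
    have := Finset.single_le_sum n1 (Finset.mem_range.2 hlL)
    have hc : cut ((2 ^ l)⁻¹ * y) = 1 := cut_eq_one (by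
      rw [abs_mul, abs_of_pos (show (0 : ℝ) < (2 ^ l)⁻¹ by positivity), inv_mul_eq_div,
        le_div_iff₀ (by positivity)]
      linarith)
    have h8 : (|y| / 4) ^ p ≤ ((2 : ℝ) ^ p) ^ l := by
      rw [two_rpow_pow]
      gcongr
      rw [pow_succ] at hl2
      linarith
    have s2' : 0 ≤ sampMean p (Finset.Icc 1 l2) cut y := s2
    rw [hc] at this
    linarith
  · obtain ⟨j, hj1, hj2⟩ := exists_nat_pow_near (x := 2 / |y|) (y := 2)
      (by rw [le_div_iff₀ hy0]; linarith) one_lt_two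
    rw [le_div_iff₀ hy0] at hj1
    rw [div_lt_iff₀ hy0] at hj2
    have hjl : j < l2 := by
      rw [div_lt_iff₀ (by positivity)] at hs
      have : (2 : ℝ) ^ j < 2 ^ l2 := by
        refine lt_of_mul_lt_mul_right ?_ hy0.le
        linarith
      exact (pow_lt_pow_iff_right₀ one_lt_two).1 this
    have := Finset.single_le_sum n2 (Finset.mem_Icc.2 ⟨Nat.le_add_left 1 j, hjl⟩)
    have hc : cut (2 ^ (j + 1) * y) = 1 := cut_eq_one (by
      rw [abs_mul, abs_of_pos (show (0 : ℝ) < 2 ^ (j + 1) by positivity)]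
      exact hj2.le)
    have h8 : (|y| / 4) ^ p ≤ rate p ^ (j + 1) := by
      rw [rate_pow]
      gcongr
      rw [le_inv_comm₀ (by positivity) (by positivity), inv_div, le_div_iff₀ hy0, pow_succ]
      linarith
    rw [hc] at this
    have : rate p ^ (j + 1) ≤ sampMean p (Finset.Icc 1 l2) cut y := by rw [sampMean]; linarith
    linarith

lemma sampSq_Icc_le {p w : ℝ} (hw : 1 < w) (hwp : (2 : ℝ) ^ p = 4 * w ^ 4) (l1 : ℕ) :
    sampSq p (Finset.Icc 1 l1) ≤ 1 / (1 - (w ^ 4)⁻¹) := by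
  have hr : 4 * rate p = (w ^ 4)⁻¹ := by
    rw [rate, rpow_neg (by norm_num), hwp]
    field_simp
  have h1 : (w ^ 4)⁻¹ < 1 := inv_lt_one_of_one_lt₀ (one_lt_pow₀ hw (by norm_num))
  have h0 : 0 ≤ (w ^ 4)⁻¹ := by positivity
  rw [sampSq, hr]
  refine (sum_pow_le h0 h1 _ (a := 0) fun l _ => Nat.zero_le l).trans ?_
  rw [pow_zero]

lemma sampSq_Ioc_le {p w : ℝ} (hw : 1 < w) (hwp : (2 : ℝ) ^ p = 4 * w ^ 4) (l1 l2 : ℕ) :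
    sampSq p (Finset.Ioc l1 l2) ≤ 1 / (1 - (w ^ 4)⁻¹) / (w ^ 4) ^ l1 := by
  have hr : 4 * rate p = (w ^ 4)⁻¹ := by
    rw [rate, rpow_neg (by norm_num), hwp]
    field_simp
  have h1 : (w ^ 4)⁻¹ < 1 := inv_lt_one_of_one_lt₀ (one_lt_pow₀ hw (by norm_num))
  have h0 : 0 ≤ (w ^ 4)⁻¹ := by positivity
  rw [sampSq, hr]
  refine (sum_pow_le h0 h1 _ (a := l1) fun l hl => (Finset.mem_Ioc.1 hl).1.le).trans (le_of_eq ?_)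
  rw [inv_pow]
  ring

section
variable {ι κ : Type*} [Fintype ι] [Fintype κ] [Nonempty κ]

/-- The rough estimator is monotone in the inverse scale. -/
lemma est_cut_mono {p : ℝ} (L : ℕ) {c c' : ℝ} (hc : 0 ≤ c) (hcc : c ≤ c') (y : Dat κ ι) :
    est (fun _ => cut) p L c y ≤ est (fun _ => cut) p L c' y := by
  have hs : ∀ {d d' : ℝ} (z : ℝ × (ι → ℝ)), 0 ≤ d → d ≤ d' →
      stat (fun _ => cut) d z ≤ stat (fun _ => cut) d' z := fun z hd hdd =>
    Finset.sum_le_sum fun i _ => cut_mono (by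
      rw [abs_mul, abs_mul, abs_of_nonneg hd, abs_of_nonneg (hd.trans hdd)]
      gcongr)
  refine add_le_add (Finset.sum_le_sum fun l _ => ?_) (add_le_add (hs _ hc hcc) (med_mono fun t =>
    hs _ hc hcc))
  have := hs y.1 (d := (2 ^ l)⁻¹ * c) (d' := (2 ^ l)⁻¹ * c') (by positivity) (by gcongr)
  gcongr

lemma base_zero {m : ℕ} (A : Fin m × ι → ℝ) : base A (fun _ => 0) = (0, fun _ => 0) := by
  have := base_smul A (fun _ => 0) (le_refl (0 : ℝ))
  simpa using this

lemma est_cut_dat_zero {p : ℝ} {m mT : ℕ} (L : ℕ) (c : ℝ) (ω : Seed m mT κ ι) :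
    est (fun _ => cut) p L c (dat ω fun _ => 0) = 0 := by
  have h0 : ∀ d : ℝ, stat (fun _ => cut) d ((0, fun _ => 0) : ℝ × (ι → ℝ)) = 0 := fun d =>
    Finset.sum_eq_zero fun i _ => cut_eq_zero (by simp)
  have hm : med (fun _ : κ => (0 : ℝ)) = 0 :=
    le_antisymm (med_le fun s hs => by
      have : s.Nonempty := Finset.card_pos.1 (by have := Fintype.card_pos (α := κ); omega)
      exact ⟨this.choose, this.choose_spec, le_rfl⟩)
      (le_med (s := Finset.univ) (by rw [Finset.card_univ]; omega) fun _ _ => le_rfl)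
  simp only [est, dat, mul_zero, base_zero, h0, Finset.sum_const_zero, hm, add_zero]

end

section
variable {ι κ : Type*} [Fintype ι] [Fintype κ] [Nonempty κ] {p : ℝ} {L : ℕ}

/-- The largest dyadic scale at which the rough estimator is at least `b`. -/
noncomputable def dyadicScale (p : ℝ) (L : ℕ) (b : ℝ) (y : Dat κ ι) : ℝ :=
  (⨆ j : ℤ, if b ≤ est (fun _ => cut) p L ((2 : ℝ) ^ j)⁻¹ y then
    ENNReal.ofReal ((2 : ℝ) ^ j) else 0).toReal

/-- The final estimator, computed from two independent copies of the data. -/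
noncomputable def twoStage (h : ℝ → ℝ → ℝ) (p : ℝ) (L : ℕ) (b : ℝ) (y : Dat κ ι × Dat κ ι) : ℝ :=
  (4 * dyadicScale p L b y.1) ^ p * est h p L (4 * dyadicScale p L b y.1)⁻¹ y.2

lemma measurable_dyadicScale (L : ℕ) (b : ℝ) :
    Measurable (dyadicScale p L b : Dat κ ι → ℝ) := by
  have h0 : Measurable fun q : ℝ × ℝ => (fun _ : ℝ => cut) q.1 q.2 :=
    contDiff_cut.continuous.measurable.comp measurable_snd
  have h1 : ∀ c : ℝ, Measurable fun y : Dat κ ι => est (fun _ => cut) p L c y := fun c => by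
    have := (measurable_est (p := p) (κ := κ) (ι := ι) (h := fun _ => cut) h0 L).comp
      (measurable_const (a := c) |>.prodMk measurable_id)
    exact this
  exact (Measurable.iSup fun j => Measurable.ite (measurableSet_le measurable_const (h1 _))
    measurable_const measurable_const).ennreal_toReal

lemma measurable_twoStage {h : ℝ → ℝ → ℝ} (hh : Measurable fun q : ℝ × ℝ => h q.1 q.2) (L : ℕ)
    (b : ℝ) : Measurable (twoStage h p L b : Dat κ ι × Dat κ ι → ℝ) := by
  have h1 : Measurable fun y : Dat κ ι × Dat κ ι => 4 * dyadicScale p L b y.1 :=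
    ((measurable_dyadicScale L b).comp measurable_fst).const_mul 4
  have h2 := (measurable_est (p := p) (κ := κ) (ι := ι) hh L).comp (h1.inv.prodMk measurable_snd)
  have h3 := (h1.pow_const p).mul h2
  exact h3

/-- The dyadic scale is located by the values of the rough estimator at two scales. -/
lemma dyadicScale_mem {b : ℝ} {y : Dat κ ι} {i j : ℤ}
    (h1 : b ≤ est (fun _ => cut) p L ((2 : ℝ) ^ i)⁻¹ y)
    (h2 : est (fun _ => cut) p L ((2 : ℝ) ^ j)⁻¹ y < b) :
    (2 : ℝ) ^ i ≤ dyadicScale p L b y ∧ dyadicScale p L b y ≤ 2 ^ j := by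
  have hle : (⨆ l : ℤ, if b ≤ est (fun _ => cut) p L ((2 : ℝ) ^ l)⁻¹ y then
      ENNReal.ofReal ((2 : ℝ) ^ l) else 0) ≤ ENNReal.ofReal ((2 : ℝ) ^ j) := by
    refine iSup_le fun l => ?_
    split_ifs with h
    · refine ENNReal.ofReal_le_ofReal (zpow_le_zpow_right₀ one_le_two ?_)
      by_contra hlj
      have : est (fun _ => cut) p L ((2 : ℝ) ^ l)⁻¹ y ≤ est (fun _ => cut) p L ((2 : ℝ) ^ j)⁻¹ y := by
        refine est_cut_mono L (by positivity) ?_ y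
        gcongr
        · exact one_le_two
        · omega
      linarith
    · simp
  have hge : ENNReal.ofReal ((2 : ℝ) ^ i) ≤ ⨆ l : ℤ, if b ≤ est (fun _ => cut) p L ((2 : ℝ) ^ l)⁻¹ y then
      ENNReal.ofReal ((2 : ℝ) ^ l) else 0 := by
    refine le_iSup_of_le i ?_
    rw [if_pos h1]
  constructor
  · exact (ENNReal.ofReal_le_iff_le_toReal (ne_top_of_le_ne_top ENNReal.ofReal_ne_top hle)).1 hge
  · exact ENNReal.toReal_le_of_le_ofReal (by positivity) hle

lemma twoStage_zero {m mT : ℕ} (h : ℝ → ℝ → ℝ) (hp : p ≠ 0) {b : ℝ} (hb : 0 < b)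
    (ω : Seed m mT κ ι) (y : Dat κ ι) : twoStage h p L b (dat ω (fun _ => 0), y) = 0 := by
  have : dyadicScale p L b (dat ω fun _ => 0) = 0 := by
    simp only [dyadicScale, est_cut_dat_zero, not_le.2 hb, if_false, iSup_const, ENNReal.toReal_zero]
  rw [twoStage, this, mul_zero, zero_rpow hp, zero_mul]

lemma sum_smul_rpow {c : ℝ} (hc : 0 ≤ c) (x : ι → ℝ) :
    ∑ i, |c * x i| ^ p = c ^ p * ∑ i, |x i| ^ p := by
  rw [Finset.mul_sum]
  refine Finset.sum_congr rfl fun i _ => ?_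
  rw [abs_mul, abs_of_nonneg hc, mul_rpow hc (abs_nonneg _)]

lemma abs_le_of_sum_rpow_le (hp : 0 < p) {x : ι → ℝ} {b : ℝ} (hb : 0 ≤ b)
    (h : ∑ i, |x i| ^ p ≤ b ^ p) (i : ι) : |x i| ≤ b := by
  have h1 := Finset.single_le_sum (f := fun i => |x i| ^ p) (fun i _ => by positivity)
    (Finset.mem_univ i)
  exact (rpow_le_rpow_iff (abs_nonneg _) hb hp).1 (h1.trans h)

/-- The second stage is accurate at every admissible scale. -/
lemma est_accurate (hp : 2 < p) {l1 l2 m mT : ℕ} (h12 : l1 ≤ l2) {h : ℝ → ℝ → ℝ}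
    {k ε e1 η : ℝ} (hk0 : 0 < k)
    (hkL : k < ((2 : ℝ) ^ p) ^ (L + 1)) (hl2 : Fintype.card ι * (2 / 2 ^ l2 : ℝ) ^ p ≤ 1)
    (he1 : 1 ≤ e1 * k) (he : 2 * 256 ^ p * e1 ≤ ε)
    [IsProbabilityMeasure (seedLaw p (Finset.Icc 1 l1) (Finset.Ioc l1 l2) m mT κ ι)]
    (hF : ∀ x : ι → ℝ, ∑ i, |x i| ^ p ≤ 2 ^ p * k →
      (seedLaw p (Finset.Icc 1 l1) (Finset.Ioc l1 l2) m mT κ ι).real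
        {ω | e1 * k < |est h p L 1 (dat ω x) -
          ∑ i, gain p (Finset.Icc 1 l1) (Finset.Ioc l1 l2) L (shell p) (x i)|} ≤ η) (x : ι → ℝ)
    {τ F : ℝ} (hτ0 : 0 < τ) (hFdef : F = ∑ i, |x i| ^ p) (hτ1 : F / τ ^ p ≤ k)
    (hτ2 : k * τ ^ p ≤ 256 ^ p * F) :
    (seedLaw p (Finset.Icc 1 l1) (Finset.Ioc l1 l2) m mT κ ι).real
      {ω | ε * F < |τ ^ p * est h p L τ⁻¹ (dat ω x) - F|} ≤ η := by
  have hp0 : 0 < p := by linarith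
  have h2p : (4 : ℝ) ≤ 2 ^ p := four_le_two_rpow hp
  have hF0 : 0 ≤ F := hFdef ▸ Finset.sum_nonneg fun i _ => by positivity
  have hy : ∑ i, |τ⁻¹ * x i| ^ p = F / τ ^ p := by
    rw [sum_smul_rpow (by positivity), inv_rpow hτ0.le, hFdef]
    ring
  have r3 := hF (fun i => τ⁻¹ * x i) (hy.le.trans (hτ1.trans (by nlinarith)))
  refine le_trans (measureReal_mono ?_ (measure_ne_top _ _)) r3
  intro ω hω
  change (_ : ℝ) < _ at hω
  change (_ : ℝ) < _
  by_contra hcon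
  rw [not_lt, ← est_dat_smul ω x L (by positivity)] at hcon
  generalize est h p L τ⁻¹ (dat ω x) = W at hcon hω
  have hg : |∑ i, gain p (Finset.Icc 1 l1) (Finset.Ioc l1 l2) L (shell p) (τ⁻¹ * x i) -
      F / τ ^ p| ≤ 1 := by
    have hle : ∀ i, |τ⁻¹ * x i| ≤ 2 ^ (L + 1) := by
      refine abs_le_of_sum_rpow_le hp0 (by positivity) ?_
      rw [hy, ← two_rpow_pow]
      exact hτ1.trans hkL.le
    rw [← hy, ← Finset.sum_sub_distrib]
    refine (Finset.abs_sum_le_sum_abs _ _).trans ((Finset.sum_le_sum fun i _ =>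
      gain_shell_error hp0.le h12 (hle i)).trans ?_)
    rw [Finset.sum_const, Finset.card_univ, nsmul_eq_mul]
    exact hl2
  have htri := abs_sub_le W
    (∑ i, gain p (Finset.Icc 1 l1) (Finset.Ioc l1 l2) L (shell p) (τ⁻¹ * x i)) (F / τ ^ p)
  have hfin : |τ ^ p * W - F| ≤ ε * F := by
    have e : τ ^ p * W - F = τ ^ p * (W - F / τ ^ p) := by
      field_simp
    rw [e, abs_mul, abs_of_pos (by positivity)]
    have he10 : 0 ≤ e1 := by
      by_contra hneg
      have := mul_neg_of_neg_of_pos (not_le.1 hneg) hk0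
      linarith
    calc _ ≤ τ ^ p * (2 * (e1 * k)) := by gcongr; linarith
      _ = 2 * e1 * (k * τ ^ p) := by ring
      _ ≤ 2 * e1 * (256 ^ p * F) := by gcongr
      _ = 2 * 256 ^ p * e1 * F := by ring
      _ ≤ ε * F := by gcongr
  linarith

lemma scale_bounds {k F D : ℝ} {j : ℤ} (hp : 0 < p) (hk : 0 < k) (h1 : ((2 : ℝ) ^ j) ^ p * k ≤ F)
    (h2 : F < ((2 : ℝ) ^ j) ^ p * 2 ^ p * k) (t1 : (2 : ℝ) ^ j ≤ D) (t2 : D ≤ (2 : ℝ) ^ (j + 6)) :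
    0 < 4 * D ∧ F / (4 * D) ^ p ≤ k ∧ k * (4 * D) ^ p ≤ 256 ^ p * F := by
  have hj : (0 : ℝ) < 2 ^ j := by positivity
  have hD : 0 < 4 * D := by linarith
  refine ⟨hD, ?_, ?_⟩
  · rw [div_le_iff₀ (by positivity)]
    have : ((2 : ℝ) ^ j) ^ p * 2 ^ p ≤ (4 * D) ^ p := by
      rw [← mul_rpow (by positivity) (by norm_num)]
      exact rpow_le_rpow (by positivity) (by linarith) hp.le
    calc F ≤ ((2 : ℝ) ^ j) ^ p * 2 ^ p * k := h2.le
      _ ≤ (4 * D) ^ p * k := by gcongr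
      _ = k * (4 * D) ^ p := mul_comm _ _
  · have : (4 * D) ^ p ≤ ((2 : ℝ) ^ j) ^ p * 256 ^ p := by
      rw [← mul_rpow (by positivity) (by norm_num)]
      rw [zpow_add₀ two_ne_zero] at t2
      norm_num at t2
      exact rpow_le_rpow hD.le (by linarith) hp.le
    calc k * (4 * D) ^ p ≤ k * (((2 : ℝ) ^ j) ^ p * 256 ^ p) := by gcongr
      _ = 256 ^ p * (((2 : ℝ) ^ j) ^ p * k) := by ring
      _ ≤ 256 ^ p * F := by gcongr

/-- The two-stage estimator is accurate when both of its stages are. -/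
lemma twoStage_accurate (hp : 2 < p) {l1 l2 m mT : ℕ}
    (h12 : l1 ≤ l2) {h : ℝ → ℝ → ℝ} (hh : Measurable fun q : ℝ × ℝ => h q.1 q.2)
    {k ε e1 η : ℝ} (hk : 2 ≤ k)
    (hkL : k < ((2 : ℝ) ^ p) ^ (L + 1)) (hl2 : Fintype.card ι * (2 / 2 ^ l2 : ℝ) ^ p ≤ 1)
    (he1 : 1 ≤ e1 * k) (he : 2 * 256 ^ p * e1 ≤ ε)
    (hR : ∀ x : ι → ℝ, ∑ i, |x i| ^ p ≤ 2 ^ p * k →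
      (seedLaw p (Finset.Icc 1 l1) (Finset.Ioc l1 l2) m mT κ ι).real
        {ω | 4⁻¹ ^ p / 16 * k < |est (fun _ => cut) p L 1 (dat ω x) -
          ∑ i, gain p (Finset.Icc 1 l1) (Finset.Ioc l1 l2) L cut (x i)|} ≤ η)
    (hF : ∀ x : ι → ℝ, ∑ i, |x i| ^ p ≤ 2 ^ p * k →
      (seedLaw p (Finset.Icc 1 l1) (Finset.Ioc l1 l2) m mT κ ι).real
        {ω | e1 * k < |est h p L 1 (dat ω x) -
          ∑ i, gain p (Finset.Icc 1 l1) (Finset.Ioc l1 l2) L (shell p) (x i)|} ≤ η) (x : ι → ℝ) :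
    ((seedLaw p (Finset.Icc 1 l1) (Finset.Ioc l1 l2) m mT κ ι).prod
      (seedLaw p (Finset.Icc 1 l1) (Finset.Ioc l1 l2) m mT κ ι)).real
      {ω | ε * ∑ i, |x i| ^ p <
        |twoStage h p L (4⁻¹ ^ p / 4 * k) (dat ω.1 x, dat ω.2 x) - ∑ i, |x i| ^ p|} ≤ 3 * η := by
  have hprob : IsProbabilityMeasure (seedLaw p (Finset.Icc 1 l1) (Finset.Ioc l1 l2) m mT κ ι) :=
    isProbabilityMeasure_seedLaw hp (fun l hl => (Finset.mem_Icc.1 hl).1) (fun l hl => by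
      have := (Finset.mem_Ioc.1 hl).1
      omega) m mT
  set μ := seedLaw p (Finset.Icc 1 l1) (Finset.Ioc l1 l2) m mT κ ι
  set F := ∑ i, |x i| ^ p with hFdef
  set b : ℝ := 4⁻¹ ^ p / 4 * k with hb
  have hp0 : 0 < p := by linarith
  have hk0 : 0 < k := by linarith
  have h4p : (0 : ℝ) < 4⁻¹ ^ p := by positivity
  have hb0 : 0 < b := by positivity
  have hη : 0 ≤ η := measureReal_nonneg.trans (hR (fun _ => 0) (by
    simp only [abs_zero, zero_rpow hp0.ne', Finset.sum_const_zero]; positivity))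
  have hF0 : 0 ≤ F := Finset.sum_nonneg fun i _ => by positivity
  rcases hF0.eq_or_lt with hFz | hFpos
  · have hx : x = fun _ => 0 := by
      funext i
      have := (Finset.sum_eq_zero_iff_of_nonneg (fun i _ => by positivity)).1 hFz.symm i
        (Finset.mem_univ i)
      exact abs_eq_zero.1 ((rpow_eq_zero (abs_nonneg _) hp0.ne').1 this)
    have : {ω : Seed m mT κ ι × Seed m mT κ ι | ε * F <
        |twoStage h p L b (dat ω.1 x, dat ω.2 x) - F|} = ∅ := by
      refine Set.eq_empty_of_forall_notMem fun ω hω => ?_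
      change (_ : ℝ) < _ at hω
      rw [← hFz, hx, twoStage_zero h hp0.ne' hb0] at hω
      simp at hω
    rw [this, measureReal_empty]
    positivity
  have hdat : Measurable fun ω : Seed m mT κ ι => dat ω x := by
    have := (measurable_dat (κ := κ) (ι := ι) m mT).comp (measurable_id.prodMk (measurable_const (a := x)))
    exact this
  have hcutm : Measurable fun q : ℝ × ℝ => (fun _ : ℝ => cut) q.1 q.2 :=
    contDiff_cut.continuous.measurable.comp measurable_snd
  -- the dyadic scale just below the true one
  obtain ⟨j, hj1, hj2⟩ := exists_mem_Ico_zpow (x := (F / k) ^ p⁻¹) (y := (2 : ℝ)) (by positivity)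
    one_lt_two
  have hj1' : ((2 : ℝ) ^ j) ^ p * k ≤ F := by
    have := rpow_le_rpow (by positivity) hj1 hp0.le
    rw [rpow_inv_rpow (by positivity) hp0.ne', le_div_iff₀ hk0] at this
    exact this
  have hj2' : F < ((2 : ℝ) ^ j) ^ p * 2 ^ p * k := by
    have := rpow_lt_rpow (by positivity) hj2 hp0
    rw [rpow_inv_rpow (by positivity) hp0.ne', div_lt_iff₀ hk0, zpow_add_one₀ two_ne_zero,
      mul_rpow (by positivity) (by norm_num)] at this
    exact this
  set u : ℝ := ((2 : ℝ) ^ j) ^ p with hu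
  have hu0 : 0 < u := by positivity
  have hlo : ∑ i, |((2 : ℝ) ^ j)⁻¹ * x i| ^ p = F / u := by
    rw [sum_smul_rpow (by positivity), inv_rpow (by positivity), hFdef]
    ring
  have hhi : ∑ i, |((2 : ℝ) ^ (j + 6))⁻¹ * x i| ^ p = F / (u * 64 ^ p) := by
    rw [sum_smul_rpow (by positivity), inv_rpow (by positivity), zpow_add₀ two_ne_zero,
      mul_rpow (by positivity) (by positivity)]
    norm_num
    rw [hFdef]
    ring
  have h2p : (4 : ℝ) ≤ 2 ^ p := four_le_two_rpow hp
  have e4 : (4⁻¹ : ℝ) ^ p = ((2 : ℝ) ^ p)⁻¹ ^ 2 := by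
    rw [show (4⁻¹ : ℝ) = 2⁻¹ * 2⁻¹ by norm_num, mul_rpow (by norm_num) (by norm_num),
      inv_rpow (by norm_num), sq]
  have e64 : (64 : ℝ) ^ p = ((2 : ℝ) ^ p) ^ 6 := by
    rw [two_rpow_pow]; norm_num
  have hloF : F / u ≤ 2 ^ p * k := by rw [div_le_iff₀ hu0]; linarith
  have hhiF : F / (u * 64 ^ p) ≤ (2 ^ p)⁻¹ ^ 5 * k := by
    rw [div_le_iff₀ (by positivity), e64]
    have : ((2 : ℝ) ^ p)⁻¹ ^ 5 * k * (u * (2 ^ p) ^ 6) = u * 2 ^ p * k := by field_simp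
    linarith
  have hq1 : ((2 : ℝ) ^ p)⁻¹ ^ 5 ≤ 4⁻¹ ^ p / 64 := by
    rw [e4]
    have : ((2 : ℝ) ^ p)⁻¹ ≤ 1 / 4 := by
      rw [inv_le_comm₀ (by positivity) (by norm_num)]; linarith
    have h3 : ((2 : ℝ) ^ p)⁻¹ ^ 3 ≤ (1 / 4) ^ 3 := by gcongr
    calc ((2 : ℝ) ^ p)⁻¹ ^ 5 = ((2 : ℝ) ^ p)⁻¹ ^ 2 * ((2 : ℝ) ^ p)⁻¹ ^ 3 := by ring
      _ ≤ ((2 : ℝ) ^ p)⁻¹ ^ 2 * (1 / 4) ^ 3 := by gcongr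
      _ = _ := by ring
  have r1 := hR _ (hlo.le.trans hloF)
  have r2 := hR _ (hhi.le.trans (hhiF.trans (by
    gcongr
    have : ((2 : ℝ) ^ p)⁻¹ ^ 5 ≤ 1 := pow_le_one₀ (by positivity) (inv_le_one_of_one_le₀ (by linarith))
    linarith)))
  set B1 := {ω : Seed m mT κ ι | 4⁻¹ ^ p / 16 * k <
    |est (fun _ => cut) p L 1 (dat ω fun i => ((2 : ℝ) ^ j)⁻¹ * x i) -
      ∑ i, gain p (Finset.Icc 1 l1) (Finset.Ioc l1 l2) L cut (((2 : ℝ) ^ j)⁻¹ * x i)|} with hB1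
  set B2 := {ω : Seed m mT κ ι | 4⁻¹ ^ p / 16 * k <
    |est (fun _ => cut) p L 1 (dat ω fun i => ((2 : ℝ) ^ (j + 6))⁻¹ * x i) -
      ∑ i, gain p (Finset.Icc 1 l1) (Finset.Ioc l1 l2) L cut (((2 : ℝ) ^ (j + 6))⁻¹ * x i)|} with hB2
  have hBm : ∀ (y : ι → ℝ) (c : ℝ), MeasurableSet {ω : Seed m mT κ ι | 4⁻¹ ^ p / 16 * k <
      |est (fun _ => cut) p L 1 (dat ω y) - c|} := fun y c => by
    have h1 := (measurable_dat (κ := κ) (ι := ι) m mT).comp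
      (measurable_id.prodMk (measurable_const (a := y)))
    have h2 := (measurable_est (p := p) (κ := κ) (ι := ι) (h := fun _ => cut) hcutm L).comp
      ((measurable_const (a := (1 : ℝ))).prodMk h1)
    exact measurableSet_lt measurable_const (h2.sub_const c).abs
  have hm1 : MeasurableSet (B1 ∪ B2) := (hBm _ _).union (hBm _ _)
  have hmeas : MeasurableSet {ω : Seed m mT κ ι × Seed m mT κ ι | ε * F <
        |twoStage h p L b (dat ω.1 x, dat ω.2 x) - F|} := by
    have h1 := (measurable_twoStage (p := p) (κ := κ) (ι := ι) hh L b).comp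
      ((hdat.comp measurable_fst).prodMk (hdat.comp measurable_snd))
    exact measurableSet_lt measurable_const (h1.sub_const F).abs
  refine (prod_real_le μ μ hmeas hm1 (c := η) fun ω hω => ?_).trans ?_
  · rw [Set.mem_union, not_or] at hω
    obtain ⟨w1, w2⟩ := hω
    change ¬ (_ : ℝ) < _ at w1
    change ¬ (_ : ℝ) < _ at w2
    have w1 := (abs_le.1 (not_lt.1 w1)).1
    have w2 := (abs_le.1 (not_lt.1 w2)).2
    rw [← est_dat_smul ω x L (by positivity)] at w1 w2
    have g1 : 4⁻¹ ^ p * (F / u - 1) ≤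
        ∑ i, gain p (Finset.Icc 1 l1) (Finset.Ioc l1 l2) L cut (((2 : ℝ) ^ j)⁻¹ * x i) := by
      have hlt : ∀ i, |((2 : ℝ) ^ j)⁻¹ * x i| < 2 ^ (L + 2) := fun i => by
        have h1 := Finset.single_le_sum (f := fun i => |((2 : ℝ) ^ j)⁻¹ * x i| ^ p)
          (fun i _ => by positivity) (Finset.mem_univ i)
        rw [hlo] at h1
        refine (rpow_lt_rpow_iff (abs_nonneg _) (by positivity) hp0).1 ((h1.trans hloF).trans_lt ?_)
        rw [← two_rpow_pow, pow_succ _ (L + 1), mul_comm (2 ^ p) k]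
        gcongr
      refine le_trans ?_ (Finset.sum_le_sum fun i _ => le_gain_cut hp h12 (hlt i))
      rw [← Finset.mul_sum, Finset.sum_sub_distrib, hlo, Finset.sum_const, Finset.card_univ,
        nsmul_eq_mul]
      gcongr
    have g2 : ∑ i, gain p (Finset.Icc 1 l1) (Finset.Ioc l1 l2) L cut (((2 : ℝ) ^ (j + 6))⁻¹ * x i) ≤
        3 * (F / (u * 64 ^ p)) := by
      refine (Finset.sum_le_sum fun i _ => gain_cut_le hp h12 L _).trans ?_
      rw [← Finset.mul_sum, hhi]
    have hFu : k ≤ F / u := by rw [le_div_iff₀ hu0]; linarith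
    have c1 : b ≤ est (fun _ => cut) p L ((2 : ℝ) ^ j)⁻¹ (dat ω x) := by
      have : 4⁻¹ ^ p * (k / 2) ≤ 4⁻¹ ^ p * (F / u - 1) := by
        gcongr; linarith
      have : 0 < 4⁻¹ ^ p * k := by positivity
      rw [hb]; linarith
    have c2 : est (fun _ => cut) p L ((2 : ℝ) ^ (j + 6))⁻¹ (dat ω x) < b := by
      have : (2 ^ p)⁻¹ ^ 5 * k ≤ 4⁻¹ ^ p / 64 * k := by gcongr
      have : 0 < 4⁻¹ ^ p * k := by positivity
      rw [hb]; linarith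
    obtain ⟨t1, t2⟩ := dyadicScale_mem c1 c2
    obtain ⟨hτ0, hτ1, hτ2⟩ := scale_bounds hp0 hk0 hj1' hj2' t1 t2
    have r3 := est_accurate hp h12 hk0 hkL hl2 he1 he hF x hτ0 hFdef hτ1 hτ2
    refine le_trans (measureReal_mono ?_ (measure_ne_top _ _)) r3
    intro ω' hω'
    exact hω'
  · have := measureReal_union_le (μ := μ) B1 B2
    rw [max_eq_left hη]
    linarith

end

section sketchable
variable {Ω Ω' Y Y' : Type*} [MeasurableSpace Ω] [MeasurableSpace Ω'] [MeasurableSpace Y]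
  [MeasurableSpace Y'] {n r r' : ℕ}

/-- `Q ω x` can be recovered from a random matrix with `r` rows and its product with `x`. -/
def Sketchable (r : ℕ) (Q : Ω → (Fin n → ℝ) → Y) : Prop :=
  ∃ (S : Ω → Fin r → Fin n → ℝ) (f : (Fin r → Fin n → ℝ) × (Fin r → ℝ) → Y),
    Measurable S ∧ Measurable f ∧ ∀ ω x, f (S ω, fun k => ∑ i, S ω k i * x i) = Q ω x

lemma Sketchable.of_fintype {ι : Type} [Fintype ι] {Q : Ω → (Fin n → ℝ) → Y}
    (S : Ω → ι → Fin n → ℝ) (f : (ι → Fin n → ℝ) × (ι → ℝ) → Y) (hS : Measurable S)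
    (hf : Measurable f) (h : ∀ ω x, f (S ω, fun k => ∑ i, S ω k i * x i) = Q ω x) :
    Sketchable (Fintype.card ι) Q := by
  let e := Fintype.equivFin ι
  refine ⟨fun ω k => S ω (e.symm k), fun q => f (fun k => q.1 (e k), fun k => q.2 (e k)), ?_, ?_, ?_⟩
  · exact measurable_pi_iff.2 fun k => (measurable_pi_apply _).comp hS
  · refine hf.comp (Measurable.prodMk (measurable_pi_iff.2 fun k => ?_) (measurable_pi_iff.2 fun k => ?_))
    · exact (measurable_pi_apply _).comp measurable_fst
    · exact (measurable_pi_apply _).comp measurable_snd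
  · intro ω x
    simp only [Equiv.symm_apply_apply]
    exact h ω x

lemma Sketchable.comp {Q : Ω → (Fin n → ℝ) → Y} (h : Sketchable r Q) {g : Ω' → Ω}
    (hg : Measurable g) : Sketchable r fun ω => Q (g ω) := by
  obtain ⟨S, f, hS, hf, h⟩ := h
  exact ⟨fun ω => S (g ω), f, hS.comp hg, hf, fun ω => h (g ω)⟩

lemma Sketchable.map {Q : Ω → (Fin n → ℝ) → Y} (h : Sketchable r Q) {g : Y → Y'}
    (hg : Measurable g) : Sketchable r fun ω x => g (Q ω x) := by
  obtain ⟨S, f, hS, hf, h⟩ := h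
  exact ⟨S, fun q => g (f q), hS, hg.comp hf, fun ω x => congrArg g (h ω x)⟩

lemma Sketchable.pi {κ : Type} [Fintype κ] {Q : κ → Ω → (Fin n → ℝ) → Y}
    (h : ∀ t, Sketchable r (Q t)) : Sketchable (Fintype.card κ * r) fun ω x t => Q t ω x := by
  choose S f hS hf h using h
  have := Sketchable.of_fintype (ι := κ × Fin r) (Q := fun ω x t => Q t ω x)
    (fun ω k => S k.1 ω k.2)
    (fun q t => f t (fun k => q.1 (t, k), fun k => q.2 (t, k))) ?_ ?_ fun ω x => funext fun t => h t ω x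
  · rwa [Fintype.card_prod, Fintype.card_fin] at this
  · exact measurable_pi_iff.2 fun k => (measurable_pi_apply _).comp (hS k.1)
  · refine measurable_pi_iff.2 fun t => (hf t).comp (Measurable.prodMk
      (measurable_pi_iff.2 fun k => ?_) (measurable_pi_iff.2 fun k => ?_))
    · exact (measurable_pi_apply _).comp measurable_fst
    · exact (measurable_pi_apply _).comp measurable_snd

lemma Sketchable.prodMk {Q : Ω → (Fin n → ℝ) → Y} {Q' : Ω → (Fin n → ℝ) → Y'}
    (h : Sketchable r Q) (h' : Sketchable r' Q') :
    Sketchable (r + r') fun ω x => (Q ω x, Q' ω x) := by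
  obtain ⟨S, f, hS, hf, h⟩ := h
  obtain ⟨S', f', hS', hf', h'⟩ := h'
  have := Sketchable.of_fintype (ι := Fin r ⊕ Fin r') (Q := fun ω x => (Q ω x, Q' ω x))
    (fun ω k => Sum.elim (S ω) (S' ω) k)
    (fun q => (f (fun k => q.1 (.inl k), fun k => q.2 (.inl k)),
      f' (fun k => q.1 (.inr k), fun k => q.2 (.inr k)))) ?_ ?_ fun ω x => Prod.ext (h ω x) (h' ω x)
  · rwa [Fintype.card_sum, Fintype.card_fin, Fintype.card_fin] at this
  · refine measurable_pi_iff.2 fun k => ?_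
    cases k with
    | inl k => exact (measurable_pi_apply k).comp hS
    | inr k => exact (measurable_pi_apply k).comp hS'
  · refine Measurable.prodMk (hf.comp (Measurable.prodMk (measurable_pi_iff.2 fun k => ?_)
      (measurable_pi_iff.2 fun k => ?_))) (hf'.comp (Measurable.prodMk
      (measurable_pi_iff.2 fun k => ?_) (measurable_pi_iff.2 fun k => ?_)))
    · exact (measurable_pi_apply _).comp measurable_fst
    · exact (measurable_pi_apply _).comp measurable_snd
    · exact (measurable_pi_apply _).comp measurable_fst
    · exact (measurable_pi_apply _).comp measurable_snd

lemma sketchable_sample_base (m : ℕ) :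
    Sketchable (m + m) fun (ω : (Fin n → ℝ) × (Fin m × Fin n → ℝ)) x =>
      base ω.2 fun i => ω.1 i * x i := by
  have := Sketchable.of_fintype (ι := Fin m ⊕ Fin m)
    (Q := fun (ω : (Fin n → ℝ) × (Fin m × Fin n → ℝ)) x => base ω.2 fun i => ω.1 i * x i)
    (fun ω k => Sum.elim (fun r i => ω.2 (r, i) * ω.1 i) (fun r i => ω.2 (r, i)) k)
    (fun q => (nrm (fun r : Fin m => q.2 (.inl r)) / m,
      fun i => (∑ r : Fin m, q.1 (.inr r) i * q.2 (.inl r)) / m)) ?_ ?_ ?_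
  · rwa [Fintype.card_sum, Fintype.card_fin] at this
  · refine measurable_pi_iff.2 fun k => measurable_pi_iff.2 fun i => ?_
    cases k with
    | inl r =>
      have h1 : Measurable fun ω : (Fin n → ℝ) × (Fin m × Fin n → ℝ) => ω.2 (r, i) :=
        (measurable_pi_apply _).comp measurable_snd
      have h2 : Measurable fun ω : (Fin n → ℝ) × (Fin m × Fin n → ℝ) => ω.1 i :=
        (measurable_pi_apply _).comp measurable_fst
      exact h1.mul h2
    | inr r => exact (measurable_pi_apply _).comp measurable_snd
  · have h1 : ∀ r : Fin m, Measurable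
        fun q : (Fin m ⊕ Fin m → Fin n → ℝ) × (Fin m ⊕ Fin m → ℝ) => q.2 (.inl r) :=
      fun r => (measurable_pi_apply _).comp measurable_snd
    have h2 : ∀ (r : Fin m) (i : Fin n), Measurable
        fun q : (Fin m ⊕ Fin m → Fin n → ℝ) × (Fin m ⊕ Fin m → ℝ) => q.1 (.inr r) i :=
      fun r i => (measurable_pi_apply i).comp ((measurable_pi_apply _).comp measurable_fst)
    exact ((measurable_nrm.comp (measurable_pi_iff.2 h1)).div_const _).prodMk
      (measurable_pi_iff.2 fun i => (Finset.measurable_sum _ fun r _ =>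
        (h2 r i).mul (h1 r)).div_const _)
  · intro ω x
    simp only [Sum.elim_inl, Sum.elim_inr, mul_assoc]
    rfl

lemma sketchable_dat {κ : Type} [Fintype κ] (m mT : ℕ) :
    Sketchable ((m + m) + ((m + m) + Fintype.card κ * (mT + mT)))
      fun (ω : Seed m mT κ (Fin n)) x => dat ω x := by
  have h1 := (sketchable_sample_base (n := n) m).comp
    (g := fun ω : Seed m mT κ (Fin n) => ((fun _ => 1 : Fin n → ℝ), ω.1))
    (measurable_const.prodMk measurable_fst)
  have h2 := (sketchable_sample_base (n := n) m).comp
    (g := fun ω : Seed m mT κ (Fin n) => ω.2.1) (measurable_fst.comp measurable_snd)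
  have h3 := Sketchable.pi fun t : κ => (sketchable_sample_base (n := n) mT).comp
    (g := fun ω : Seed m mT κ (Fin n) => ω.2.2 t)
    ((measurable_pi_apply t).comp (measurable_snd.comp measurable_snd))
  have := h1.prodMk (h2.prodMk h3)
  simp only [one_mul] at this
  exact this

lemma sketchable_twoStage {κ : Type} [Fintype κ] [Nonempty κ] (m mT : ℕ) {p : ℝ}
    {h : ℝ → ℝ → ℝ} (hh : Measurable fun q : ℝ × ℝ => h q.1 q.2) (L : ℕ) (b : ℝ) :
    Sketchable (2 * ((m + m) + ((m + m) + Fintype.card κ * (mT + mT))))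
      fun (ω : Seed m mT κ (Fin n) × Seed m mT κ (Fin n)) x =>
        twoStage h p L b (dat ω.1 x, dat ω.2 x) := by
  have h0 := sketchable_dat (n := n) (κ := κ) m mT
  have h1 := h0.comp (g := fun ω : Seed m mT κ (Fin n) × Seed m mT κ (Fin n) => ω.1) measurable_fst
  have h2 := h0.comp (g := fun ω : Seed m mT κ (Fin n) × Seed m mT κ (Fin n) => ω.2) measurable_snd
  rw [two_mul]
  exact (h1.prodMk h2).map (measurable_twoStage hh L b)

/-- A sketchable and accurate random quantity gives a sketching scheme. -/
lemma Sketchable.exists_scheme {Q : Ω → (Fin n → ℝ) → ℝ} (h : Sketchable r Q) (μ : Measure Ω)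
    [IsProbabilityMeasure μ] {p ε δ : ℝ}
    (hQ : ∀ x, μ.real {ω | ε * Fp p x < |Q ω x - Fp p x|} ≤ δ) :
    ∃ (ρ : Measure (Fin r → Fin n → ℝ)) (f : (Fin r → Fin n → ℝ) → (Fin r → ℝ) → ℝ),
      IsSketchingScheme p n r ε δ ρ f := by
  obtain ⟨S, f, hS, hf, h⟩ := h
  refine ⟨μ.map S, fun A y => f (A, y), Measure.isProbabilityMeasure_map hS.aemeasurable, hf,
    fun x => ?_⟩
  have hl : Measurable fun A : Fin r → Fin n → ℝ => (A, fun k => ∑ i, A k i * x i) :=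
    measurable_id.prodMk (measurable_pi_iff.2 fun k => Finset.measurable_sum _ fun i _ =>
      ((measurable_pi_apply i).comp (measurable_pi_apply k)).mul_const _)
  have hm : MeasurableSet {A : Fin r → Fin n → ℝ |
      |f (A, fun k => ∑ i, A k i * x i) - Fp p x| ≤ ε * Fp p x} :=
    measurableSet_le ((hf.comp hl).sub_const _).abs measurable_const
  rw [Measure.map_apply hS hm]
  have hQm : MeasurableSet {ω | ε * Fp p x < |Q ω x - Fp p x|} := by
    have : Measurable fun ω => Q ω x := by
      rw [← funext fun ω => h ω x]
      exact hf.comp (hl.comp hS)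
    exact measurableSet_lt measurable_const (this.sub_const _).abs
  have hc : S ⁻¹' {A | |f (A, fun k => ∑ i, A k i * x i) - Fp p x| ≤ ε * Fp p x} =
      {ω | ε * Fp p x < |Q ω x - Fp p x|}ᶜ := by
    ext ω
    change |f (S ω, fun k => ∑ i, S ω k i * x i) - Fp p x| ≤ ε * Fp p x ↔
      ¬ ε * Fp p x < |Q ω x - Fp p x|
    rw [h, not_lt]
  rw [hc, ← ENNReal.ofReal_toReal (measure_ne_top μ _)]
  refine ENNReal.ofReal_le_ofReal ?_
  have := probReal_compl_eq_one_sub (μ := μ) hQm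
  rw [measureReal_def] at this
  rw [this]
  linarith [hQ x]

lemma exists_scheme_self (p : ℝ) (n : ℕ) {ε δ : ℝ} (hε : 0 ≤ ε) (hδ : 0 ≤ δ) :
    ∃ (ρ : Measure (Fin n → Fin n → ℝ)) (f : (Fin n → Fin n → ℝ) → (Fin n → ℝ) → ℝ),
      IsSketchingScheme p n n ε δ ρ f := by
  have h : Sketchable n fun (_ : Unit) (x : Fin n → ℝ) => Fp p x := by
    refine ⟨fun _ k i => if k = i then 1 else 0, fun q => Fp p q.2, measurable_const, ?_, fun _ x => ?_⟩
    · unfold Fp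
      fun_prop
    · simp
  refine h.exists_scheme (Measure.dirac ()) fun x => ?_
  have h0 : 0 ≤ Fp p x := Finset.sum_nonneg fun i _ => by positivity
  have : {ω : Unit | ε * Fp p x < |Fp p x - Fp p x|} = ∅ := by
    refine Set.eq_empty_of_forall_notMem fun ω hω => ?_
    change (_ : ℝ) < _ at hω
    rw [sub_self, abs_zero] at hω
    exact absurd hω (not_lt.2 (by positivity))
  rw [this, measureReal_empty]
  exact hδ

end sketchable

lemma sum_sq_le_rpow {n : ℕ} {p : ℝ} (hp : 2 < p) (x : Fin n → ℝ) {S : ℝ}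
    (h : ∑ i, |x i| ^ p ≤ S) : ∑ i, x i ^ 2 ≤ (n : ℝ) ^ (1 - 2 / p) * S ^ (2 / p) := by
  have hp0 : 0 < p := by linarith
  have hS : 0 ≤ S := le_trans (Finset.sum_nonneg fun i _ => by positivity) h
  have h1 := rpow_sum_le_const_mul_sum_rpow_of_nonneg (s := Finset.univ) (f := fun i => x i ^ 2)
    (p := p / 2) (by linarith) fun i _ => sq_nonneg (x i)
  have e1 : ∀ i, (x i ^ 2) ^ (p / 2) = |x i| ^ p := fun i => by
    rw [← sq_abs, ← rpow_natCast, ← rpow_mul (abs_nonneg _)]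
    congr 1
    push_cast
    ring
  simp only [e1, Finset.card_univ, Fintype.card_fin] at h1
  have h2 : (∑ i, x i ^ 2) ^ (p / 2) ≤ (n : ℝ) ^ (p / 2 - 1) * S := h1.trans (by gcongr)
  have h3 := rpow_le_rpow (by positivity) h2 (show 0 ≤ 2 / p by positivity)
  rw [← rpow_mul (by positivity), mul_rpow (by positivity) hS, ← rpow_mul (by positivity)] at h3
  have e2 : p / 2 * (2 / p) = 1 := by field_simp
  have e3 : (p / 2 - 1) * (2 / p) = 1 - 2 / p := by field_simp
  rwa [e2, e3, rpow_one] at h3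

/-- The relations between the parameters that make the estimators concentrate. -/
structure Params (p w Λ B k q : ℝ) (n m mT l1 L T : ℕ) : Prop where
  hw : 1 < w
  hwp : (2 : ℝ) ^ p = 4 * w ^ 4
  hk : 0 < k
  hq0 : 0 < q
  hq1 : q ≤ 1
  hn0 : 0 < n
  hn : n * exp (-(1 / (64 * q ^ 2))) ≤ 1
  hqw : q ^ 2 * w ^ (4 * L) ≤ 1
  hB : 0 ≤ B
  hΛ0 : 0 ≤ Λ
  hm : 32 * (1 / (1 - (w ^ 4)⁻¹) + 2 * B) * ((n : ℝ) ^ (1 - 2 / p) * k ^ (2 / p)) ≤ q ^ 2 * m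
  hmT : 1024 * (1 / (1 - (w ^ 4)⁻¹)) * ((n : ℝ) ^ (1 - 2 / p) * k ^ (2 / p)) / (w ^ 4) ^ l1 ≤
    q ^ 2 * mT
  hmN : 4 * (2 ^ p) ^ 2 * k * w ^ (2 * L) ≤ m
  hmTN : 4 * (2 ^ p) ^ 2 * k ≤ mT
  hΛ : Λ * 4 ^ l1 ≤ 4 * (n : ℝ) ^ (1 - 2 / p)
  hT : 2 * (B * Λ) ≤ T
  one_le : 1 ≤ B * Λ
  small : 18 * exp (-(B * Λ)) ≤ 1 / 64

lemma Params.conc {p w Λ B k q : ℝ} {n m mT l1 l2 L T : ℕ} (H : Params p w Λ B k q n m mT l1 L T)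
    (hp : 2 < p) {h : ℝ → ℝ → ℝ} {ψ : ℝ → ℝ} {C t : ℝ} {J : ℕ} (hh : Estimates h ψ C J)
    [NeZero T] (ht : 0 < t) (ht1 : t ≤ 1) (hqt : q ^ J ≤ t / w ^ L)
    (hX : B * Λ ≤ t ^ 2 * (4 * (2 ^ p) ^ 2 * k) / (2048 * C ^ 2)) (x : Fin n → ℝ)
    (hx : ∑ i, |x i| ^ p ≤ 2 ^ p * k) :
    (seedLaw p (Finset.Icc 1 l1) (Finset.Ioc l1 l2) m mT (Fin T) (Fin n)).real
      {ω | (4 * (1 / (1 - w⁻¹)) + 10) * C * t * (4 * (2 ^ p) ^ 2 * k) <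
        |est h p L 1 (dat ω x) -
          ∑ i, gain p (Finset.Icc 1 l1) (Finset.Ioc l1 l2) L ψ (x i)|} ≤
      (15 * (1 / (1 - exp (-(w ^ 2 - 1)))) + 20) * exp (-(B * Λ)) := by
  obtain ⟨hw, hwp, hk, hq0, hq1, hn0, hn, hqw, hB, hΛ0, hm, hmT, hmN, hmTN, hΛ, hT, one_le, small⟩ := H
  have hp0 : 0 < p := by linarith
  have hnR : (0 : ℝ) < n := by exact_mod_cast hn0
  set R := (n : ℝ) ^ (1 - 2 / p) * k ^ (2 / p) with hR
  have hR0 : 0 < R := by positivity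
  set D := 1 / (1 - (w ^ 4)⁻¹) with hD
  have hw4 : 1 < w ^ 4 := one_lt_pow₀ hw (by norm_num)
  have hD0 : 1 ≤ D := by
    have h1 : (w ^ 4)⁻¹ < 1 := inv_lt_one_of_one_lt₀ hw4
    have h2 : 0 < (w ^ 4)⁻¹ := by positivity
    rw [hD, le_div_iff₀ (by linarith)]
    linarith
  have h2p : ((2 : ℝ) ^ p * k) ^ (2 / p) = 4 * k ^ (2 / p) := by
    rw [mul_rpow (by positivity) hk.le, ← rpow_mul (by norm_num), mul_div_cancel₀ _ hp0.ne',
      rpow_two]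
    norm_num
  have hE2 : ∑ i, x i ^ 2 ≤ 4 * R := by
    refine (sum_sq_le_rpow hp x hx).trans_eq ?_
    rw [h2p, hR]
    ring
  have hmpos : 0 < m := by
    have : (0 : ℝ) < m := lt_of_lt_of_le (by positivity) hmN
    exact_mod_cast this
  have hmTpos : 0 < mT := by
    have : (0 : ℝ) < mT := lt_of_lt_of_le (by positivity) hmTN
    exact_mod_cast this
  have hsqrt : ∀ (a : ℝ) (M : ℕ), 4 * a ≤ q ^ 2 * M → 2 * √a ≤ q * √M := fun a M h => by
    have e1 : 2 * √a = √(4 * a) := by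
      rw [sqrt_mul (by norm_num), show (4 : ℝ) = 2 ^ 2 by norm_num, sqrt_sq (by norm_num)]
    have e2 : q * √M = √(q ^ 2 * M) := by rw [sqrt_mul (by positivity), sqrt_sq hq0.le]
    rw [e1, e2]
    exact sqrt_le_sqrt h
  have hI : ∀ l ∈ Finset.Icc 1 l1, 1 ≤ l := fun l hl => (Finset.mem_Icc.1 hl).1
  have hI' : ∀ l ∈ Finset.Ioc l1 l2, 1 ≤ l := fun l hl => by
    have := (Finset.mem_Ioc.1 hl).1
    omega
  set X := t ^ 2 * (4 * (2 ^ p) ^ 2 * k) / (2048 * C ^ 2) with hXd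
  have hXe : exp (-X) ≤ exp (-(B * Λ)) := exp_le_exp.2 (by linarith)
  -- energy of the moderately sampled levels
  have hE : (Measure.pi fun _ : Fin n => samp p (Finset.Icc 1 l1)).real
      {v | (8 * D + 16 * B) * R ≤ ∑ i, (v i * x i) ^ 2} ≤ exp (-(B * Λ)) := by
    have h4 : (0 : ℝ) < 4 ^ l1 := by positivity
    have hc := samp_energy_chernoff hp hI x (a := (8 * D + 16 * B) * R)
      (θ := (4 ^ l1 * (4 * k ^ (2 / p)))⁻¹) (by positivity) (fun l hl i => by
        rw [inv_mul_le_iff₀ (by positivity), mul_one, mul_pow, ← pow_mul, mul_comm l 2, pow_mul]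
        have h5 : (2 ^ 2 : ℝ) ^ l ≤ 4 ^ l1 := by
          norm_num
          exact pow_le_pow_right₀ (by norm_num) (Finset.mem_Icc.1 hl).2
        have h6 : x i ^ 2 ≤ 4 * k ^ (2 / p) := by
          rw [← h2p, ← sq_abs]
          have := Finset.single_le_sum (f := fun i => |x i| ^ p) (fun i _ => by positivity)
            (Finset.mem_univ i)
          have := rpow_le_rpow (by positivity) (this.trans hx) (show 0 ≤ 2 / p by positivity)
          rwa [← rpow_mul (abs_nonneg _), mul_div_cancel₀ _ hp0.ne', rpow_two] at this
        gcongr)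
    refine hc.trans (exp_le_exp.2 ?_)
    have h7 : 2 * sampSq p (Finset.Icc 1 l1) * ∑ i, x i ^ 2 ≤ 2 * D * (4 * R) := by
      have := sampSq_Icc_le hw hwp l1
      gcongr
    calc _ ≤ (4 ^ l1 * (4 * k ^ (2 / p)))⁻¹ * (-(16 * B * R)) := by
          gcongr
          linarith
      _ = -(B * (4 * (n : ℝ) ^ (1 - 2 / p) / 4 ^ l1)) := by
          rw [hR]
          field_simp
          norm_num
      _ ≤ -(B * Λ) := by
          have : Λ ≤ 4 * (n : ℝ) ^ (1 - 2 / p) / 4 ^ l1 := by rwa [le_div_iff₀ h4]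
          have := mul_le_mul_of_nonneg_left this hB
          linarith
  -- energy of the deeply sampled levels
  have hE' : (Measure.pi fun _ : Fin n => samp p (Finset.Ioc l1 l2)).real
      {v | 256 * D * R / (w ^ 4) ^ l1 ≤ ∑ i, (v i * x i) ^ 2} + 18 * exp (-X) ≤ 1 / 16 := by
    have hc := samp_energy_markov hp hI' x (a := 256 * D * R / (w ^ 4) ^ l1) (by positivity)
    have h7 : sampSq p (Finset.Ioc l1 l2) * ∑ i, x i ^ 2 ≤ D / (w ^ 4) ^ l1 * (4 * R) := by
      have := sampSq_Ioc_le hw hwp l1 l2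
      gcongr
    have h8 : sampSq p (Finset.Ioc l1 l2) * (∑ i, x i ^ 2) / (256 * D * R / (w ^ 4) ^ l1) ≤ 1 / 64 := by
      rw [div_le_iff₀ (by positivity)]
      refine h7.trans_eq ?_
      ring
    linarith
  have := est_conc (κ := Fin T) hp hI hI' hh hmpos hmTpos x (a := (8 * D + 16 * B) * R)
    (a' := 256 * D * R / (w ^ 4) ^ l1) (q := q) (t := t) (w := w) (L := L)
    (N := 4 * (2 ^ p) ^ 2 * k) (E := exp (-(B * Λ))) hw hwp hq1 hq0
    (by rwa [Fintype.card_fin]) ht ht1 hqt (by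
      have : (0 : ℝ) < 2 ^ p := by positivity
      calc _ ≤ 4 * 2 ^ p * (2 ^ p * k) := by gcongr
        _ = _ := by ring)
    (hsqrt _ m (by
      have : 0 ≤ B * R := by positivity
      have : R ≤ D * R := le_mul_of_one_le_left hR0.le hD0
      linarith)) hmN hqw (by linarith) (hsqrt _ m (by linarith))
    (hsqrt _ mT (by
      refine le_trans (le_of_eq ?_) hmT
      ring)) hmTN hE hE'
  refine this.trans ?_
  have hTe : exp (-((Fintype.card (Fin T) : ℝ) / 2)) ≤ exp (-(B * Λ)) := by
    rw [Fintype.card_fin]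
    exact exp_le_exp.2 (by linarith)
  have hA : 0 ≤ 15 * (1 / (1 - exp (-(w ^ 2 - 1)))) + 18 := by
    have : exp (-(w ^ 2 - 1)) < 1 := exp_lt_one_iff.2 (by nlinarith)
    have : 0 ≤ 1 / (1 - exp (-(w ^ 2 - 1))) := div_nonneg zero_le_one (by linarith)
    linarith
  have := mul_le_mul_of_nonneg_left hXe hA
  linarith

lemma pow_le_rpow_of_rate {p w k : ℝ} (hp : 2 < p) (hwp : (2 : ℝ) ^ p = 4 * w ^ 4) {L : ℕ}
    (hL : ((2 : ℝ) ^ p) ^ L ≤ k) : w ^ (4 * L) ≤ k ^ (1 - 2 / p) := by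
  have hp0 : 0 < p := by linarith
  have e : w ^ (4 * L) = (((2 : ℝ) ^ p) ^ L) ^ (1 - 2 / p) := by
    have h1 : ((2 : ℝ) ^ p) ^ (1 - 2 / p) = w ^ 4 := by
      rw [← rpow_mul (by norm_num), mul_sub, mul_one, mul_div_cancel₀ _ hp0.ne',
        rpow_sub (by norm_num), hwp, rpow_two]
      ring
    rw [← rpow_natCast ((2 : ℝ) ^ p), ← rpow_mul (by positivity), mul_comm (L : ℝ),
      rpow_mul (by positivity), h1, rpow_natCast, ← pow_mul]
  rw [e]
  have : 2 / p ≤ 1 := by rw [div_le_one hp0]; exact hp.le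
  exact rpow_le_rpow (by positivity) hL (by linarith)

/-- The number of moderately sampled levels. -/
lemma exists_depth {p w : ℝ} (hp : 2 < p) (hwp : (2 : ℝ) ^ p = 4 * w ^ 4) {n : ℕ} (hn : 2 ≤ n) :
    ∃ l : ℕ, (n : ℝ) ^ ((1 - 2 / p) ^ 2) ≤ (w ^ 4) ^ l ∧
      (w ^ 4) ^ l ≤ 2 ^ (p - 2) * (n : ℝ) ^ (1 - 2 / p) ∧
      (n : ℝ) ^ ((1 - 2 / p) ^ 2) * 4 ^ l ≤ 4 * (n : ℝ) ^ (1 - 2 / p) := by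
  have hp0 : 0 < p := by linarith
  set s := 1 - 2 / p with hs
  have hs1 : s ≤ 1 := by
    have : 0 < 2 / p := by positivity
    linarith
  have hs0 : 0 < s := by
    have : 2 / p < 1 := by rwa [div_lt_one hp0]
    linarith
  have hps : p * s = p - 2 := by rw [hs]; field_simp
  have hn1 : (1 : ℝ) ≤ n := by exact_mod_cast (by omega : 1 ≤ n)
  have hn0 : (0 : ℝ) < n := by linarith
  obtain ⟨j, hj1, hj2⟩ := exists_nat_pow_near (show 1 ≤ (n : ℝ) ^ (s / p) from
    one_le_rpow hn1 (by positivity)) (show (1 : ℝ) < 2 by norm_num)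
  set W := (w ^ 4) ^ (j + 1) with hW
  have hWe : W = ((2 : ℝ) ^ (j + 1)) ^ (p - 2) := by
    have : w ^ 4 = 2 ^ (p - 2) := by
      rw [rpow_sub (by norm_num), hwp, rpow_two]
      ring
    rw [hW, this, two_rpow_pow]
  have hnc : ((n : ℝ) ^ (s / p)) ^ (p - 2) = (n : ℝ) ^ (s ^ 2) := by
    rw [← rpow_mul hn0.le, ← hps]
    congr 1
    field_simp
  have hW1 : (n : ℝ) ^ (s ^ 2) ≤ W := by
    rw [← hnc, hWe]
    exact rpow_le_rpow (by positivity) hj2.le (by linarith)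
  have hss : s ^ 2 ≤ s := by nlinarith
  have hcs : (n : ℝ) ^ (s ^ 2) ≤ (n : ℝ) ^ s := rpow_le_rpow_of_exponent_le hn1 hss
  have hW2 : W ≤ 2 ^ (p - 2) * (n : ℝ) ^ s := by
    have : W ≤ (2 * (n : ℝ) ^ (s / p)) ^ (p - 2) := by
      rw [hWe]
      refine rpow_le_rpow (by positivity) ?_ (by linarith)
      rw [pow_succ]
      linarith
    rw [mul_rpow (by norm_num) (by positivity), hnc] at this
    exact this.trans (by gcongr)
  refine ⟨j + 1, hW1, hW2, ?_⟩
  have h1 : (4 : ℝ) ^ (j + 1) ≤ 4 * ((n : ℝ) ^ (s / p)) ^ (2 : ℝ) := by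
    have : (2 : ℝ) ^ (j + 1) ≤ 2 * (n : ℝ) ^ (s / p) := by rw [pow_succ]; linarith
    have := pow_le_pow_left₀ (by positivity) this 2
    rw [rpow_two]
    calc (4 : ℝ) ^ (j + 1) = ((2 : ℝ) ^ (j + 1)) ^ 2 := by
          rw [← pow_mul, mul_comm, pow_mul]
          norm_num
      _ ≤ _ := this
      _ = _ := by ring
  calc _ ≤ (n : ℝ) ^ (s ^ 2) * (4 * ((n : ℝ) ^ (s / p)) ^ (2 : ℝ)) := by gcongr
    _ = 4 * (n : ℝ) ^ s := by
      rw [← rpow_mul hn0.le, mul_left_comm, ← rpow_add hn0]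
      congr 2
      have : s / p * 2 = s - s ^ 2 := by
        rw [eq_sub_iff_add_eq]
        field_simp
        linarith
      linarith

set_option maxHeartbeats 1000000 in
/-- All parameters of the sketch can be chosen within the claimed dimension. -/
lemma exists_params {p w B c₃ C₁ : ℝ} (hp : 2 < p) (hw : 1 < w) (hwp : (2 : ℝ) ^ p = 4 * w ^ 4)
    (hB : 8 ≤ B) (hB' : 18 * exp (-(B / 8)) ≤ 1 / 64) (hc : 0 < c₃) (hc' : c₃ ≤ 1 / 64)
    (hC₁ : 1 ≤ C₁) :
    ∃ C, 0 < C ∧ ∀ (n : ℕ) (Λ k : ℝ), 2 ≤ n → 1 / 8 ≤ Λ → Λ ≤ (n : ℝ) ^ ((1 - 2 / p) ^ 2) →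
      1 ≤ k → k ≤ C₁ * n → ∃ (q : ℝ) (m mT l1 L T : ℕ), Params p w Λ B k q n m mT l1 L T ∧
        T ≠ 0 ∧ ((2 : ℝ) ^ p) ^ L ≤ k ∧ k < ((2 : ℝ) ^ p) ^ (L + 1) ∧
        q ^ 2 * k ^ (1 - 2 / p) ≤ c₃ ∧
        ((2 * ((m + m) + ((m + m) + T * (mT + mT))) : ℕ) : ℝ) ≤
          C * ((n : ℝ) ^ (1 - 2 / p) * (k + k ^ (2 / p) * log n)) := by
  have hp0 : 0 < p := by linarith
  set s := 1 - 2 / p with hs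
  have hs1 : s ≤ 1 := by
    have : 0 < 2 / p := by positivity
    linarith
  have hs0 : 0 < s := by
    have : 2 / p < 1 := by rwa [div_lt_one hp0]
    linarith
  have hps : p * s = p - 2 := by rw [hs]; field_simp
  set D := 1 / (1 - (w ^ 4)⁻¹) with hD
  have hw4 : 1 < w ^ 4 := one_lt_pow₀ hw (by norm_num)
  have hD0 : 0 < D := by
    have h1 : (w ^ 4)⁻¹ < 1 := inv_lt_one_of_one_lt₀ hw4
    exact one_div_pos.2 (by linarith)
  set M := (1024 * D + 64 * B) / c₃ + 4 * (2 ^ p) ^ 2 * C₁ + 4 * (2 ^ p) ^ 2 * 2 ^ (p - 2) with hM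
  have hM1 : 1024 * D + 64 * B ≤ M * c₃ := by
    have : (1024 * D + 64 * B) / c₃ ≤ M := by
      have : 0 ≤ 4 * (2 ^ p) ^ 2 * C₁ + 4 * (2 ^ p) ^ 2 * 2 ^ (p - 2) := by positivity
      linarith
    rwa [div_le_iff₀ hc] at this
  have hM0' : 0 ≤ (1024 * D + 64 * B) / c₃ := by positivity
  have hM2 : 4 * (2 ^ p) ^ 2 * C₁ ≤ M := by
    have : 0 ≤ 4 * ((2 : ℝ) ^ p) ^ 2 * 2 ^ (p - 2) := by positivity
    linarith
  have hM3 : 4 * (2 ^ p) ^ 2 * 2 ^ (p - 2) ≤ M := by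
    have : 0 ≤ 4 * ((2 : ℝ) ^ p) ^ 2 * C₁ := by positivity
    linarith
  have hM0 : 0 < M := lt_of_lt_of_le (by positivity) hM2
  refine ⟨(8 + 4 * (2 * B + 8)) * (M + 1), by positivity, fun n Λ k hn hΛ hΛn hk hkn => ?_⟩
  have hn1 : (1 : ℝ) ≤ n := by exact_mod_cast (by omega : 1 ≤ n)
  have hn0 : (0 : ℝ) < n := by linarith
  have hk0 : 0 < k := by linarith
  have hlog : 0 ≤ log n := log_nonneg hn1
  have hks : 1 ≤ k ^ s := one_le_rpow hk hs0.le
  have hns : 1 ≤ (n : ℝ) ^ s := one_le_rpow hn1 hs0.le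
  set G := k ^ s + log n with hG
  have hG1 : 1 ≤ G := by linarith
  set R := (n : ℝ) ^ s * k ^ (2 / p) with hR
  set Q := (n : ℝ) ^ s * (k + k ^ (2 / p) * log n) with hQ
  have hkk : k ^ (2 / p) * k ^ s = k := by
    rw [← rpow_add hk0, hs, add_sub_cancel, rpow_one]
  have hQR : Q = R * G := by
    rw [hQ, hR, hG, mul_add (_ * _), mul_assoc, hkk]
    ring
  have hQk : (n : ℝ) ^ s * k ≤ Q := by
    rw [hQ]
    gcongr
    have : 0 ≤ k ^ (2 / p) * log n := by positivity
    linarith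
  have hQn : (n : ℝ) ^ s ≤ Q := (le_mul_of_one_le_right (by positivity) hk).trans hQk
  have hQ1 : 1 ≤ Q := hns.trans hQn
  obtain ⟨L, hL1, hL2⟩ := exists_nat_pow_near hk (show (1 : ℝ) < 2 ^ p by
    linarith [four_le_two_rpow hp])
  obtain ⟨l1, hW1, hW2, hl4⟩ := exists_depth hp hwp hn
  set W := (w ^ 4) ^ l1 with hW
  have hcs : (n : ℝ) ^ (s ^ 2) ≤ (n : ℝ) ^ s := rpow_le_rpow_of_exponent_le hn1 (by nlinarith)
  have hW0 : 0 < W := by positivity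
  set q := √(c₃ / G) with hq
  have hq2 : q ^ 2 = c₃ / G := sq_sqrt (by positivity)
  have hqG : q ^ 2 * G = c₃ := by rw [hq2]; field_simp
  have hqQ : q ^ 2 * Q = c₃ * R := by rw [hQR, ← hqG]; ring
  have hqMQ : q ^ 2 * (M * Q) = M * c₃ * R := by linear_combination M * hqQ
  have hq0 : 0 < q := sqrt_pos.2 (by positivity)
  have hqk : q ^ 2 * k ^ s ≤ c₃ := by
    rw [← hqG]
    gcongr
    linarith
  have hql : q ^ 2 * log n ≤ c₃ := by
    rw [← hqG]
    gcongr
    linarith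
  have hR0 : 0 < R := by positivity
  have hLs := pow_le_rpow_of_rate hp hwp hL1
  have hm := Nat.le_ceil (M * Q)
  have hmT := Nat.le_ceil (M * Q / W)
  have hT := Nat.le_ceil (2 * (B * Λ))
  have hBΛ : B / 8 ≤ B * Λ := by
    have := mul_le_mul_of_nonneg_left hΛ (show 0 ≤ B by linarith)
    linarith
  refine ⟨q, ⌈M * Q⌉₊, ⌈M * Q / W⌉₊, l1, L, ⌈2 * (B * Λ)⌉₊, ?_, ?_, hL1, hL2, hqk, ?_⟩
  · refine ⟨hw, hwp, hk0, hq0, ?_, by omega, ?_, ?_, by linarith, by linarith, ?_, ?_, ?_, ?_, ?_, hT,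
      by linarith, ?_⟩
    · have : q ^ 2 ≤ 1 := by
        have : q ^ 2 * 1 ≤ q ^ 2 * k ^ s := by gcongr
        linarith
      exact (sq_le_one_iff₀ hq0.le).1 this
    · calc (n : ℝ) * exp (-(1 / (64 * q ^ 2))) ≤ n * exp (-log n) := by
            gcongr
            rw [le_div_iff₀ (by positivity)]
            linarith
        _ = 1 := by rw [exp_neg, exp_log hn0, mul_inv_cancel₀ hn0.ne']
    · have : q ^ 2 * w ^ (4 * L) ≤ q ^ 2 * k ^ s := by gcongr
      linarith
    · have h1 : 32 * (D + 2 * B) ≤ M * c₃ := by linarith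
      have h2 := mul_le_mul_of_nonneg_right h1 hR0.le
      have h3 := mul_le_mul_of_nonneg_left hm (sq_nonneg q)
      change 32 * (D + 2 * B) * R ≤ _
      linarith
    · have h1 : 1024 * D ≤ M * c₃ := by linarith
      have h2 := mul_le_mul_of_nonneg_right h1 hR0.le
      have h3 := mul_le_mul_of_nonneg_left hmT (sq_nonneg q)
      change 1024 * D * R / W ≤ _
      refine le_trans ?_ h3
      have h4 : q ^ 2 * (M * Q / W) = q ^ 2 * (M * Q) / W := by ring
      rw [h4]
      exact div_le_div_of_nonneg_right (by linarith) hW0.le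
    · refine le_trans ?_ hm
      have h1 : w ^ (2 * L) ≤ C₁ * (n : ℝ) ^ s := by
        calc w ^ (2 * L) ≤ w ^ (4 * L) := pow_le_pow_right₀ hw.le (by omega)
          _ ≤ k ^ s := hLs
          _ ≤ (C₁ * n) ^ s := rpow_le_rpow hk0.le hkn hs0.le
          _ = C₁ ^ s * (n : ℝ) ^ s := mul_rpow (by linarith) hn0.le
          _ ≤ C₁ ^ (1 : ℝ) * (n : ℝ) ^ s := by
            gcongr
          _ = _ := by rw [rpow_one]
      calc 4 * (2 ^ p) ^ 2 * k * w ^ (2 * L) ≤ 4 * (2 ^ p) ^ 2 * k * (C₁ * (n : ℝ) ^ s) := by gcongr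
        _ = 4 * (2 ^ p) ^ 2 * C₁ * ((n : ℝ) ^ s * k) := by ring
        _ ≤ M * Q := by gcongr
    · refine le_trans ?_ hmT
      rw [le_div_iff₀ hW0]
      calc 4 * (2 ^ p) ^ 2 * k * W ≤ 4 * (2 ^ p) ^ 2 * k * (2 ^ (p - 2) * (n : ℝ) ^ s) := by gcongr
        _ = 4 * (2 ^ p) ^ 2 * 2 ^ (p - 2) * ((n : ℝ) ^ s * k) := by ring
        _ ≤ M * Q := by gcongr
    · exact (mul_le_mul_of_nonneg_right hΛn (by positivity)).trans hl4
    · have : exp (-(B * Λ)) ≤ exp (-(B / 8)) := exp_le_exp.2 (by linarith)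
      linarith
  · have : 0 < ⌈2 * (B * Λ)⌉₊ := Nat.ceil_pos.2 (by positivity)
    omega
  · have hm' := (Nat.ceil_lt_add_one (show 0 ≤ M * Q by positivity)).le
    have hmT' := (Nat.ceil_lt_add_one (show 0 ≤ M * Q / W by positivity)).le
    have hT' := (Nat.ceil_lt_add_one (show 0 ≤ 2 * (B * Λ) by positivity)).le
    push_cast
    have h1 : (⌈2 * (B * Λ)⌉₊ : ℝ) ≤ (2 * B + 8) * Λ := by linarith
    have h2 : (⌈2 * (B * Λ)⌉₊ : ℝ) * ⌈M * Q / W⌉₊ ≤ (2 * B + 8) * ((M + 1) * Q) := by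
      calc _ ≤ (2 * B + 8) * Λ * (M * Q / W + 1) := by gcongr
        _ = (2 * B + 8) * (M * Q * (Λ / W) + Λ) := by ring
        _ ≤ (2 * B + 8) * (M * Q * 1 + Q) := by
          gcongr
          · exact (div_le_one hW0).2 (hΛn.trans hW1)
          · exact hΛn.trans (hcs.trans hQn)
        _ = _ := by ring
    have h3 : (⌈M * Q⌉₊ : ℝ) ≤ (M + 1) * Q := by linarith
    linarith

/-- A sketching scheme obtained from admissible parameters. -/
lemma exists_scheme_of_params {p w Λ B k q : ℝ} {n m mT l1 l2 L T : ℕ}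
    (H : Params p w Λ B k q n m mT l1 L T) (hp : 2 < p) (hT : T ≠ 0) {h : ℝ → ℝ → ℝ}
    {Cf Cc af ε δ t : ℝ} {J : ℕ} (hf : Estimates h (shell p) Cf J)
    (hc : Estimates (fun _ => cut) cut Cc 1) (h12 : l1 ≤ l2) (hl2 : n * (2 / 2 ^ l2 : ℝ) ^ p ≤ 1)
    (hk : 2 ≤ k) (hkL : k < ((2 : ℝ) ^ p) ^ (L + 1))
    (ht : 0 < t) (ht1 : t ≤ 1) (haf : 0 < af * ε) (haf1 : af * ε ≤ 1)
    (hte : (4 * (1 / (1 - w⁻¹)) + 10) * Cc * t * (4 * (2 ^ p) ^ 2) ≤ 4⁻¹ ^ p / 16)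
    (hae : (4 * (1 / (1 - w⁻¹)) + 10) * Cf * (af * ε) * (4 * (2 ^ p) ^ 2) ≤ ε / (2 * 256 ^ p))
    (hek : 1 ≤ ε / (2 * 256 ^ p) * k) (hqt : q ^ 1 ≤ t / w ^ L) (hqf : q ^ J ≤ af * ε / w ^ L)
    (hXt : B * Λ ≤ t ^ 2 * (4 * (2 ^ p) ^ 2 * k) / (2048 * Cc ^ 2))
    (hXf : B * Λ ≤ (af * ε) ^ 2 * (4 * (2 ^ p) ^ 2 * k) / (2048 * Cf ^ 2))
    (hδ : 3 * ((15 * (1 / (1 - exp (-(w^2 - 1)))) + 20) * exp (-(B * Λ))) ≤ δ) :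
    ∃ (ρ : Measure (Fin (2 * ((m + m) + ((m + m) + T * (mT + mT)))) → Fin n → ℝ))
      (f : (Fin (2 * ((m + m) + ((m + m) + T * (mT + mT)))) → Fin n → ℝ) →
        (Fin (2 * ((m + m) + ((m + m) + T * (mT + mT)))) → ℝ) → ℝ),
      IsSketchingScheme p n _ ε δ ρ f := by
  have : NeZero T := ⟨hT⟩
  have hk0 : 0 ≤ k := by linarith
  have hS := sketchable_twoStage (n := n) (κ := Fin T) m mT (p := p) hf.meas L (4⁻¹ ^ p / 4 * k)
  rw [Fintype.card_fin] at hS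
  have hprob := isProbabilityMeasure_seedLaw (κ := Fin T) (ι := Fin n) hp
    (I := Finset.Icc 1 l1) (I' := Finset.Ioc l1 l2) (fun l hl => (Finset.mem_Icc.1 hl).1)
    (fun l hl => by
      have := (Finset.mem_Ioc.1 hl).1
      omega) m mT
  refine hS.exists_scheme ((seedLaw p (Finset.Icc 1 l1) (Finset.Ioc l1 l2) m mT (Fin T)
    (Fin n)).prod (seedLaw p (Finset.Icc 1 l1) (Finset.Ioc l1 l2) m mT (Fin T) (Fin n)))
    fun x => le_trans ?_ hδ
  refine twoStage_accurate hp h12 hf.meas hk hkL (by rwa [Fintype.card_fin]) hek ?_ ?_ ?_ x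
  · have : (256 : ℝ) ^ p ≠ 0 := by positivity
    exact (by field_simp : 2 * 256 ^ p * (ε / (2 * 256 ^ p)) = ε).le
  · refine fun x hx => le_trans (measureReal_mono (fun ω hω => ?_) (measure_ne_top _ _))
      (H.conc (l2 := l2) hp hc ht ht1 hqt hXt x hx)
    change (_ : ℝ) < _ at hω
    change (_ : ℝ) < _
    refine lt_of_le_of_lt ?_ hω
    have := mul_le_mul_of_nonneg_right hte hk0
    linarith
  · refine fun x hx => le_trans (measureReal_mono (fun ω hω => ?_) (measure_ne_top _ _))
      (H.conc (l2 := l2) hp hf haf haf1 hqf hXf x hx)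
    change (_ : ℝ) < _ at hω
    change (_ : ℝ) < _
    refine lt_of_le_of_lt ?_ hω
    have := mul_le_mul_of_nonneg_right hae hk0
    linarith

lemma mul_two_div_two_pow_rpow_le {p : ℝ} (hp : 2 < p) {n : ℕ} (hn : 2 ≤ n) (l : ℕ) :
    n * (2 / 2 ^ (l + n) : ℝ) ^ p ≤ 1 := by
  have h4 : (4 : ℝ) ≤ 2 ^ n := by
    calc (4 : ℝ) = 2 ^ 2 := by norm_num
      _ ≤ _ := pow_le_pow_right₀ (by norm_num) hn
  have hl : (2 : ℝ) ^ n ≤ 2 ^ (l + n) := pow_le_pow_right₀ (by norm_num) (by omega)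
  have hnn : (n : ℝ) ≤ 2 ^ n := by exact_mod_cast Nat.lt_two_pow_self.le
  have h1 : (2 / 2 ^ (l + n) : ℝ) ≤ 1 := (div_le_one (by positivity)).2 (by linarith)
  have h2 : (2 / 2 ^ (l + n) : ℝ) ^ p ≤ (2 / 2 ^ (l + n) : ℝ) ^ (2 : ℝ) :=
    rpow_le_rpow_of_exponent_ge (by positivity) h1 hp.le
  rw [rpow_two] at h2
  calc _ ≤ (2 : ℝ) ^ n * (2 / 2 ^ n) ^ 2 := by
        refine mul_le_mul hnn (h2.trans ?_) (by positivity) (by positivity)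
        gcongr
    _ = 4 / 2 ^ n := by field_simp; norm_num
    _ ≤ 1 := (div_le_one (by positivity)).2 h4

lemma pow_le_div_of_rate {q k s c a ε w : ℝ} {L N : ℕ} (hw : 1 ≤ w) (hq : 0 ≤ q) (hk : 1 ≤ k)
    (hs : s ≤ 1) (hqk : q ^ 2 * k ^ s ≤ c) (hc : c ≤ 1) (hca : c ≤ a) (hL : w ^ (4 * L) ≤ k ^ s)
    (hN : N ≠ 0) (hsN : 3 / 4 ≤ s * N) (hε : 1 ≤ ε ^ 2 * k) (hε0 : 0 ≤ ε) :
    q ^ (2 * N) ≤ a * ε / w ^ L := by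
  have hk0 : 0 < k := by linarith
  have hw0 : 0 < w ^ L := by positivity
  rw [le_div_iff₀ hw0]
  have hc0 : 0 ≤ c := le_trans (by positivity) hqk
  have h1 : q ^ (2 * N) * k ^ (s * N) ≤ a := by
    calc _ = (q ^ 2 * k ^ s) ^ N := by rw [mul_pow, ← pow_mul, rpow_mul hk0.le, rpow_natCast]
      _ ≤ c ^ N := pow_le_pow_left₀ (by positivity) hqk N
      _ ≤ c := pow_le_of_le_one hc0 hc hN
      _ ≤ a := hca
  have h2 : w ^ L ≤ k ^ (1 / 4 : ℝ) := by
    have : (w ^ L) ^ 4 ≤ (k ^ (1 / 4 : ℝ)) ^ 4 := by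
      calc (w ^ L) ^ 4 = w ^ (4 * L) := by rw [← pow_mul, mul_comm]
        _ ≤ k ^ s := hL
        _ ≤ k ^ (1 : ℝ) := rpow_le_rpow_of_exponent_le hk hs
        _ = _ := by
          rw [← rpow_natCast (k ^ (1 / 4 : ℝ)), ← rpow_mul hk0.le]
          norm_num
    exact le_of_pow_le_pow_left₀ (by norm_num) (by positivity) this
  have h3 : k ^ (-(1 / 2) : ℝ) ≤ ε := by
    refine le_of_pow_le_pow_left₀ two_ne_zero hε0 ?_
    rw [← rpow_natCast (k ^ (-(1 / 2) : ℝ)), ← rpow_mul hk0.le]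
    have : (-(1 / 2) : ℝ) * (2 : ℕ) = -1 := by norm_num
    rw [this, rpow_neg_one, inv_le_iff_one_le_mul₀ hk0]
    exact hε
  calc q ^ (2 * N) * w ^ L ≤ q ^ (2 * N) * k ^ (1 / 4 : ℝ) := by gcongr
    _ = q ^ (2 * N) * k ^ (3 / 4 : ℝ) * k ^ (-(1 / 2) : ℝ) := by
      rw [mul_assoc, ← rpow_add hk0]
      norm_num
    _ ≤ q ^ (2 * N) * k ^ (s * N) * ε := by
      gcongr
    _ ≤ a * ε := by gcongr

lemma log_one_div_bounds {N δ : ℝ} (h1 : (2 : ℝ) ^ (-N) ≤ δ) (h2 : δ ≤ 7 / 8) (hN : 0 ≤ N) :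
    exp (-log (1 / δ)) = δ ∧ 1 / 8 ≤ log (1 / δ) ∧ log (1 / δ) ≤ N := by
  have h0 : 0 < δ := lt_of_lt_of_le (by positivity) h1
  have h3 : log (1 / δ) = -log δ := by rw [one_div, log_inv]
  rw [h3]
  refine ⟨by rw [neg_neg, exp_log h0], ?_, ?_⟩
  · have := log_le_sub_one_of_pos h0
    linarith
  · have h4 := log_le_log (by positivity) h1
    rw [log_rpow (by norm_num)] at h4
    have h5 : log 2 ≤ 1 := by linarith [log_two_lt_d9]
    nlinarith

lemma exists_decay {A : ℝ} (hA : 0 < A) :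
    ∃ B, 8 ≤ B ∧ 18 * exp (-(B / 8)) ≤ 1 / 64 ∧
      ∀ Λ, 1 / 8 ≤ Λ → 3 * (A * exp (-(B * Λ))) ≤ exp (-Λ) := by
  set G := 1152 + 3 * A with hG
  have hG1 : 1 ≤ G := by linarith
  have hG0 : 0 < G := by linarith
  have hl : 0 ≤ log G := log_nonneg hG1
  refine ⟨8 + 8 * log G, by linarith, ?_, fun Λ hΛ => ?_⟩
  · have h1 : exp (-((8 + 8 * log G) / 8)) ≤ G⁻¹ := by
      rw [← exp_log (inv_pos.2 hG0), log_inv]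
      exact exp_le_exp.2 (by linarith)
    have h2 : G⁻¹ ≤ 1152⁻¹ := by
      gcongr
      linarith
    linarith
  · have h1 : exp (-((8 + 8 * log G) * Λ)) ≤ exp (-Λ) * G⁻¹ := by
      rw [← exp_log (inv_pos.2 hG0), log_inv, ← exp_add]
      refine exp_le_exp.2 ?_
      nlinarith
    have h2 : 3 * A * G⁻¹ ≤ 1 := by
      rw [← div_eq_mul_inv, div_le_one hG0]
      linarith
    have h3 := exp_pos (-Λ)
    calc 3 * (A * exp (-((8 + 8 * log G) * Λ))) ≤ 3 * (A * (exp (-Λ) * G⁻¹)) := by gcongr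
      _ = 3 * A * G⁻¹ * exp (-Λ) := by ring
      _ ≤ 1 * exp (-Λ) := by gcongr
      _ = _ := one_mul _

lemma scale_le {p ε Λ C₁ l k : ℝ} (hp : 2 < p) (hε : 0 < ε) (hΛ : 0 ≤ Λ) (hC₁ : 1 ≤ C₁)
    (hl : 0 ≤ l) (hk : k = C₁ * (ε ^ (-2 : ℝ) * Λ)) :
    k + k ^ (2 / p) * l ≤
      C₁ * (ε ^ (-2 : ℝ) * Λ + ε ^ (-(4 / p)) * Λ ^ (2 / p) * l) := by
  have hp0 : 0 < p := by linarith
  have h1 : k ^ (2 / p) = C₁ ^ (2 / p) * (ε ^ (-(4 / p)) * Λ ^ (2 / p)) := by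
    rw [hk, mul_rpow (by linarith) (by positivity), mul_rpow (by positivity) hΛ,
      ← rpow_mul hε.le]
    ring_nf
  have h2 : C₁ ^ (2 / p) ≤ C₁ := by
    calc _ ≤ C₁ ^ (1 : ℝ) :=
          rpow_le_rpow_of_exponent_le hC₁ ((div_le_one hp0).2 hp.le)
      _ = C₁ := rpow_one _
  have h3 : 0 ≤ ε ^ (-(4 / p)) * Λ ^ (2 / p) * l := by positivity
  have h4 := mul_le_mul_of_nonneg_right h2 h3
  rw [h1, hk]
  linarith

set_option maxHeartbeats 1000000 in
/-- Rates for the sampled sketch, up to constants depending only on `p`. -/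
lemma exists_scheme_sampled {p : ℝ} (hp : 2 < p) :
    ∃ C C₁ : ℝ, 0 < C ∧ 1 ≤ C₁ ∧ ∀ (n : ℕ) (ε δ : ℝ), 2 ≤ n → 0 < ε → ε < 1 →
      (2 : ℝ) ^ (-((n : ℝ) ^ ((1 - 2 / p) ^ 2))) ≤ δ → δ ≤ 7 / 8 →
      ε ^ (-2 : ℝ) * log (1 / δ) ≤ n →
      ∃ (r : ℕ) (ρ : Measure (Fin r → Fin n → ℝ)) (f : (Fin r → Fin n → ℝ) → (Fin r → ℝ) → ℝ),
        (r : ℝ) ≤ C * ((n : ℝ) ^ (1 - 2 / p) *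
          (C₁ * (ε ^ (-2 : ℝ) * log (1 / δ) +
            ε ^ (-(4 / p)) * log (1 / δ) ^ (2 / p) * log n))) ∧
        IsSketchingScheme p n r ε δ ρ f := by
  have hp0 : 0 < p := by linarith
  have hs1 : 1 - 2 / p ≤ 1 := by
    have : 0 < 2 / p := by positivity
    linarith
  have hs0 : 0 < 1 - 2 / p := by
    have : 2 / p < 1 := by rwa [div_lt_one hp0]
    linarith
  obtain ⟨w, hw, hwp⟩ : ∃ w : ℝ, 1 < w ∧ (2 : ℝ) ^ p = 4 * w ^ 4 := by
    refine ⟨2 ^ ((p - 2) / 4), one_lt_rpow (by norm_num) (by linarith), ?_⟩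
    rw [← rpow_natCast ((2 : ℝ) ^ ((p - 2) / 4)), ← rpow_mul (by norm_num)]
    have : (p - 2) / 4 * (4 : ℕ) = p - 2 := by push_cast; ring
    rw [this, rpow_sub (by norm_num), rpow_two]
    ring
  have hA : 0 < 15 * (1 / (1 - exp (-(w ^ 2 - 1)))) + 20 := by
    have h1 : exp (-(w ^ 2 - 1)) < 1 := by
      rw [exp_lt_one_iff]
      nlinarith
    have : 0 < 1 / (1 - exp (-(w ^ 2 - 1))) := one_div_pos.2 (by linarith)
    linarith
  obtain ⟨B, hB, hB', hBδ⟩ := exists_decay hA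
  set D := 4 * (1 / (1 - w⁻¹)) + 10 with hD
  have hD0 : 10 ≤ D := by
    have h1 : w⁻¹ < 1 := inv_lt_one_of_one_lt₀ hw
    have : 0 < 1 / (1 - w⁻¹) := one_div_pos.2 (by linarith)
    linarith
  obtain ⟨J, hJ⟩ := exists_nat_ge (3 / 4 / (1 - 2 / p))
  have hJ' : 3 / 4 ≤ (1 - 2 / p) * (J + 1 : ℕ) := by
    rw [div_le_iff₀ hs0] at hJ
    push_cast
    linarith
  obtain ⟨Cf, hf⟩ := (bump_shell p).estimates J
  obtain ⟨Cc, hc⟩ := estimates_cut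
  have hCf := hf.one_le
  have hCc := hc.one_le
  set V : ℝ := 4 * (2 ^ p) ^ 2 with hV
  have h2p := four_le_two_rpow hp
  have hV1 : 1 ≤ V := by nlinarith
  have h256 : (1 : ℝ) ≤ 256 ^ p := one_le_rpow (by norm_num) hp0.le
  have h4 : (4⁻¹ : ℝ) ^ p ≤ 1 := rpow_le_one (by norm_num) (by norm_num) hp0.le
  have hDCf : 1 ≤ D * Cf * V := by
    have : 1 ≤ D * Cf := by nlinarith
    nlinarith
  have hDCc : 1 ≤ D * Cc * V := by
    have : 1 ≤ D * Cc := by nlinarith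
    nlinarith
  set t := 4⁻¹ ^ p / 16 / (D * Cc * V) with ht
  have ht0 : 0 < t := by positivity
  have ht1 : t ≤ 1 := by
    rw [ht, div_le_one (by positivity)]
    linarith
  have hte : D * Cc * t * V ≤ 4⁻¹ ^ p / 16 := by
    rw [ht]
    apply le_of_eq
    field_simp
  set a := 1 / (2 * 256 ^ p) / (D * Cf * V) with ha
  have ha0 : 0 < a := by positivity
  have ha1 : a ≤ 1 := by
    rw [ha, div_le_one (by positivity)]
    refine le_trans ?_ hDCf
    rw [div_le_one (by positivity)]
    linarith
  set c₃ := min (1 / 64) (min a (t ^ 2)) with hc₃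
  have hc₃0 : 0 < c₃ := by positivity
  have hc₃1 : c₃ ≤ 1 / 64 := min_le_left _ _
  have hc₃a : c₃ ≤ a := (min_le_right _ _).trans (min_le_left _ _)
  have hc₃t : c₃ ≤ t ^ 2 := (min_le_right _ _).trans (min_le_right _ _)
  set Xf := a ^ 2 * V / (2048 * Cf ^ 2) with hXf
  set Xt := t ^ 2 * V / (2048 * Cc ^ 2) with hXt
  have hXf0 : 0 < Xf := by positivity
  have hXt0 : 0 < Xt := by positivity
  set C₁ := 16 + 16 * 256 ^ p + B / Xf + B / Xt with hC₁
  have hBf : 0 ≤ B / Xf := by positivity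
  have hBt : 0 ≤ B / Xt := by positivity
  have hC16 : 16 ≤ C₁ := by linarith
  have hC256 : 16 * 256 ^ p ≤ C₁ := by linarith
  have hCXf : B ≤ C₁ * Xf := by
    rw [← div_le_iff₀ hXf0]
    linarith
  have hCXt : B ≤ C₁ * Xt := by
    rw [← div_le_iff₀ hXt0]
    linarith
  obtain ⟨C, hC0, hC⟩ := exists_params hp hw hwp hB hB' hc₃0 hc₃1 (show 1 ≤ C₁ by linarith)
  refine ⟨C, C₁, hC0, by linarith, fun n ε δ hn hε hε1 hδ hδ' hle => ?_⟩
  obtain ⟨hexp, hΛ, hΛn⟩ := log_one_div_bounds hδ hδ' (by positivity)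
  set Λ := log (1 / δ) with hΛdef
  have hn1 : (1 : ℝ) ≤ n := by exact_mod_cast (by omega : 1 ≤ n)
  set k := C₁ * (ε ^ (-2 : ℝ) * Λ) with hk
  have hεk : ε ^ 2 * k = C₁ * Λ := by
    rw [hk, rpow_neg hε.le, rpow_two]
    field_simp
  have hε2 : ε ^ 2 ≤ 1 := pow_le_one₀ hε.le hε1.le
  have hk0 : 0 ≤ k := by positivity
  have hkC : C₁ * Λ ≤ k := by
    rw [← hεk]
    exact mul_le_of_le_one_left hk0 hε2
  have hCΛ : 2 ≤ C₁ * Λ := by nlinarith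
  have hk2 : 2 ≤ k := by linarith
  obtain ⟨q, m, mT, l1, L, T, H, hT, hL1, hL2, hqk, hr⟩ := hC n Λ k hn hΛ hΛn (by linarith) (by
    rw [hk]
    gcongr)
  have hLs := pow_le_rpow_of_rate hp hwp hL1
  have hw0 : 0 < w := by linarith
  have hae : D * Cf * (a * ε) * V ≤ ε / (2 * 256 ^ p) := by
    rw [ha]
    apply le_of_eq
    field_simp
  have hek : 1 ≤ ε / (2 * 256 ^ p) * k := by
    rw [div_mul_eq_mul_div, le_div_iff₀ (by positivity)]
    have h1 : C₁ * Λ ≤ ε * k := by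
      rw [← hεk, sq, mul_assoc]
      exact mul_le_of_le_one_left (by positivity) hε1.le
    have h2 := mul_le_mul hC256 hΛ (by norm_num) (by linarith)
    linarith
  have hqt : q ^ 1 ≤ t / w ^ L := by
    rw [pow_one, le_div_iff₀ (by positivity)]
    refine le_of_pow_le_pow_left₀ two_ne_zero ht0.le (le_trans ?_ hc₃t)
    refine le_trans ?_ hqk
    rw [mul_pow, ← pow_mul]
    refine mul_le_mul_of_nonneg_left ?_ (sq_nonneg q)
    exact (pow_le_pow_right₀ hw.le (by omega)).trans hLs
  have hqf := pow_le_div_of_rate (ε := ε) hw.le H.hq0.le (by linarith) hs1 hqk (by linarith) hc₃a hLs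
    (Nat.succ_ne_zero J) hJ' (by linarith) hε.le
  have hΛ0 : 0 ≤ Λ := by linarith
  have hXt' : B * Λ ≤ t ^ 2 * (V * k) / (2048 * Cc ^ 2) := by
    have h1 : t ^ 2 * (V * k) / (2048 * Cc ^ 2) = Xt * k := by
      rw [hXt]
      ring
    rw [h1]
    have h2 := mul_le_mul_of_nonneg_left hkC hXt0.le
    have h3 := mul_le_mul_of_nonneg_right hCXt hΛ0
    linarith
  have hXf' : B * Λ ≤ (a * ε) ^ 2 * (V * k) / (2048 * Cf ^ 2) := by
    have h1 : (a * ε) ^ 2 * (V * k) / (2048 * Cf ^ 2) = Xf * (ε ^ 2 * k) := by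
      rw [hXf]
      ring
    rw [h1, hεk]
    have h3 := mul_le_mul_of_nonneg_right hCXf hΛ0
    linarith
  have hdec := hBδ Λ hΛ
  rw [hexp] at hdec
  obtain ⟨ρ, f, hρ⟩ := exists_scheme_of_params (l2 := l1 + n) (af := a) (ε := ε) (δ := δ) (t := t)
    H hp hT hf hc (Nat.le_add_right _ _) (mul_two_div_two_pow_rpow_le hp hn l1) hk2 hL2 ht0 ht1
    (mul_pos ha0 hε) (mul_le_one₀ ha1 hε.le hε1.le) hte hae hek hqt hqf hXt' hXf' hdec
  refine ⟨_, ρ, f, hr.trans ?_, hρ⟩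
  gcongr
  exact scale_le hp hε (by linarith) (by linarith) (log_nonneg hn1) hk

end FpSketch

/-- Upper bound: existence of an `(ε,δ)`-sketching scheme for `F_p`, `p > 2`, with optimal
sketching dimension. -/
theorem fp_sketching_dimension_upper_bound (p : ℝ) (hp : 2 < p) :
    ∃ K c₀ : ℝ, 0 < K ∧ 0 < c₀ ∧
      ∀ (n : ℕ), 2 ≤ n →
      ∀ ε δ : ℝ, 0 < ε → ε < 1 →
        (2 : ℝ) ^ (-((n : ℝ) ^ c₀)) ≤ δ → δ ≤ 7 / 8 →
        ∃ (r : ℕ) (ρ : Measure (Fin r → Fin n → ℝ))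
          (f : (Fin r → Fin n → ℝ) → (Fin r → ℝ) → ℝ),
          (r : ℝ) ≤ K * min (n : ℝ)
              ((n : ℝ) ^ (1 - 2 / p) *
                (ε ^ (-2 : ℝ) * Real.log (1 / δ) +
                  ε ^ (-(4 / p)) * Real.log (1 / δ) ^ (2 / p) * Real.log n)) ∧
          IsSketchingScheme p n r ε δ ρ f := by
  have hp0 : 0 < p := by linarith
  have hs0 : 0 < 1 - 2 / p := by
    have : 2 / p < 1 := by rwa [div_lt_one hp0]
    linarith
  obtain ⟨C, C₁, hC, hC₁, hS⟩ := FpSketch.exists_scheme_sampled hp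
  refine ⟨max 1 (C * C₁), (1 - 2 / p) ^ 2, by positivity, by positivity,
    fun n hn ε δ hε hε1 hδ hδ' => ?_⟩
  obtain ⟨-, hΛ, -⟩ := FpSketch.log_one_div_bounds hδ hδ' (by positivity)
  have hn1 : (1 : ℝ) ≤ n := by exact_mod_cast (by omega : 1 ≤ n)
  have hlog : 0 ≤ Real.log n := Real.log_nonneg hn1
  set Bd := (n : ℝ) ^ (1 - 2 / p) * (ε ^ (-2 : ℝ) * Real.log (1 / δ) +
    ε ^ (-(4 / p)) * Real.log (1 / δ) ^ (2 / p) * Real.log n) with hBd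
  rcases le_or_gt Bd n with h | h
  · have h1 : 1 ≤ (n : ℝ) ^ (1 - 2 / p) := Real.one_le_rpow hn1 hs0.le
    have h2 : 0 ≤ ε ^ (-(4 / p)) * Real.log (1 / δ) ^ (2 / p) * Real.log n := by positivity
    have h3 : 0 ≤ ε ^ (-2 : ℝ) * Real.log (1 / δ) := by positivity
    have h4 : ε ^ (-2 : ℝ) * Real.log (1 / δ) ≤ Bd := by
      rw [hBd]
      nlinarith
    obtain ⟨r, ρ, f, hr, hρ⟩ := hS n ε δ hn hε hε1 hδ hδ' (h4.trans h)
    refine ⟨r, ρ, f, ?_, hρ⟩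
    rw [min_eq_right h]
    calc (r : ℝ) ≤ _ := hr
      _ = C * C₁ * Bd := by rw [hBd]; ring
      _ ≤ _ := mul_le_mul_of_nonneg_right (le_max_right _ _) (h3.trans h4)
  · obtain ⟨ρ, f, hρ⟩ := FpSketch.exists_scheme_self p n hε.le
      (le_trans (by positivity) hδ : (0 : ℝ) ≤ δ)
    refine ⟨n, ρ, f, ?_, hρ⟩
    rw [min_eq_left h.le]
    exact le_mul_of_one_le_left (by linarith) (le_max_left _ _)
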